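/- arXiv:2409.00382 — 8 statements merged into one kernel-verified Lean document; each statement's English description precedes it below -/
import Mathlib

section
/- Let k > 0 and let V_k(r) = 1/(r^2 (1 - log r)^{2+k}) for 0 < r < e. For every β ∈ ℝ there exists a unique function v ∈ C^0([0, e)) ∩ C^2((0, e)) with v(0) = β satisfying v''(r) + v'(r)/r + V_k(r) e^{v(r)} = 0 for all 0 < r < e. Moreover this solution satisfies the integral equation v(r) = β - ∫_0^r (1/s) (∫_0^s t·V_k(t)·e^{v(t)} dt) ds for all 0 ≤ r < e. -/
open Filter Topology Set MeasureTheory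

/-- The weight `V_k(r) = 1/(r^2 (1 - log r)^(2+k))`. -/
noncomputable def Vk (k r : ℝ) : ℝ := 1 / (r ^ 2 * (1 - Real.log r) ^ (2 + k))

/-- `v` is a `C²` solution of `v'' + v'/r + V_k(r) e^v = 0` on `(0, e)`,
with first and second derivatives `v'` and `v''`. -/
def IsSolExp (k : ℝ) (v v' v'' : ℝ → ℝ) : Prop :=
  (∀ r ∈ Set.Ioo (0 : ℝ) (Real.exp 1), HasDerivAt v (v' r) r) ∧
  (∀ r ∈ Set.Ioo (0 : ℝ) (Real.exp 1), HasDerivAt v' (v'' r) r) ∧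
  ContinuousOn v'' (Set.Ioo (0 : ℝ) (Real.exp 1)) ∧
  (∀ r ∈ Set.Ioo (0 : ℝ) (Real.exp 1),
    v'' r + v' r / r + Vk k r * Real.exp (v r) = 0)


lemma keyK (b : ℝ) (G G' h : ℝ → ℝ) (hG : ContinuousOn G (Ico 0 b))
    (hG' : ∀ r ∈ Ioo 0 b, HasDerivAt G (G' r) r)
    (hh : ContinuousOn h (Ioo 0 b)) (hb : ∀ r ∈ Ioo 0 b, |h r| ≤ G' r) :
    (∀ r ∈ Ico 0 b, IntervalIntegrable h volume 0 r ∧ |∫ t in (0:ℝ)..r, h t| ≤ G r - G 0) ∧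
    ContinuousOn (fun r => ∫ t in (0:ℝ)..r, h t) (Ico 0 b) ∧
    (∀ r ∈ Ioo 0 b, HasDerivAt (fun r => ∫ t in (0:ℝ)..r, h t) (h r) r) := by
  have hGi : ∀ r ∈ Ico 0 b, IntervalIntegrable G' volume 0 r := by
    intro r hr
    rw [intervalIntegrable_iff_integrableOn_Ioc_of_le hr.1]
    apply intervalIntegral.integrableOn_deriv_of_nonneg (g := G)
    · exact hG.mono (fun x hx => ⟨hx.1, hx.2.trans_lt hr.2⟩)
    · intro x hx
      exact hG' x ⟨hx.1, hx.2.trans hr.2⟩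
    · intro x hx
      exact (abs_nonneg _).trans (hb x ⟨hx.1, hx.2.trans hr.2⟩)
  have hi : ∀ r ∈ Ico 0 b, IntervalIntegrable h volume 0 r := by
    intro r hr
    refine (hGi r hr).mono_fun ?_ ?_
    · rw [uIoc_of_le hr.1]
      exact (hh.mono (fun x hx => ⟨hx.1, hx.2.trans_lt hr.2⟩)).aestronglyMeasurable
        measurableSet_Ioc
    · rw [uIoc_of_le hr.1]
      filter_upwards [ae_restrict_mem measurableSet_Ioc] with x hx
      have := hb x ⟨hx.1, hx.2.trans_lt hr.2⟩
      rw [Real.norm_eq_abs, Real.norm_eq_abs]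
      exact this.trans (le_abs_self _)
  refine ⟨fun r hr => ⟨hi r hr, ?_⟩, ?_, ?_⟩
  · have e : ∫ t in (0:ℝ)..r, G' t = G r - G 0 := by
      apply intervalIntegral.integral_eq_sub_of_hasDerivAt_of_le hr.1
      · exact hG.mono (fun x hx => ⟨hx.1, hx.2.trans_lt hr.2⟩)
      · intro x hx
        exact hG' x ⟨hx.1, hx.2.trans hr.2⟩
      · exact hGi r hr
    rw [← e, ← Real.norm_eq_abs]
    apply intervalIntegral.norm_integral_le_of_norm_le hr.1 _ (hGi r hr)
    filter_upwards with x hx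
    exact hb x ⟨hx.1, hx.2.trans_lt hr.2⟩
  · intro r hr
    obtain ⟨c, hc1, hc2⟩ := exists_between hr.2
    have hc0 : 0 ≤ c := hr.1.trans hc1.le
    have := intervalIntegral.continuousOn_primitive_interval'
      (hi c ⟨hc0, hc2⟩) (a := 0) (left_mem_uIcc)
    rw [uIcc_of_le hc0] at this
    have h2 := this r ⟨hr.1, hc1.le⟩
    refine h2.mono_of_mem_nhdsWithin ?_
    have : Iio c ∈ 𝓝 r := Iio_mem_nhds hc1
    filter_upwards [mem_nhdsWithin_of_mem_nhds this, self_mem_nhdsWithin] with x hx hx2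
    exact ⟨hx2.1, le_of_lt hx⟩
  · intro r hr
    apply intervalIntegral.integral_hasDerivAt_right (hi r ⟨hr.1.le, hr.2⟩)
    · exact hh.stronglyMeasurableAtFilter isOpen_Ioo r hr
    · exact hh.continuousAt (isOpen_Ioo.mem_nhds hr)


noncomputable def PhiA (k A r : ℝ) : ℝ :=
  if r ≤ 0 then 1 else Real.exp (A * (1 - Real.log r) ^ (-k))

noncomputable def PsiA (k A r : ℝ) : ℝ :=
  if r ≤ 0 then 0 else k * A * (1 - Real.log r) ^ (-k - 1) * Real.exp (A * (1 - Real.log r) ^ (-k))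

lemma X_pos {r : ℝ} (hr : r ∈ Ioo 0 (Real.exp 1)) : 0 < 1 - Real.log r := by
  have := Real.log_lt_log hr.1 hr.2
  rw [Real.log_exp] at this
  linarith

lemma X_deriv {r : ℝ} (hr : r ∈ Ioo 0 (Real.exp 1)) (p : ℝ) :
    HasDerivAt (fun r => (1 - Real.log r) ^ (-p)) (p * (1 - Real.log r) ^ (-p - 1) / r) r := by
  have h1 : HasDerivAt (fun r => 1 - Real.log r) (-(r⁻¹)) r := by
    simpa using (Real.hasDerivAt_log hr.1.ne').const_sub 1
  have := h1.rpow_const (p := -p) (Or.inl (X_pos hr).ne')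
  convert this using 1
  field_simp

lemma X_tendsto {p : ℝ} (hp : 0 < p) :
    Tendsto (fun r => (1 - Real.log r) ^ (-p)) (𝓝[>] 0) (𝓝 0) := by
  have h1 : Tendsto (fun r => 1 - Real.log r) (𝓝[>] 0) atTop := by
    have := tendsto_neg_atBot_atTop.comp Real.tendsto_log_nhdsGT_zero
    simpa [sub_eq_add_neg] using tendsto_atTop_add_const_left _ (1:ℝ) this
  exact (tendsto_rpow_neg_atTop hp).comp h1

lemma Phi_deriv {r : ℝ} (hr : r ∈ Ioo 0 (Real.exp 1)) (k A : ℝ) :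
    HasDerivAt (PhiA k A) (1 / r * PsiA k A r) r := by
  have h := ((X_deriv hr k).const_mul A).exp
  have h2 : HasDerivAt (fun r => Real.exp (A * (1 - Real.log r) ^ (-k))) (1 / r * PsiA k A r) r := by
    convert h using 1
    simp only [PsiA, not_le.2 hr.1, if_false]
    ring
  refine h2.congr_of_eventuallyEq ?_
  filter_upwards [Ioi_mem_nhds hr.1] with x hx
  simp only [PhiA, not_le.2 (show 0 < x from hx), if_false]

lemma Psi_deriv {r : ℝ} (hr : r ∈ Ioo 0 (Real.exp 1)) (k A : ℝ) :
    HasDerivAt (PsiA k A) (k * (k + 1) * A * ((1 - Real.log r) ^ (-k - 2) / r) * PhiA k A r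
      + (k * A * (1 - Real.log r) ^ (-k - 1)) ^ 2 / r * PhiA k A r) r := by
  have h := ((X_deriv hr k).const_mul A).exp
  have h1 := ((X_deriv hr (k + 1)).const_mul (k * A)).mul h
  have e1 : -(k+1) = -k - 1 := by ring
  have e2 : -k - 1 - 1 = -k - 2 := by ring
  simp only [e1, e2] at h1
  have h2 : HasDerivAt (fun r => k * A * (1 - Real.log r) ^ (-k - 1) *
      Real.exp (A * (1 - Real.log r) ^ (-k))) (k * (k + 1) * A * ((1 - Real.log r) ^ (-k - 2) / r) * PhiA k A r
      + (k * A * (1 - Real.log r) ^ (-k - 1)) ^ 2 / r * PhiA k A r) r := by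
    have e3 : PhiA k A r = Real.exp (A * (1 - Real.log r) ^ (-k)) := by
      simp only [PhiA, not_le.2 hr.1, if_false]
    rw [e3]
    refine HasDerivAt.congr_deriv h1 ?_
    ring
  refine h2.congr_of_eventuallyEq ?_
  filter_upwards [Ioi_mem_nhds hr.1] with x hx
  simp only [PsiA, not_le.2 (show 0 < x from hx), if_false]

lemma cont_Ico {f : ℝ → ℝ} {b : ℝ} (h : ∀ r ∈ Ioo 0 b, ContinuousAt f r)
    (h0 : Tendsto f (𝓝[>] 0) (𝓝 (f 0))) : ContinuousOn f (Ico 0 b) := by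
  intro r hr
  rcases hr.1.eq_or_lt with h1 | h1
  · subst h1
    have : ContinuousWithinAt f (Ioi 0) 0 := h0
    have h3 : ContinuousWithinAt f (Ici 0) 0 := continuousWithinAt_Ioi_iff_Ici.1 this
    exact h3.mono Ico_subset_Ici_self
  · exact (h r ⟨h1, hr.2⟩).continuousWithinAt

lemma Phi_cont {k : ℝ} (hk : 0 < k) (A : ℝ) : ContinuousOn (PhiA k A) (Ico 0 (Real.exp 1)) := by
  apply cont_Ico (fun r hr => (Phi_deriv hr k A).continuousAt)
  have h := (Real.continuous_exp.tendsto _).comp ((X_tendsto hk).const_mul A)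
  simp only [mul_zero, Real.exp_zero] at h
  have e : PhiA k A 0 = 1 := by simp [PhiA]
  rw [e]
  refine h.congr' ?_
  filter_upwards [self_mem_nhdsWithin] with x hx
  simp only [PhiA, not_le.2 (show 0 < x from hx), if_false, Function.comp]

lemma Psi_cont {k : ℝ} (hk : 0 < k) (A : ℝ) : ContinuousOn (PsiA k A) (Ico 0 (Real.exp 1)) := by
  apply cont_Ico (fun r hr => (Psi_deriv hr k A).continuousAt)
  have h := (Real.continuous_exp.tendsto _).comp ((X_tendsto hk).const_mul A)
  have h1 := ((X_tendsto (show 0 < k + 1 by linarith)).const_mul (k * A)).mul h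
  simp only [mul_zero, zero_mul] at h1
  have e : PsiA k A 0 = 0 := by simp [PsiA]
  rw [e]
  refine h1.congr' ?_
  filter_upwards [self_mem_nhdsWithin] with x hx
  have e1 : -(k+1) = -k - 1 := by ring
  simp only [PsiA, not_le.2 (show 0 < x from hx), if_false, Function.comp, e1]

lemma Phi_ge {k A r : ℝ} (hA : 0 ≤ A) (hr : r ∈ Ioo 0 (Real.exp 1)) : 1 ≤ PhiA k A r := by
  simp only [PhiA, not_le.2 hr.1, if_false]
  exact Real.one_le_exp (mul_nonneg hA (Real.rpow_nonneg (X_pos hr).le _))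

lemma Q_eq {k r : ℝ} (hr : r ∈ Ioo 0 (Real.exp 1)) :
    r * Vk k r = (1 - Real.log r) ^ (-k - 2) / r := by
  have e : -k - 2 = -(2 + k) := by ring
  have := hr.1.ne'
  rw [e, Real.rpow_neg (X_pos hr).le, Vk]
  field_simp

lemma Q_pos {k r : ℝ} (hr : r ∈ Ioo 0 (Real.exp 1)) : 0 < r * Vk k r := by
  rw [Q_eq hr]
  exact div_pos (Real.rpow_pos_of_pos (X_pos hr) _) hr.1

lemma Q_cont (k : ℝ) : ContinuousOn (fun r => r * Vk k r) (Ioo 0 (Real.exp 1)) := by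
  have : ContinuousOn (fun r => (1 - Real.log r) ^ (-k - 2) / r) (Ioo 0 (Real.exp 1)) := by
    intro r hr
    have h := (X_deriv hr (k + 2)).continuousAt
    have e : -(k + 2) = -k - 2 := by ring
    rw [e] at h
    exact (h.div continuousAt_id hr.1.ne').continuousWithinAt
  exact this.congr (fun r hr => Q_eq hr)

noncomputable def JJ (h : ℝ → ℝ) (r : ℝ) : ℝ :=
  ∫ s in (0 : ℝ)..r, (1 / s) * ∫ t in (0 : ℝ)..s, h t

/-- main estimate -/
lemma J_main {k A B : ℝ} (hk : 0 < k) (hA : 0 ≤ A) (hAB : k * (k + 1) * A = B) (C : ℝ) (hC : 0 ≤ C)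
    (h : ℝ → ℝ) (hh : ContinuousOn h (Ioo 0 (Real.exp 1)))
    (hb : ∀ r ∈ Ioo 0 (Real.exp 1), |h r| ≤ C * B * (r * Vk k r) * PhiA k A r) :
    (∀ r ∈ Ico 0 (Real.exp 1), IntervalIntegrable h volume 0 r) ∧
    (∀ r ∈ Ico 0 (Real.exp 1),
      IntervalIntegrable (fun s => (1 / s) * ∫ t in (0 : ℝ)..s, h t) volume 0 r) ∧
    (∀ r ∈ Ico 0 (Real.exp 1), |JJ h r| ≤ C * (PhiA k A r - 1)) ∧
    ContinuousOn (JJ h) (Ico 0 (Real.exp 1)) ∧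
    (∀ r ∈ Ioo 0 (Real.exp 1), HasDerivAt (fun r => ∫ t in (0:ℝ)..r, h t) (h r) r) ∧
    (∀ r ∈ Ioo 0 (Real.exp 1), HasDerivAt (JJ h) ((1 / r) * ∫ t in (0:ℝ)..r, h t) r) := by
  obtain ⟨a1, a2, a3⟩ := keyK (Real.exp 1) (fun r => C * PsiA k A r) _ h
    ((Psi_cont hk A).const_smul C) (fun r hr => (Psi_deriv hr k A).const_mul C) hh (by
      intro r hr
      refine (hb r hr).trans ?_
      rw [Q_eq hr, ← hAB]
      have h1 : 0 ≤ C * ((k * A * (1 - Real.log r) ^ (-k - 1)) ^ 2 / r * PhiA k A r) := by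
        have := Phi_ge (k := k) hA hr
        have := hr.1
        positivity
      linarith)
  obtain ⟨b1, b2, b3⟩ := keyK (Real.exp 1) (fun r => C * PhiA k A r) _
    (fun s => (1 / s) * ∫ t in (0 : ℝ)..s, h t)
    ((Phi_cont hk A).const_smul C) (fun r hr => (Phi_deriv hr k A).const_mul C) (by
      intro r hr
      exact ((continuousAt_const.div continuousAt_id hr.1.ne').mul
        (a3 r hr).continuousAt).continuousWithinAt) (by
      intro r hr
      have h1 := (a1 r ⟨hr.1.le, hr.2⟩).2
      have e : PsiA k A 0 = 0 := by simp [PsiA]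
      simp only [e, mul_zero, sub_zero] at h1
      have h0 : 0 < 1 / r := one_div_pos.2 hr.1
      rw [abs_mul, abs_of_pos h0]
      calc _ ≤ 1 / r * (C * PsiA k A r) := by gcongr
        _ = _ := by ring)
  refine ⟨fun r hr => (a1 r hr).1, fun r hr => (b1 r hr).1, fun r hr => ?_, b2, a3, b3⟩
  have := (b1 r hr).2
  have e : PhiA k A 0 = 1 := by simp [PhiA]
  rw [e, ← mul_sub] at this
  exact this

lemma J_nonneg {h : ℝ → ℝ} (h0 : ∀ r ∈ Ico 0 (Real.exp 1), 0 ≤ h r) {r : ℝ}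
    (hr : r ∈ Ico 0 (Real.exp 1)) : 0 ≤ JJ h r := by
  apply intervalIntegral.integral_nonneg hr.1
  intro s hs
  apply mul_nonneg (one_div_nonneg.2 hs.1)
  apply intervalIntegral.integral_nonneg hs.1
  intro t ht
  exact h0 t ⟨ht.1, (ht.2.trans hs.2).trans_lt hr.2⟩

lemma J_congr {h h' : ℝ → ℝ} (h0 : ∀ r ∈ Ico 0 (Real.exp 1), h r = h' r) {r : ℝ}
    (hr : r ∈ Ico 0 (Real.exp 1)) : JJ h r = JJ h' r := by
  apply intervalIntegral.integral_congr
  intro s hs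
  rw [uIcc_of_le hr.1] at hs
  have : ∫ t in (0 : ℝ)..s, h t = ∫ t in (0 : ℝ)..s, h' t := by
    apply intervalIntegral.integral_congr
    intro t ht
    rw [uIcc_of_le hs.1] at ht
    exact h0 t ⟨ht.1, (ht.2.trans hs.2).trans_lt hr.2⟩
  simp only [this]

lemma J_diff {k A β : ℝ} (hk : 0 < k) (hA : 0 ≤ A) (hAB : k * (k + 1) * A = 2 * Real.exp β)
    (M : ℝ) (hM : 0 ≤ M) (f g : ℝ → ℝ)
    (hf : ContinuousOn f (Ioo 0 (Real.exp 1))) (hg : ContinuousOn g (Ioo 0 (Real.exp 1)))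
    (fb : ∀ r ∈ Ioo 0 (Real.exp 1), f r ≤ β) (gb : ∀ r ∈ Ioo 0 (Real.exp 1), g r ≤ β)
    (hb : ∀ r ∈ Ioo 0 (Real.exp 1), |f r - g r| ≤ M * PhiA k A r) :
    ∀ r ∈ Ico 0 (Real.exp 1), |JJ (fun t => t * Vk k t * Real.exp (f t)) r -
      JJ (fun t => t * Vk k t * Real.exp (g t)) r| ≤ M / 2 * (PhiA k A r - 1) := by
  have cont : ∀ f : ℝ → ℝ, ContinuousOn f (Ioo 0 (Real.exp 1)) →
      ContinuousOn (fun t => t * Vk k t * Real.exp (f t)) (Ioo 0 (Real.exp 1)) := fun f hf =>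
    (Q_cont k).mul (Real.continuous_exp.comp_continuousOn hf)
  have bd : ∀ f : ℝ → ℝ, (∀ r ∈ Ioo 0 (Real.exp 1), f r ≤ β) → ∀ r ∈ Ioo 0 (Real.exp 1),
      |r * Vk k r * Real.exp (f r)| ≤ (1/2) * (2 * Real.exp β) * (r * Vk k r) * PhiA k A r := by
    intro f fb r hr
    have h1 := Q_pos (k := k) hr
    have h2 := Phi_ge (k := k) hA hr
    have h3 := Real.exp_le_exp.2 (fb r hr)
    rw [abs_of_pos (by positivity)]
    calc _ ≤ r * Vk k r * Real.exp β * 1 := by rw [mul_one]; gcongr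
      _ ≤ r * Vk k r * Real.exp β * PhiA k A r := by gcongr
      _ = _ := by ring
  obtain ⟨f1, f2, -⟩ := J_main hk hA hAB (1/2) (by norm_num) _ (cont f hf) (bd f fb)
  obtain ⟨g1, g2, -⟩ := J_main hk hA hAB (1/2) (by norm_num) _ (cont g hg) (bd g gb)
  obtain ⟨-, -, d, -⟩ := J_main hk hA hAB (M/2) (by positivity)
    (fun t => t * Vk k t * Real.exp (f t) - t * Vk k t * Real.exp (g t))
    ((cont f hf).sub (cont g hg)) (by
      intro r hr
      have h1 := Q_pos (k := k) hr
      have h2 : |Real.exp (f r) - Real.exp (g r)| ≤ Real.exp β * |f r - g r| := by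
        have key : ∀ a b : ℝ, a ≤ b → b ≤ β → Real.exp b - Real.exp a ≤ Real.exp β * (b - a) := by
          intro a b hab hb
          have e1 : Real.exp a = Real.exp b * Real.exp (a - b) := by
            rw [← Real.exp_add]; ring_nf
          have e2 := Real.add_one_le_exp (a - b)
          have e3 := Real.exp_le_exp.2 hb
          have e4 := Real.exp_pos b
          rw [e1]
          nlinarith
        rcases le_total (f r) (g r) with h | h
        · rw [abs_sub_comm, abs_sub_comm (f r), abs_of_nonneg (sub_nonneg.2 h),
            abs_of_nonneg (sub_nonneg.2 (Real.exp_le_exp.2 h))]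
          exact key _ _ h (gb r hr)
        · rw [abs_of_nonneg (sub_nonneg.2 h),
            abs_of_nonneg (sub_nonneg.2 (Real.exp_le_exp.2 h))]
          exact key _ _ h (fb r hr)
      rw [← mul_sub, abs_mul, abs_of_pos h1]
      calc _ ≤ r * Vk k r * (Real.exp β * (M * PhiA k A r)) := by
            gcongr
            exact h2.trans (by gcongr; exact hb r hr)
        _ = _ := by ring)
  intro r hr
  have e : JJ (fun t => t * Vk k t * Real.exp (f t)) r -
      JJ (fun t => t * Vk k t * Real.exp (g t)) r =
      JJ (fun t => t * Vk k t * Real.exp (f t) - t * Vk k t * Real.exp (g t)) r := by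
    unfold JJ
    rw [← intervalIntegral.integral_sub (f2 r hr) (g2 r hr)]
    apply intervalIntegral.integral_congr
    intro s hs
    rw [uIcc_of_le hr.1] at hs
    have hs' : s ∈ Ico 0 (Real.exp 1) := ⟨hs.1, hs.2.trans_lt hr.2⟩
    simp only
    rw [intervalIntegral.integral_sub (f1 s hs') (g1 s hs'), mul_sub]
  rw [e]
  exact d r hr

lemma J_exp {k A β : ℝ} (hk : 0 < k) (hA : 0 ≤ A) (hAB : k * (k + 1) * A = 2 * Real.exp β)
    (f : ℝ → ℝ) (hf : ContinuousOn f (Ioo 0 (Real.exp 1)))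
    (fb : ∀ r ∈ Ioo 0 (Real.exp 1), f r ≤ β) :
    (∀ r ∈ Ico 0 (Real.exp 1),
      |JJ (fun t => t * Vk k t * Real.exp (f t)) r| ≤ (1/2) * (PhiA k A r - 1)) ∧
    ContinuousOn (JJ (fun t => t * Vk k t * Real.exp (f t))) (Ico 0 (Real.exp 1)) ∧
    (∀ r ∈ Ioo 0 (Real.exp 1), HasDerivAt
      (fun r => ∫ t in (0:ℝ)..r, t * Vk k t * Real.exp (f t)) (r * Vk k r * Real.exp (f r)) r) ∧
    (∀ r ∈ Ioo 0 (Real.exp 1), HasDerivAt (JJ (fun t => t * Vk k t * Real.exp (f t)))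
      ((1 / r) * ∫ t in (0:ℝ)..r, t * Vk k t * Real.exp (f t)) r) := by
  have := J_main hk hA hAB (1/2) (by norm_num) (fun t => t * Vk k t * Real.exp (f t))
    ((Q_cont k).mul (Real.continuous_exp.comp_continuousOn hf)) (by
    intro r hr
    have h1 := Q_pos (k := k) hr
    have h2 := Phi_ge (k := k) hA hr
    have h3 := Real.exp_le_exp.2 (fb r hr)
    rw [abs_of_pos (by positivity)]
    calc _ ≤ r * Vk k r * Real.exp β * 1 := by rw [mul_one]; gcongr
      _ ≤ r * Vk k r * Real.exp β * PhiA k A r := by gcongr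
      _ = _ := by ring)
  exact ⟨this.2.2.1, this.2.2.2.1, this.2.2.2.2.1, this.2.2.2.2.2⟩

lemma Q_nonneg {k r : ℝ} (hr : r ∈ Ico 0 (Real.exp 1)) : 0 ≤ r * Vk k r := by
  rcases hr.1.eq_or_lt with h | h
  · rw [← h]; simp
  · exact (Q_pos ⟨h, hr.2⟩).le

lemma no_log {w : ℝ → ℝ} {b c d : ℝ} (hb : 0 < b) (hw : ContinuousOn w (Ico 0 b))
    (h : ∀ᶠ r in 𝓝[>] 0, w r ≤ c * Real.log r + d) : c ≤ 0 := by
  by_contra! hc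
  have h1 : Tendsto w (𝓝[>] 0) (𝓝 (w 0)) := by
    have := hw 0 ⟨le_rfl, hb⟩
    have h2 : ContinuousWithinAt w (Ioo 0 b) 0 := this.mono Ioo_subset_Ico_self
    rw [ContinuousWithinAt, nhdsWithin_Ioo_eq_nhdsGT hb] at h2
    exact h2
  have h2 : Tendsto (fun r => c * Real.log r + d) (𝓝[>] 0) atBot :=
    tendsto_atBot_add_const_right _ _ (Real.tendsto_log_nhdsGT_zero.const_mul_atBot hc)
  have h3 := tendsto_atBot_mono' _ h h2
  exact not_tendsto_nhds_of_tendsto_atBot h3 _ h1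

lemma sol_int {k β : ℝ} (hk : 0 < k) {u u' u'' : ℝ → ℝ}
    (hc : ContinuousOn u (Ico 0 (Real.exp 1))) (h0 : u 0 = β) (hs : IsSolExp k u u' u'') :
    (∀ r ∈ Ico 0 (Real.exp 1), u r ≤ β) ∧
    ∀ r ∈ Ico 0 (Real.exp 1), u r = β - JJ (fun t => t * Vk k t * Real.exp (u t)) r := by
  obtain ⟨s1, s2, -, s4⟩ := hs
  have he : (0:ℝ) < Real.exp 1 := Real.exp_pos 1
  have hP : ∀ r ∈ Ioo 0 (Real.exp 1),
      HasDerivAt (fun r => r * u' r) (-(r * Vk k r * Real.exp (u r))) r := by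
    intro r hr
    refine HasDerivAt.congr_deriv ((hasDerivAt_id r).mul (s2 r hr)) ?_
    have := s4 r hr
    have h1 := hr.1.ne'
    have h2 : u'' r = - u' r / r - Vk k r * Real.exp (u r) := by
      rw [neg_div]; linarith
    rw [h2]
    simp only [id]
    field_simp
    ring
  have hanti : AntitoneOn (fun r => r * u' r) (Ioo 0 (Real.exp 1)) := by
    apply antitoneOn_of_deriv_nonpos (convex_Ioo _ _)
      (fun r hr => (hP r hr).continuousAt.continuousWithinAt)
    · rw [interior_Ioo]
      exact fun r hr => (hP r hr).differentiableAt.differentiableWithinAt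
    · rw [interior_Ioo]
      intro r hr
      rw [(hP r hr).deriv]
      have := Q_pos (k := k) hr
      have := mul_pos this (Real.exp_pos (u r))
      linarith
  have hPneg : ∀ r ∈ Ioo 0 (Real.exp 1), r * u' r ≤ 0 := by
    intro r0 hr0
    set c := r0 * u' r0 with hcdef
    -- u - c log is monotone on (0, r0]
    have hmono : MonotoneOn (fun r => u r - c * Real.log r) (Ioc 0 r0) := by
      have hd : ∀ r ∈ Ioc 0 r0, HasDerivAt (fun r => u r - c * Real.log r)
          (u' r - c * r⁻¹) r := fun r hr =>
        (s1 r ⟨hr.1, hr.2.trans_lt hr0.2⟩).sub ((Real.hasDerivAt_log hr.1.ne').const_mul c)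
      apply monotoneOn_of_deriv_nonneg (convex_Ioc _ _)
        (fun r hr => (hd r hr).continuousAt.continuousWithinAt)
      · rw [interior_Ioc]
        exact fun r hr => (hd r ⟨hr.1, hr.2.le⟩).differentiableAt.differentiableWithinAt
      · rw [interior_Ioc]
        intro r hr
        rw [(hd r ⟨hr.1, hr.2.le⟩).deriv]
        have := hanti ⟨hr.1, hr.2.trans hr0.2⟩ hr0 hr.2.le
        simp only at this
        rw [← hcdef] at this
        have h1 := hr.1
        rw [← div_eq_mul_inv, sub_nonneg, div_le_iff₀ h1]
        linarith
    refine no_log (d := u r0 - c * Real.log r0) he hc ?_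
    filter_upwards [Ioc_mem_nhdsGT hr0.1] with r hr
    have := hmono hr ⟨hr0.1, le_rfl⟩ hr.2
    simp only at this
    linarith
  have hub : ∀ r ∈ Ico 0 (Real.exp 1), u r ≤ β := by
    have ha : AntitoneOn u (Ico 0 (Real.exp 1)) := by
      apply antitoneOn_of_deriv_nonpos (convex_Ico _ _) hc
      · rw [interior_Ico]
        exact fun r hr => (s1 r hr).differentiableAt.differentiableWithinAt
      · rw [interior_Ico]
        intro r hr
        rw [(s1 r hr).deriv]
        have := hPneg r hr
        have h1 := hr.1
        by_contra! h
        nlinarith [mul_pos h1 h]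
    intro r hr
    rw [← h0]
    exact ha ⟨le_rfl, he⟩ hr hr.1
  refine ⟨hub, ?_⟩
  have hA : 0 ≤ 2 * Real.exp β / (k * (k + 1)) := by positivity
  have hAB : k * (k + 1) * (2 * Real.exp β / (k * (k + 1))) = 2 * Real.exp β := by
    field_simp
  obtain ⟨-, j2, j3, j4⟩ := J_exp hk hA hAB u (hc.mono Ioo_subset_Ico_self)
    (fun r hr => hub r ⟨hr.1.le, hr.2⟩)
  set F := fun r => ∫ t in (0:ℝ)..r, t * Vk k t * Real.exp (u t) with hF
  set J := JJ (fun t => t * Vk k t * Real.exp (u t)) with hJ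
  obtain ⟨c, hcc⟩ : ∃ c, ∀ r ∈ Ioo 0 (Real.exp 1), r * u' r + F r = c := by
    have hd : ∀ r ∈ Ioo 0 (Real.exp 1), HasDerivAt (fun r => r * u' r + F r) 0 r := fun r hr =>
      HasDerivAt.congr_deriv ((hP r hr).add (j3 r hr)) (by ring)
    exact isOpen_Ioo.exists_is_const_of_deriv_eq_zero isPreconnected_Ioo
      (fun r hr => (hd r hr).differentiableAt.differentiableWithinAt) (fun r hr => (hd r hr).deriv)
  obtain ⟨d, hdd⟩ : ∃ d, ∀ r ∈ Ioo 0 (Real.exp 1), u r + J r - c * Real.log r = d := by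
    have hd : ∀ r ∈ Ioo 0 (Real.exp 1), HasDerivAt (fun r => u r + J r - c * Real.log r) 0 r := by
      intro r hr
      refine HasDerivAt.congr_deriv (((s1 r hr).add (j4 r hr)).sub
        ((Real.hasDerivAt_log hr.1.ne').const_mul c)) ?_
      have h1 := hcc r hr
      have h2 := hr.1.ne'
      change u' r + 1 / r * F r - c * r⁻¹ = 0
      rw [← h1]
      field_simp
      ring
    exact isOpen_Ioo.exists_is_const_of_deriv_eq_zero isPreconnected_Ioo
      (fun r hr => (hd r hr).differentiableAt.differentiableWithinAt) (fun r hr => (hd r hr).deriv)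
  have hcont : ContinuousOn (fun r => u r + J r) (Ico 0 (Real.exp 1)) := hc.add j2
  have hc1 : c ≤ 0 := by
    refine no_log (d := d) he hcont ?_
    filter_upwards [Ioo_mem_nhdsGT he] with r hr
    linarith [hdd r hr]
  have hc2 : -c ≤ 0 := by
    refine no_log (d := -d) he hcont.neg ?_
    filter_upwards [Ioo_mem_nhdsGT he] with r hr
    simp only [Pi.neg_apply]
    linarith [hdd r hr]
  have hc0 : c = 0 := by linarith
  subst hc0
  have J0 : J 0 = 0 := by simp [hJ, JJ]
  have hd0 : d = β := by
    have h1 : Tendsto (fun r => u r + J r) (𝓝[>] 0) (𝓝 (u 0 + J 0)) := by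
      have h2 : ContinuousWithinAt (fun r => u r + J r) (Ioo 0 (Real.exp 1)) 0 :=
        (hcont 0 ⟨le_rfl, he⟩).mono Ioo_subset_Ico_self
      rw [ContinuousWithinAt, nhdsWithin_Ioo_eq_nhdsGT he] at h2
      exact h2
    have h2 : Tendsto (fun r => u r + J r) (𝓝[>] 0) (𝓝 d) := by
      refine tendsto_const_nhds.congr' ?_
      filter_upwards [Ioo_mem_nhdsGT he] with r hr
      linarith [hdd r hr]
    have := tendsto_nhds_unique h1 h2
    rw [h0, J0] at this
    linarith
  intro r hr
  rcases hr.1.eq_or_lt with h | h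
  · rw [← h, J0, h0]; ring
  · have := hdd r ⟨h, hr.2⟩
    linarith

lemma int_unique {k A β : ℝ} (hk : 0 < k) (hA : 0 ≤ A) (hAB : k * (k + 1) * A = 2 * Real.exp β)
    {u v : ℝ → ℝ} (hu : ContinuousOn u (Ico 0 (Real.exp 1)))
    (hv : ContinuousOn v (Ico 0 (Real.exp 1)))
    (ub : ∀ r ∈ Ico 0 (Real.exp 1), u r ≤ β) (vb : ∀ r ∈ Ico 0 (Real.exp 1), v r ≤ β)
    (ui : ∀ r ∈ Ico 0 (Real.exp 1), u r = β - JJ (fun t => t * Vk k t * Real.exp (u t)) r)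
    (vi : ∀ r ∈ Ico 0 (Real.exp 1), v r = β - JJ (fun t => t * Vk k t * Real.exp (v t)) r) :
    ∀ r ∈ Ico 0 (Real.exp 1), u r = v r := by
  have hu' := hu.mono (Ioo_subset_Ico_self)
  have hv' := hv.mono (Ioo_subset_Ico_self)
  have ub' : ∀ r ∈ Ioo 0 (Real.exp 1), u r ≤ β := fun r hr => ub r ⟨hr.1.le, hr.2⟩
  have vb' : ∀ r ∈ Ioo 0 (Real.exp 1), v r ≤ β := fun r hr => vb r ⟨hr.1.le, hr.2⟩
  have h1 := (J_exp hk hA hAB u hu' ub').1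
  have h2 := (J_exp hk hA hAB v hv' vb').1
  have main : ∀ n : ℕ, ∀ r ∈ Ico 0 (Real.exp 1), |u r - v r| ≤ (1/2)^n * PhiA k A r := by
    intro n
    induction n with
    | zero =>
      intro r hr
      have a := abs_le.1 (h1 r hr)
      have b := abs_le.1 (h2 r hr)
      rw [ui r hr, vi r hr, abs_le]
      constructor <;> linarith
    | succ n ih =>
      intro r hr
      have := J_diff hk hA hAB ((1/2)^n) (by positivity) v u hv' hu' vb' ub'
        (fun r hr => by rw [abs_sub_comm]; exact ih r ⟨hr.1.le, hr.2⟩) r hr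
      have e : u r - v r = JJ (fun t => t * Vk k t * Real.exp (v t)) r -
        JJ (fun t => t * Vk k t * Real.exp (u t)) r := by
        linarith [ui r hr, vi r hr]
      rw [e, pow_succ]
      refine this.trans ?_
      have : (0:ℝ) < (1/2)^n := by positivity
      linarith
  intro r hr
  have : Tendsto (fun n : ℕ => (1/2:ℝ)^n * PhiA k A r) atTop (𝓝 (0 * PhiA k A r)) :=
    (tendsto_pow_atTop_nhds_zero_of_lt_one (by norm_num) (by norm_num)).mul_const _
  rw [zero_mul] at this
  have h3 := ge_of_tendsto' this (fun n => main n r hr)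
  have := abs_nonpos_iff.1 h3
  linarith

/-- extension of `g * Phi` truncated at `β` -/
noncomputable def extW (k A β : ℝ) (g : Ioo (0:ℝ) (Real.exp 1) → ℝ) (r : ℝ) : ℝ :=
  if h : r ∈ Ioo (0:ℝ) (Real.exp 1) then min (g ⟨r, h⟩ * PhiA k A r) β else β

lemma extW_le (k A β : ℝ) (g : Ioo (0:ℝ) (Real.exp 1) → ℝ) (r : ℝ) : extW k A β g r ≤ β := by
  unfold extW
  split_ifs
  · exact min_le_right _ _
  · exact le_rfl

lemma extW_cont {k A β : ℝ} (hk : 0 < k) (g : Ioo (0:ℝ) (Real.exp 1) → ℝ) (hg : Continuous g) :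
    ContinuousOn (extW k A β g) (Ioo 0 (Real.exp 1)) := by
  rw [continuousOn_iff_continuous_domRestrict]
  have h1 : Continuous ((Ioo (0:ℝ) (Real.exp 1)).domRestrict (PhiA k A)) :=
    continuousOn_iff_continuous_domRestrict.1 ((Phi_cont hk A).mono Ioo_subset_Ico_self)
  have : (Ioo (0:ℝ) (Real.exp 1)).domRestrict (extW k A β g) =
      fun x => min (g x * (Ioo (0:ℝ) (Real.exp 1)).domRestrict (PhiA k A) x) β := by
    funext x
    simp only [domRestrict_apply, extW, x.2, dite_true]
  rw [this]
  exact (hg.mul h1).min continuous_const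

lemma exists_int {k A β : ℝ} (hk : 0 < k) (hA : 0 ≤ A) (hAB : k * (k + 1) * A = 2 * Real.exp β) :
    ∃ v : ℝ → ℝ, ContinuousOn v (Ico 0 (Real.exp 1)) ∧ (∀ r ∈ Ico 0 (Real.exp 1), v r ≤ β) ∧
    ∀ r ∈ Ico 0 (Real.exp 1), v r = β - JJ (fun t => t * Vk k t * Real.exp (v t)) r := by
  let S := Ioo (0:ℝ) (Real.exp 1)
  let J : BoundedContinuousFunction S ℝ → ℝ → ℝ := fun g =>
    JJ (fun t => t * Vk k t * Real.exp (extW k A β g t))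
  have hJ := fun g : BoundedContinuousFunction S ℝ =>
    J_exp hk hA hAB (extW k A β g) (extW_cont hk g g.continuous) (fun r _ => extW_le _ _ _ _ _)
  let T : BoundedContinuousFunction S ℝ → BoundedContinuousFunction S ℝ := fun g =>
    BoundedContinuousFunction.ofNormedAddCommGroup (fun x : S => (β - J g x) / PhiA k A x) (by
      have : ContinuousOn (fun r => (β - J g r) / PhiA k A r) S := by
        apply ContinuousOn.div
        · exact continuousOn_const.sub ((hJ g).2.1.mono Ioo_subset_Ico_self)
        · exact (Phi_cont hk A).mono Ioo_subset_Ico_self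
        · intro r hr
          have := Phi_ge (k := k) hA hr
          linarith
      exact continuousOn_iff_continuous_domRestrict.1 this) (|β| + 1) (by
      intro x
      have h1 := Phi_ge (k := k) hA x.2
      have h2 := (hJ g).1 x ⟨x.2.1.le, x.2.2⟩
      rw [Real.norm_eq_abs, abs_div, abs_of_pos (show 0 < PhiA k A x by linarith),
        div_le_iff₀ (by linarith)]
      have h3 : |β - J g x| ≤ |β| + |J g x| := abs_sub _ _
      have h4 := abs_nonneg β
      nlinarith)
  have hT : ContractingWith (1/2) T := by
    refine ⟨by rw [← NNReal.coe_lt_coe]; norm_num, LipschitzWith.of_dist_le_mul fun f g => ?_⟩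
    rw [BoundedContinuousFunction.dist_le (by positivity)]
    intro x
    have h1 := Phi_ge (k := k) hA x.2
    have h2 := J_diff hk hA hAB (dist f g) dist_nonneg (extW k A β f) (extW k A β g)
      (extW_cont hk f f.continuous) (extW_cont hk g g.continuous)
      (fun r _ => extW_le _ _ _ _ _) (fun r _ => extW_le _ _ _ _ _) (by
        intro r hr
        have h1 := Phi_ge (k := k) hA hr
        simp only [extW, hr, dite_true]
        refine (abs_min_sub_min_le_max _ _ _ _).trans ?_
        rw [sub_self, abs_zero, max_eq_left (abs_nonneg _), ← sub_mul, abs_mul,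
          abs_of_pos (show 0 < PhiA k A r by linarith)]
        gcongr
        exact BoundedContinuousFunction.dist_coe_le_dist (f := f) (g := g) ⟨r, hr⟩)
      x ⟨x.2.1.le, x.2.2⟩
    change dist ((β - J f x) / PhiA k A x) ((β - J g x) / PhiA k A x) ≤ _
    rw [Real.dist_eq, ← sub_div, abs_div, abs_of_pos (show 0 < PhiA k A x by linarith),
        div_le_iff₀ (by linarith)]
    have e : |β - J f x - (β - J g x)| = |J f x - J g x| := by
      rw [abs_sub_comm]; congr 1; ring
    rw [e]
    refine h2.trans ?_
    have : 0 ≤ dist f g := dist_nonneg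
    push_cast
    nlinarith
  let g := ContractingWith.fixedPoint T hT
  have hg : T g = g := hT.fixedPoint_isFixedPt
  have hle : ∀ r ∈ Ico 0 (Real.exp 1), β - J g r ≤ β := by
    intro r hr
    have := J_nonneg (h := fun t => t * Vk k t * Real.exp (extW k A β g t))
      (fun r hr => mul_nonneg (Q_nonneg hr) (Real.exp_pos _).le) hr
    change β - JJ _ r ≤ β
    linarith
  refine ⟨fun r => β - J g r, continuousOn_const.sub (hJ g).2.1, hle, ?_⟩
  intro r hr
  change β - JJ _ r = _
  congr 1
  apply J_congr _ hr
  intro t ht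
  rcases ht.1.eq_or_lt with h | h
  · rw [← h]; simp
  · have ht' : t ∈ Ioo 0 (Real.exp 1) := ⟨h, ht.2⟩
    have h1 := Phi_ge (k := k) hA ht'
    have h2 : g ⟨t, ht'⟩ = (β - J g t) / PhiA k A t := by
      conv_lhs => rw [← hg]
      rfl
    have : extW k A β g t = β - J g t := by
      simp only [extW, ht', dite_true]
      rw [h2, div_mul_cancel₀ _ (by linarith), min_eq_left (hle t ht)]
    simp only [this]

theorem stmt1 (k : ℝ) (hk : 0 < k) (β : ℝ) :
    ∃ v v' v'' : ℝ → ℝ,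
      ContinuousOn v (Set.Ico 0 (Real.exp 1)) ∧ v 0 = β ∧ IsSolExp k v v' v'' ∧
      (∀ r ∈ Set.Ico (0 : ℝ) (Real.exp 1),
        v r = β - ∫ s in (0 : ℝ)..r,
          (1 / s) * ∫ t in (0 : ℝ)..s, t * Vk k t * Real.exp (v t)) ∧
      (∀ u u' u'' : ℝ → ℝ,
        ContinuousOn u (Set.Ico 0 (Real.exp 1)) → u 0 = β → IsSolExp k u u' u'' →
        ∀ r ∈ Set.Ico (0 : ℝ) (Real.exp 1), u r = v r) := by
  have hA : 0 ≤ 2 * Real.exp β / (k * (k + 1)) := by positivity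
  have hAB : k * (k + 1) * (2 * Real.exp β / (k * (k + 1))) = 2 * Real.exp β := by
    field_simp
  have he : (0:ℝ) < Real.exp 1 := Real.exp_pos 1
  obtain ⟨v, vc, vb, vi⟩ := exists_int hk hA hAB
  obtain ⟨-, j2, j3, j4⟩ := J_exp hk hA hAB v (vc.mono Ioo_subset_Ico_self)
    (fun r hr => vb r ⟨hr.1.le, hr.2⟩)
  have hQ : ContinuousOn (fun t => t * Vk k t * Real.exp (v t)) (Ioo 0 (Real.exp 1)) :=
    (Q_cont k).mul (Real.continuous_exp.comp_continuousOn (vc.mono Ioo_subset_Ico_self))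
  refine ⟨v, fun r => -((1 / r) * ∫ t in (0:ℝ)..r, t * Vk k t * Real.exp (v t)),
    fun r => -((-1 / r ^ 2) * (∫ t in (0:ℝ)..r, t * Vk k t * Real.exp (v t))
      + (1 / r) * (r * Vk k r * Real.exp (v r))), vc, ?_, ⟨?_, ?_, ?_, ?_⟩, vi, ?_⟩
  · rw [vi 0 ⟨le_rfl, he⟩]
    simp [JJ]
  · intro r hr
    refine ((j4 r hr).const_sub β).congr_of_eventuallyEq ?_
    filter_upwards [isOpen_Ioo.mem_nhds hr] with x hx
    exact vi x ⟨hx.1.le, hx.2⟩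
  · intro r hr
    have h1 : HasDerivAt (fun r : ℝ => 1 / r) (-1 / r ^ 2) r := by
      refine HasDerivAt.congr_deriv ((hasDerivAt_inv hr.1.ne').congr_of_eventuallyEq
        (Eventually.of_forall fun x => one_div x)) ?_
      rw [neg_div, one_div]
    exact (h1.mul (j3 r hr)).neg
  · intro r hr
    have hr0 := hr.1.ne'
    have h1 : ContinuousAt (fun r : ℝ => -1 / r ^ 2) r :=
      continuousAt_const.div (continuousAt_id.pow 2) (pow_ne_zero 2 hr0)
    have h2 : ContinuousAt (fun r : ℝ => 1 / r) r := continuousAt_const.div continuousAt_id hr0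
    exact ((h1.mul (j3 r hr).continuousAt).add
      (h2.mul (hQ.continuousAt (isOpen_Ioo.mem_nhds hr)))).neg.continuousWithinAt
  · intro r hr
    have hr0 := hr.1.ne'
    simp only
    field_simp
    ring
  · intro u u' u'' uc u0 us
    obtain ⟨ub, ui⟩ := sol_int hk uc u0 us
    exact int_unique hk hA hAB uc vc ub vb ui vi
end

section
/- Let k > 0 and let V_k(r) = 1/(r^2 (1 - log r)^{2+k}) for 0 < r < e. Suppose v is a C^2 function on (0, e) satisfying v''(r) + v'(r)/r + V_k(r) e^{v(r)} = 0 for all 0 < r < e and v(r) → ∞ as r → 0+. Then limsup_{r → 0+} ( v(r) - k·log(1 - log r) ) > -∞. -/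
open Filter Topology Set MeasureTheory

theorem aux_mono (f f' : ℝ → ℝ) (T : ℝ) (hf : ∀ t, T ≤ t → HasDerivAt f (f' t) t)
    (h : ∀ t, T ≤ t → 0 ≤ f' t) (a b : ℝ) (ha : T ≤ a) (hab : a ≤ b) : f a ≤ f b := by
  have : MonotoneOn f (Set.Ici T) := by
    apply monotoneOn_of_deriv_nonneg (convex_Ici T)
    · intro t ht
      exact (hf t ht).continuousAt.continuousWithinAt
    · intro t ht
      rw [interior_Ici] at ht
      exact (hf t (le_of_lt ht)).differentiableAt.differentiableWithinAt
    · intro t ht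
      rw [interior_Ici] at ht
      rw [(hf t (le_of_lt ht)).deriv]
      exact h t (le_of_lt ht)
  exact this ha (le_trans ha hab) hab

theorem aux_le (k c T : ℝ) (w w1 w2 P p : ℝ → ℝ)
    (hw : ∀ t, T ≤ t → HasDerivAt w (w1 t) t)
    (hw1 : ∀ t, T ≤ t → HasDerivAt w1 (w2 t) t)
    (hP : ∀ t, T ≤ t → HasDerivAt P (p t) t)
    (hP0 : ∀ t, T ≤ t → 0 ≤ P t)
    (h2 : ∀ t, T ≤ t → p t ≤ w2 t)
    (hb : ∀ t, T ≤ t → w t ≤ k * Real.log t + c) :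
    ∀ t, T ≤ t → w1 t ≤ P t := by
  intro a ha
  by_contra hcon
  push Not at hcon
  set d := w1 a - P a with hd
  have hd0 : 0 < d := by linarith
  have hge : ∀ t, a ≤ t → d ≤ w1 t := by
    intro t ht
    have := aux_mono (fun t => w1 t - P t) (fun t => w2 t - p t) T
      (fun t ht => (hw1 t ht).sub (hP t ht)) (fun t ht => by linarith [h2 t ht]) a t ha ht
    have h0 := hP0 t (ha.trans ht)
    linarith
  have hlin : ∀ t, a ≤ t → w a - d * a ≤ w t - d * t := by
    intro t ht
    exact aux_mono (fun t => w t - d * t) (fun t => w1 t - d) a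
      (fun t ht => by
        have := (hw t (ha.trans ht)).sub ((hasDerivAt_id t).const_mul d)
        rw [mul_one] at this
        exact this) (fun t ht => by linarith [hge t ht]) a t le_rfl ht
  have h1 : Tendsto (fun t : ℝ => Real.log t / t) atTop (𝓝 0) := by
    have := Real.isLittleO_log_id_atTop.tendsto_div_nhds_zero
    simpa using this
  have h3 : Tendsto (fun t : ℝ => k * (Real.log t / t) + (c - w a + d * a) / t) atTop (𝓝 0) := by
    have := (h1.const_mul k).add (tendsto_const_nhds (x := c - w a + d * a) |>.div_atTop tendsto_id)
    simpa using this
  have h4 := h3.eventually (gt_mem_nhds hd0)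
  obtain ⟨t, ht, ht1, ht2⟩ := (h4.and ((eventually_ge_atTop a).and (eventually_gt_atTop 0))).exists
  have e1 := hlin t ht1
  have e2 := hb t (ha.trans ht1)
  have : k * Real.log t + (c - w a + d * a) < d * t := by
    have := mul_lt_mul_of_pos_right ht ht2
    have e : (k * (Real.log t / t) + (c - w a + d * a) / t) * t
      = k * Real.log t + (c - w a + d * a) := by field_simp
    linarith
  linarith

theorem aux_main (k : ℝ) (hk : 0 < k) (w w1 : ℝ → ℝ)
    (hw : ∀ t, 0 < t → HasDerivAt w (w1 t) t)
    (hw1 : ∀ t, 0 < t → HasDerivAt w1 (-(t ^ (-(2 + k)) * Real.exp (w t))) t)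
    (hinf : Tendsto w atTop atTop)
    (hb : ∀ c : ℝ, ∀ᶠ t in atTop, w t - k * Real.log t < c) : False := by
  obtain ⟨T0, hT0⟩ := eventually_atTop.1 (hb (Real.log (k / 2)))
  set T := max T0 1 with hT
  have hpos : ∀ t, T ≤ t → 0 < t := fun t ht =>
    lt_of_lt_of_le one_pos ((le_max_right _ _).trans ht)
  have hb1 : ∀ t, T ≤ t → w t ≤ k * Real.log t + Real.log (k / 2) := fun t ht => by
    linarith [hT0 t ((le_max_left _ _).trans ht)]
  have key : ∀ a C t : ℝ, 0 < t → w t ≤ a * Real.log t + C →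
      t ^ (-(2 + k)) * Real.exp (w t) ≤ Real.exp C * t ^ (-(2 + k) + a) := by
    intro a C t ht h
    rw [Real.rpow_def_of_pos ht, Real.rpow_def_of_pos ht, ← Real.exp_add, ← Real.exp_add]
    apply Real.exp_le_exp.2
    nlinarith
  have powd : ∀ A m t : ℝ, 0 < t → HasDerivAt (fun t => A * t ^ m) (A * (m * t ^ (m - 1))) t :=
    fun A m t ht => (Real.hasDerivAt_rpow_const (Or.inl ht.ne')).const_mul A
  -- step 1
  have s1 := aux_le k _ T w w1 _ (fun t => (k / 2) * t ^ (-1 : ℝ)) _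
    (fun t ht => hw t (hpos t ht)) (fun t ht => hw1 t (hpos t ht))
    (fun t ht => powd _ _ t (hpos t ht))
    (fun t ht => by have := Real.rpow_pos_of_pos (hpos t ht) (-1); positivity)
    (fun t ht => by
      have := key k _ t (hpos t ht) (hb1 t ht)
      rw [Real.exp_log (by positivity)] at this
      have e : (-(2 + k) + k : ℝ) = -1 - 1 := by ring
      rw [e] at this
      linarith) hb1
  -- step 2
  have s2 : ∀ t, T ≤ t → w t ≤ (k / 2) * Real.log t + (w T - (k / 2) * Real.log T) := by
    intro t ht
    have := aux_mono (fun t => (k / 2) * Real.log t - w t) (fun t => (k / 2) * t⁻¹ - w1 t) T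
      (fun t ht => ((Real.hasDerivAt_log (hpos t ht).ne').const_mul _).sub (hw t (hpos t ht)))
      (fun t ht => by
        have := s1 t ht
        simp only [Real.rpow_neg_one] at this
        linarith) T t le_rfl ht
    linarith
  set C := w T - (k / 2) * Real.log T with hC
  -- step 3
  have s3 := aux_le k _ T w w1 _ (fun t => (Real.exp C / (1 + k / 2)) * t ^ (-(1 + k / 2))) _
    (fun t ht => hw t (hpos t ht)) (fun t ht => hw1 t (hpos t ht))
    (fun t ht => powd _ _ t (hpos t ht))
    (fun t ht => by have := Real.rpow_pos_of_pos (hpos t ht) (-(1 + k / 2)); positivity)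
    (fun t ht => by
      have := key (k / 2) _ t (hpos t ht) (s2 t ht)
      have e : (-(2 + k) + k / 2 : ℝ) = -(1 + k / 2) - 1 := by ring
      rw [e] at this
      have e2 : ∀ x : ℝ, Real.exp C / (1 + k / 2) * (-(1 + k / 2) * x) = -(Real.exp C * x) := by
        intro x
        field_simp
      rw [e2]
      linarith) hb1
  set A := Real.exp C / (1 + k / 2) with hA
  have hA0 : 0 < A := by positivity
  have s4 : ∀ t, T ≤ t → w t ≤ w T + A / (k / 2) * T ^ (-(k / 2)) := by
    intro t ht
    have := aux_mono (fun t => (-(A / (k / 2))) * t ^ (-(k / 2)) - w t) _ T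
      (fun t ht => (powd _ _ t (hpos t ht)).sub (hw t (hpos t ht)))
      (fun t ht => by
        have := s3 t ht
        have e : (-(k / 2) - 1 : ℝ) = -(1 + k / 2) := by ring
        have e2 : ∀ x : ℝ, -(A / (k / 2)) * (-(k / 2) * x) = A * x := by
          intro x
          field_simp
        rw [e, e2]
        linarith) T t le_rfl ht
    have h0 := Real.rpow_pos_of_pos (hpos t ht) (-(k / 2))
    have : 0 < A / (k / 2) * t ^ (-(k / 2)) := by positivity
    linarith
  obtain ⟨t, h1, h2⟩ := ((hinf.eventually_gt_atTop (w T + A / (k / 2) * T ^ (-(k / 2)))).and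
    (eventually_ge_atTop T)).exists
  linarith [s4 t h2]

/-- If `v` is a singular solution (i.e. `v(r) → ∞` as `r → 0+`), then
`limsup_{r → 0+} (v(r) - k log(1 - log r)) > -∞`, i.e. the quantity is
frequently bounded below near `0`. -/
theorem stmt2 (k : ℝ) (hk : 0 < k) (v v' v'' : ℝ → ℝ)
    (hsol : IsSolExp k v v' v'')
    (hsing : Tendsto v (𝓝[>] (0 : ℝ)) atTop) :
    ∃ c : ℝ, ∃ᶠ r in 𝓝[>] (0 : ℝ),
      c ≤ v r - k * Real.log (1 - Real.log r) := by
  by_contra hcon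
  push Not at hcon
  obtain ⟨h1, h2, -, h4⟩ := hsol
  have hmem : ∀ t : ℝ, 0 < t → Real.exp (1 - t) ∈ Set.Ioo (0 : ℝ) (Real.exp 1) := fun t ht =>
    ⟨Real.exp_pos _, Real.exp_lt_exp.2 (by linarith)⟩
  have hE : ∀ t : ℝ, HasDerivAt (fun t : ℝ => Real.exp (1 - t)) (-Real.exp (1 - t)) t := by
    intro t
    have := ((hasDerivAt_id t).const_sub 1).exp
    simpa using this
  have hlim : Tendsto (fun t : ℝ => Real.exp (1 - t)) atTop (𝓝[>] (0 : ℝ)) := by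
    refine tendsto_nhdsWithin_iff.2 ⟨?_, Eventually.of_forall fun t => Real.exp_pos _⟩
    refine Real.tendsto_exp_atBot.comp ?_
    exact tendsto_atBot_add_const_left _ 1 tendsto_neg_atTop_atBot
  refine aux_main k hk (fun t => v (Real.exp (1 - t)))
    (fun t => v' (Real.exp (1 - t)) * (-Real.exp (1 - t))) ?_ ?_ (hsing.comp hlim) ?_
  · intro t ht
    exact (h1 _ (hmem t ht)).comp t (hE t)
  · intro t ht
    have := ((h2 _ (hmem t ht)).comp t (hE t)).mul (hE t).neg
    refine this.congr_deriv ?_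
    have e := h4 _ (hmem t ht)
    simp only [Function.comp, Pi.neg_apply, Vk, Real.log_exp, sub_sub_cancel] at e ⊢
    rw [Real.rpow_neg ht.le]
    have hp := Real.rpow_pos_of_pos ht (2 + k)
    have hx := Real.exp_pos (1 - t)
    set x := Real.exp (1 - t)
    have e' : v'' x = -(v' x / x) - 1 / (x ^ 2 * t ^ (2 + k)) * Real.exp (v x) := by linarith
    rw [e']
    field_simp
    ring
  · intro c
    have := hlim.eventually (hcon c)
    simpa using this
end

section
/- Let k > 1/4. Suppose w : ℝ → ℝ is a C^2 function, not identically zero, satisfying w''(t) - w'(t) + k(e^{w(t)} - 1) = 0 for all t ∈ ℝ and w(t) → 0 as t → -∞. Then w changes sign infinitely many times as t → -∞; that is, for every T ∈ ℝ there exist t_1 < t_2 < T with w(t_1) < 0 and w(t_2) > 0. -/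
open Filter Topology Set

lemma aux_exp_abs (x M : ℝ) (h : |x| ≤ M) : |Real.exp x - 1| ≤ Real.exp M * |x| := by
  have h1 := Real.add_one_le_exp x
  have h2 := Real.add_one_le_exp (-x)
  have h3 : Real.exp x * Real.exp (-x) = 1 := by rw [← Real.exp_add]; simp
  have h4 : Real.exp x - 1 ≤ x * Real.exp x := by nlinarith [Real.exp_pos x]
  have hM : 1 ≤ Real.exp M := Real.one_le_exp ((abs_nonneg x).trans h)
  have hxM : Real.exp x ≤ Real.exp M := Real.exp_le_exp.2 ((le_abs_self x).trans h)
  rcases le_total 0 x with hx | hx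
  · rw [abs_of_nonneg hx, abs_of_nonneg (by linarith)]
    nlinarith
  · rw [abs_of_nonpos hx, abs_of_nonpos (by linarith [Real.exp_le_one_iff.2 hx])]
    nlinarith

lemma aux_exp_mul (k m x : ℝ) (hk : 0 < k) (hm : m < k) (h : m < k * Real.exp x) :
    m * x ^ 2 ≤ k * (Real.exp x - 1) * x := by
  have h1 := Real.add_one_le_exp x
  have h2 := Real.add_one_le_exp (-x)
  have h3 : Real.exp x * Real.exp (-x) = 1 := by rw [← Real.exp_add]; simp
  have h4 : Real.exp x - 1 ≤ x * Real.exp x := by nlinarith [Real.exp_pos x]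
  rcases le_total 0 x with hx | hx
  · have : x * x ≤ (Real.exp x - 1) * x := mul_le_mul_of_nonneg_right (by linarith) hx
    nlinarith [mul_le_mul_of_nonneg_left this hk.le, sq_nonneg x]
  · have : (x * Real.exp x) * x ≤ (Real.exp x - 1) * x :=
      mul_le_mul_of_nonpos_right h4 hx
    nlinarith [mul_le_mul_of_nonneg_left this hk.le, sq_nonneg x]

lemma aux_unique (k : ℝ) (hk : 1 / 4 < k) (w w' w'' : ℝ → ℝ)
    (hd1 : ∀ t : ℝ, HasDerivAt w (w' t) t)
    (hd2 : ∀ t : ℝ, HasDerivAt w' (w'' t) t)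
    (heq : ∀ t : ℝ, w'' t - w' t + k * (Real.exp (w t) - 1) = 0)
    (t₀ : ℝ) (h0 : w t₀ = 0) (h0' : w' t₀ = 0) (t : ℝ) : w t = 0 := by
  have hcw : Continuous w := continuous_iff_continuousAt.2 fun t => (hd1 t).continuousAt
  obtain ⟨M, hM⟩ := (isCompact_uIcc (a := t₀) (b := t)).exists_bound_of_continuousOn
    hcw.continuousOn
  set C := 3 + k * Real.exp M with hC
  have hE : ∀ s, HasDerivAt (fun s => w s ^ 2 + w' s ^ 2)
      (2 * w s * w' s + 2 * w' s * w'' s) s := by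
    intro s
    refine HasDerivAt.congr_deriv (((hd1 s).pow 2).add ((hd2 s).pow 2)) ?_
    norm_num
  have hb : ∀ s ∈ uIcc t₀ t, |2 * w s * w' s + 2 * w' s * w'' s| ≤ C * (w s ^ 2 + w' s ^ 2) := by
    intro s hs
    have h1 := aux_exp_abs (w s) M (hM s hs)
    have h2 : w'' s = w' s - k * (Real.exp (w s) - 1) := by linarith [heq s]
    have h3 : |w' s * (Real.exp (w s) - 1)| ≤ Real.exp M * (|w s| * |w' s|) := by
      rw [abs_mul]; nlinarith [abs_nonneg (w' s)]
    have h4 : 2 * (|w s| * |w' s|) ≤ w s ^ 2 + w' s ^ 2 := by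
      nlinarith [sq_nonneg (|w s| - |w' s|), sq_abs (w s), sq_abs (w' s)]
    have h5 : |w' s * (Real.exp (w s) - 1)| * 2 ≤ Real.exp M * (w s ^ 2 + w' s ^ 2) := by
      nlinarith [Real.exp_pos M]
    have h6 := mul_le_mul_of_nonneg_left h5 (by linarith : (0:ℝ) ≤ k)
    have h7 := mul_le_mul_of_nonneg_left (le_abs_self (w' s * (Real.exp (w s) - 1))) (by linarith : (0:ℝ) ≤ k)
    have h8 := mul_le_mul_of_nonneg_left (neg_abs_le (w' s * (Real.exp (w s) - 1))) (by linarith : (0:ℝ) ≤ k)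
    rw [h2, hC, abs_le]
    constructor <;>
      nlinarith [sq_nonneg (w s - w' s), sq_nonneg (w s + w' s), sq_nonneg (w s), sq_nonneg (w' s)]
  have key : w t ^ 2 + w' t ^ 2 ≤ 0 := by
    rcases le_total t₀ t with h | h
    · rw [uIcc_of_le h] at hb
      have hF : ∀ s, HasDerivAt (fun s => (w s ^ 2 + w' s ^ 2) * Real.exp (-C * s))
          ((2 * w s * w' s + 2 * w' s * w'' s) * Real.exp (-C * s)
            + (w s ^ 2 + w' s ^ 2) * (Real.exp (-C * s) * (-C * 1))) s := fun s =>
        (hE s).mul (((hasDerivAt_id s).const_mul (-C)).exp)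
      have hanti := antitoneOn_of_deriv_nonpos (convex_Icc t₀ t)
        (fun s _ => (hF s).continuousAt.continuousWithinAt)
        (fun s _ => (hF s).differentiableAt.differentiableWithinAt)
        (fun s hs => by
          rw [(hF s).deriv]
          have := (abs_le.1 (hb s (interior_subset hs))).2
          nlinarith [Real.exp_pos (-C * s)])
      have := hanti (left_mem_Icc.2 h) (right_mem_Icc.2 h) h
      simp only [h0, h0'] at this
      have hp := Real.exp_pos (-C * t)
      by_contra hcon
      push Not at hcon
      nlinarith [mul_pos hcon hp]
    · rw [uIcc_of_ge h] at hb
      have hF : ∀ s, HasDerivAt (fun s => (w s ^ 2 + w' s ^ 2) * Real.exp (C * s))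
          ((2 * w s * w' s + 2 * w' s * w'' s) * Real.exp (C * s)
            + (w s ^ 2 + w' s ^ 2) * (Real.exp (C * s) * (C * 1))) s := fun s =>
        (hE s).mul (((hasDerivAt_id s).const_mul C).exp)
      have hmono := monotoneOn_of_deriv_nonneg (convex_Icc t t₀)
        (fun s _ => (hF s).continuousAt.continuousWithinAt)
        (fun s _ => (hF s).differentiableAt.differentiableWithinAt)
        (fun s hs => by
          rw [(hF s).deriv]
          have := (abs_le.1 (hb s (interior_subset hs))).1
          nlinarith [Real.exp_pos (C * s)])
      have := hmono (left_mem_Icc.2 h) (right_mem_Icc.2 h) h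
      simp only [h0, h0'] at this
      have hp := Real.exp_pos (C * t)
      by_contra hcon
      push Not at hcon
      nlinarith [mul_pos hcon hp]
  have : w t ^ 2 = 0 := by nlinarith [sq_nonneg (w t), sq_nonneg (w' t)]
  exact pow_eq_zero_iff (two_ne_zero) |>.1 this

lemma aux_zero (k : ℝ) (hk : 1 / 4 < k) (w w' w'' : ℝ → ℝ)
    (hd1 : ∀ t : ℝ, HasDerivAt w (w' t) t)
    (hd2 : ∀ t : ℝ, HasDerivAt w' (w'' t) t)
    (heq : ∀ t : ℝ, w'' t - w' t + k * (Real.exp (w t) - 1) = 0)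
    (hlim : Tendsto w atBot (𝓝 0)) (T : ℝ) : ∃ t < T, w t = 0 := by
  by_contra! hcon
  obtain ⟨m, hm1, hm2⟩ := exists_between hk
  have hev : ∀ᶠ t in atBot, m < k * Real.exp (w t) := by
    have : Tendsto (fun t => k * Real.exp (w t)) atBot (𝓝 (k * Real.exp 0)) :=
      ((Real.continuous_exp.tendsto 0).comp hlim).const_mul k
    exact this.eventually_const_lt (by simpa using hm2)
  obtain ⟨T₁, hT₁⟩ := eventually_atBot.1 hev
  set s := Real.sqrt (m - 1 / 4) with hs
  have hspos : 0 < s := Real.sqrt_pos.2 (by linarith)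
  have hs2 : s ^ 2 = m - 1 / 4 := Real.sq_sqrt (by linarith)
  set b := min T₁ (T - 1) with hb
  have hbT : b < T := (min_le_right _ _).trans_lt (by linarith)
  set q : ℝ → ℝ := fun t => (w' t / w t - 1 / 2) / s with hq
  have hqd : ∀ t, t ≤ b → HasDerivAt (fun t => Real.arctan (q t) + s * t)
      (1 / (1 + q t ^ 2) * (((w'' t * w t - w' t * w' t) / w t ^ 2) / s) + s * 1) t := by
    intro t ht
    have hw : w t ≠ 0 := hcon t (ht.trans_lt hbT)
    exact ((((hd2 t).div (hd1 t) hw).sub_const (1 / 2)).div_const s).arctan.add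
      ((hasDerivAt_id t).const_mul s)
  have hle : ∀ t, t ≤ b →
      1 / (1 + q t ^ 2) * (((w'' t * w t - w' t * w' t) / w t ^ 2) / s) + s * 1 ≤ 0 := by
    intro t ht
    have hw : w t ≠ 0 := hcon t (ht.trans_lt hbT)
    have h1 := aux_exp_mul k m (w t) (by linarith) hm2 (hT₁ t (ht.trans (min_le_left _ _)))
    have h2 : w'' t = w' t - k * (Real.exp (w t) - 1) := by linarith [heq t]
    have hw2 : 0 < w t ^ 2 := by positivity
    have hq1 : s ^ 2 * (1 + q t ^ 2) = m - 1 / 4 + (w' t / w t - 1 / 2) ^ 2 := by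
      rw [← hs2, hq]; field_simp
    have h3 : (w'' t * w t - w' t * w' t) / w t ^ 2 ≤ -(s ^ 2 * (1 + q t ^ 2)) := by
      rw [hq1, div_le_iff₀ hw2]
      have : -(m - 1 / 4 + (w' t / w t - 1 / 2) ^ 2) * w t ^ 2
          = -m * w t ^ 2 - w' t ^ 2 + w' t * w t := by field_simp; ring
      rw [this, h2]; nlinarith
    have hpos : 0 < 1 + q t ^ 2 := by positivity
    have h4 : ((w'' t * w t - w' t * w' t) / w t ^ 2) / s ≤ -(s * (1 + q t ^ 2)) := by
      rw [div_le_iff₀ hspos]; nlinarith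
    have h5 : 1 / (1 + q t ^ 2) * (((w'' t * w t - w' t * w' t) / w t ^ 2) / s) ≤ -s := by
      rw [one_div, inv_mul_le_iff₀ hpos]; linarith
    linarith
  have hanti := antitoneOn_of_deriv_nonpos (convex_Iic b)
    (fun t ht => (hqd t ht).continuousAt.continuousWithinAt)
    (fun t ht => (hqd t (mem_Iic.1 (interior_subset ht))).differentiableAt.differentiableWithinAt)
    (fun t ht => by rw [(hqd t (mem_Iic.1 (interior_subset ht))).deriv]; exact hle t (mem_Iic.1 (interior_subset ht)))
  have hpi := Real.pi_pos
  have hab : b - Real.pi / s ≤ b := by have : 0 < Real.pi / s := by positivity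
                                       linarith
  have := hanti (mem_Iic.2 hab) (mem_Iic.2 le_rfl) hab
  simp only at this
  have e : s * (b - Real.pi / s) = s * b - Real.pi := by field_simp
  rw [e] at this
  linarith [Real.arctan_lt_pi_div_two (q (b - Real.pi / s)), Real.neg_pi_div_two_lt_arctan (q b)]

/-- Any nontrivial `C²` solution of `w'' - w' + k(e^w - 1) = 0` on `ℝ` with
`w(t) → 0` as `t → -∞` changes sign infinitely many times as `t → -∞`,
provided `k > 1/4`. -/
theorem stmt3 (k : ℝ) (hk : 1 / 4 < k) (w w' w'' : ℝ → ℝ)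
    (hd1 : ∀ t : ℝ, HasDerivAt w (w' t) t)
    (hd2 : ∀ t : ℝ, HasDerivAt w' (w'' t) t)
    (hcont : Continuous w'')
    (heq : ∀ t : ℝ, w'' t - w' t + k * (Real.exp (w t) - 1) = 0)
    (hlim : Tendsto w atBot (𝓝 0))
    (hne : w ≠ fun _ => 0) :
    ∀ T : ℝ, ∃ t₁ t₂ : ℝ, t₁ < t₂ ∧ t₂ < T ∧ w t₁ < 0 ∧ 0 < w t₂ := by
  have hz : ∀ t, w t = 0 → w' t ≠ 0 := fun t h h' =>
    hne (funext fun x => aux_unique k hk w w' w'' hd1 hd2 heq t h h' x)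
  have hpos : ∀ T : ℝ, ∃ t < T, 0 < w t := by
    intro T
    by_contra! hcon
    obtain ⟨t, htT, ht⟩ := aux_zero k hk w w' w'' hd1 hd2 heq hlim T
    refine hz t ht (IsLocalMax.hasDerivAt_eq_zero ?_ (hd1 t))
    filter_upwards [Iio_mem_nhds htT] with x hx
    rw [ht]; exact hcon x hx
  have hneg : ∀ T : ℝ, ∃ t < T, w t < 0 := by
    intro T
    by_contra! hcon
    obtain ⟨t, htT, ht⟩ := aux_zero k hk w w' w'' hd1 hd2 heq hlim T
    refine hz t ht (IsLocalMin.hasDerivAt_eq_zero ?_ (hd1 t))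
    filter_upwards [Iio_mem_nhds htT] with x hx
    rw [ht]; exact hcon x hx
  intro T
  obtain ⟨t₂, h2, h2'⟩ := hpos T
  obtain ⟨t₁, h1, h1'⟩ := hneg t₂
  exact ⟨t₁, t₂, h1, h2, h1', h2'⟩
end

section
/- Let R ≥ 1 and let B_1 be the open unit ball in ℝ^2. Then for every Lipschitz function φ : ℝ^2 → ℝ with compact support contained in B_1, one has (1/4) ∫_{B_1} φ(x)^2 / ( |x|^2 (log(R/|x|))^2 ) dx ≤ ∫_{B_1} |∇φ(x)|^2 dx. -/
open Filter Topology Set MeasureTheory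

lemma hardy_aux_eps (R : ℝ) (hR : 1 ≤ R) (f : ℝ → ℝ) (L : NNReal) (hf : LipschitzWith L f)
    (ε ρ : ℝ) (hε : 0 < ε) (hερ : ε ≤ ρ) (hρ1 : ρ < 1) (hfρ : f ρ = 0) :
    ∫⁻ r in Ioc ε ρ, ENNReal.ofReal (r * (1 / 4 * ((f r) ^ 2 / (r ^ 2 * (Real.log (R / r)) ^ 2))))
      ≤ ∫⁻ r in Ioc ε ρ, ENNReal.ofReal (r * (deriv f r) ^ 2) := by
  have hlog : ∀ r, 0 < r → r < 1 → 0 < Real.log (R / r) := by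
    intro r h0 h1
    apply Real.log_pos
    rw [lt_div_iff₀ h0]; linarith
  have hmem : ∀ r ∈ Icc ε ρ, 0 < r ∧ 0 < Real.log (R / r) := fun r hr =>
    ⟨hε.trans_le hr.1, hlog r (hε.trans_le hr.1) (hr.2.trans_lt hρ1)⟩
  set A : ℝ → ℝ := fun r => r * (1 / 4 * ((f r) ^ 2 / (r ^ 2 * (Real.log (R / r)) ^ 2))) with hA
  set B : ℝ → ℝ := fun r => r * (deriv f r) ^ 2 with hB
  have hlogc : ContinuousOn (fun r => Real.log (R / r)) (Icc ε ρ) := by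
    apply ContinuousOn.log
    · exact continuousOn_const.div continuousOn_id (fun r hr => (hmem r hr).1.ne')
    · intro r hr
      have := (hmem r hr).1
      positivity
  have hfc := hf.continuous
  have hAc : ContinuousOn A (Icc ε ρ) := by
    apply continuousOn_id.mul
    apply continuousOn_const.mul
    apply ContinuousOn.div (by fun_prop) ((by fun_prop : ContinuousOn (fun r : ℝ => r ^ 2) _).mul (hlogc.pow 2))
    intro r hr
    obtain ⟨h1, h2⟩ := hmem r hr
    exact mul_ne_zero (pow_ne_zero _ h1.ne') (pow_ne_zero _ h2.ne')
  have hAi : IntegrableOn A (Ioc ε ρ) :=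
    (hAc.integrableOn_compact isCompact_Icc).mono_set Ioc_subset_Icc_self
  have hBi : IntegrableOn B (Ioc ε ρ) := by
    apply Measure.integrableOn_of_bounded (M := ρ * L ^ 2) (by simp)
    rotate_left
    · exact (measurable_id.mul ((measurable_deriv f).pow_const 2)).aestronglyMeasurable
    · filter_upwards [ae_restrict_mem measurableSet_Ioc] with r hr
      have h1 : 0 < r := hε.trans hr.1
      have h2 := norm_deriv_le_of_lipschitz (x₀ := r) hf
      simp only [hB, norm_mul, norm_pow, Real.norm_of_nonneg h1.le]
      exact mul_le_mul hr.2 (pow_le_pow_left₀ (norm_nonneg _) h2 2) (by positivity)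
        (h1.le.trans hr.2)
  have hA0 : 0 ≤ᵐ[volume.restrict (Ioc ε ρ)] A := by
    filter_upwards [ae_restrict_mem measurableSet_Ioc] with r hr
    have h1 : 0 < r := hε.trans hr.1
    simp only [hA, Pi.zero_apply]; positivity
  have hB0 : 0 ≤ᵐ[volume.restrict (Ioc ε ρ)] B := by
    filter_upwards [ae_restrict_mem measurableSet_Ioc] with r hr
    have h1 : 0 < r := hε.trans hr.1
    simp only [hB, Pi.zero_apply]; positivity
  rw [← ofReal_integral_eq_lintegral_ofReal hAi hA0, ← ofReal_integral_eq_lintegral_ofReal hBi hB0]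
  apply ENNReal.ofReal_le_ofReal
  -- main part
  set w : ℝ → ℝ := fun r => (Real.log (R / r))⁻¹ with hw
  have hfac : AbsolutelyContinuousOnInterval f ε ρ :=
    (hf.lipschitzOnWith (s := uIcc ε ρ)).absolutelyContinuousOnInterval
  have hwac : AbsolutelyContinuousOnInterval w ε ρ := by
    apply ContDiffOn.absolutelyContinuousOnInterval
    rw [uIcc_of_le hερ]
    apply ContDiffOn.inv
    · apply ContDiffOn.log
      · exact contDiffOn_const.div contDiffOn_id (fun r hr => (hmem r hr).1.ne')
      · intro r hr
        have := (hmem r hr).1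
        positivity
    · intro r hr
      exact (hmem r hr).2.ne'
  have hh := (hfac.fun_mul hfac).fun_mul hwac
  have hI := hh.integral_deriv_eq_sub
  have hint := hh.intervalIntegrable_deriv
  rw [intervalIntegrable_iff_integrableOn_Ioc_of_le hερ] at hint
  rw [intervalIntegral.integral_of_le hερ] at hI
  set h : ℝ → ℝ := fun r => f r * f r * w r with hhdef
  have hle : ∫ r in Ioc ε ρ, A r ≤ ∫ r in Ioc ε ρ, (B r + 1 / 2 * deriv h r) := by
    apply integral_mono_ae hAi (hBi.add (hint.const_mul _))
    filter_upwards [ae_restrict_mem measurableSet_Ioc,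
      ae_restrict_of_ae hf.ae_differentiableAt_real] with r hr hd
    obtain ⟨h1, h2⟩ := hmem r (Ioc_subset_Icc_self hr)
    have hRr : R / r ≠ 0 := by positivity
    have hdw : HasDerivAt w (1 / (r * Real.log (R / r) ^ 2)) r := by
      have e1 : HasDerivAt (fun r => R / r) (-R / r ^ 2) r := by
        have := (hasDerivAt_inv h1.ne').const_mul R
        simpa [div_eq_mul_inv] using this
      have := (e1.log hRr).fun_inv h2.ne'
      have hR0 : R ≠ 0 := by positivity
      have e2 : 1 / (r * Real.log (R / r) ^ 2)
          = -(-R / r ^ 2 / (R / r)) / Real.log (R / r) ^ 2 := by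
        have := h2.ne'
        generalize Real.log (R / r) = l at *
        field_simp
      rw [e2]
      exact this
    have hdh := (hd.hasDerivAt.fun_mul hd.hasDerivAt).fun_mul hdw
    change A r ≤ B r + 1 / 2 * deriv h r
    have hdh' : deriv h r = _ := hdh.deriv
    rw [hdh']
    simp only [hA, hB, hw]
    set l := Real.log (R / r)
    have key : 0 ≤ r * (deriv f r + f r / (2 * r * l)) ^ 2 := by positivity
    have : r * deriv f r ^ 2 + 1 / 2 * ((deriv f r * f r + f r * deriv f r) * l⁻¹
        + f r * f r * (1 / (r * l ^ 2))) - r * (1 / 4 * (f r ^ 2 / (r ^ 2 * l ^ 2)))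
        = r * (deriv f r + f r / (2 * r * l)) ^ 2 := by
      field_simp
      ring
    linarith
  rw [integral_add hBi (hint.const_mul _), integral_const_mul, hI] at hle
  have e1 : h ρ = 0 := by simp [hhdef, hfρ]
  have e2 : 0 ≤ h ε := by
    obtain ⟨h1, h2⟩ := hmem ε ⟨le_rfl, hερ⟩
    simp only [hhdef, hw]
    have := mul_self_nonneg (f ε)
    positivity
  linarith

lemma hardy_aux_1d (R : ℝ) (hR : 1 ≤ R) (f : ℝ → ℝ) (L : NNReal) (hf : LipschitzWith L f)
    (ρ : ℝ) (hρ0 : 0 < ρ) (hρ1 : ρ < 1) (hfρ : ∀ r, ρ ≤ r → f r = 0) :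
    ∫⁻ r in Ioi 0, ENNReal.ofReal (r * (1 / 4 * ((f r) ^ 2 / (r ^ 2 * (Real.log (R / r)) ^ 2))))
      ≤ ∫⁻ r in Ioi 0, ENNReal.ofReal (r * (deriv f r) ^ 2) := by
  have hU : Ioc 0 ρ = ⋃ n : ℕ, Ioc (ρ / (n + 1)) ρ := by
    ext r
    simp only [mem_Ioc, mem_iUnion]
    constructor
    · rintro ⟨h1, h2⟩
      obtain ⟨n, hn⟩ := exists_nat_one_div_lt (div_pos h1 hρ0)
      refine ⟨n, ?_, h2⟩
      rw [lt_div_iff₀ hρ0] at hn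
      calc ρ / (n + 1) = 1 / (n + 1) * ρ := by ring
        _ < r := hn
    · rintro ⟨n, h1, h2⟩
      exact ⟨lt_trans (by positivity) h1, h2⟩
  have hdir : Directed (· ⊆ ·) (fun n : ℕ => Ioc (ρ / ((n : ℝ) + 1)) ρ) := by
    apply Monotone.directed_le
    intro m n hmn
    apply Ioc_subset_Ioc_left
    gcongr
  have h1 : ∫⁻ r in Ioi 0, ENNReal.ofReal (r * (1 / 4 * ((f r) ^ 2 / (r ^ 2 * (Real.log (R / r)) ^ 2))))
      = ∫⁻ r in Ioc 0 ρ, ENNReal.ofReal (r * (1 / 4 * ((f r) ^ 2 / (r ^ 2 * (Real.log (R / r)) ^ 2)))) := by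
    rw [← Ioc_union_Ioi_eq_Ioi hρ0.le, lintegral_union measurableSet_Ioi]
    · rw [setLIntegral_congr_fun (g := fun _ => 0) measurableSet_Ioi]
      · simp
      · intro r hr
        simp [hfρ r (le_of_lt hr)]
    · exact Ioc_disjoint_Ioi le_rfl
  rw [h1, hU, setLIntegral_iUnion_of_directed _ hdir]
  apply iSup_le
  intro n
  have hpos : 0 < ρ / ((n : ℝ) + 1) := by positivity
  refine (hardy_aux_eps R hR f L hf _ ρ hpos ?_ hρ1 (hfρ ρ le_rfl)).trans ?_
  · apply div_le_self hρ0.le; linarith [(Nat.cast_nonneg n : (0 : ℝ) ≤ n)]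
  · apply lintegral_mono_set
    intro r hr
    exact hpos.trans hr.1

noncomputable def hardyU (θ : ℝ) : EuclideanSpace ℝ (Fin 2) :=
  Complex.orthonormalBasisOneI.repr (Real.cos θ + Real.sin θ * Complex.I)

lemma hardyU_norm (θ : ℝ) : ‖hardyU θ‖ = 1 := by
  rw [hardyU, LinearIsometryEquiv.norm_map]
  simpa using Complex.norm_exp_ofReal_mul_I θ ▸ congrArg norm (Complex.exp_mul_I (θ : ℂ)).symm

lemma hardyU_cont : Continuous hardyU := by
  unfold hardyU
  apply (LinearIsometryEquiv.continuous _).comp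
  fun_prop

lemma hardy_polar (F : EuclideanSpace ℝ (Fin 2) → ENNReal) (hF : Measurable F) :
    ∫⁻ x, F x = ∫⁻ θ in Ioo (-Real.pi) Real.pi, ∫⁻ r in Ioi (0 : ℝ),
      ENNReal.ofReal r * F (r • hardyU θ) := by
  have e := (Complex.orthonormalBasisOneI.repr).measurePreserving
  rw [← e.lintegral_comp hF, ← Complex.lintegral_comp_polarCoord_symm, polarCoord_target,
    Measure.volume_eq_prod, setLIntegral_prod_symm]
  · have : ∀ r θ : ℝ, Complex.orthonormalBasisOneI.repr (Complex.polarCoord.symm (r, θ))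
        = r • hardyU θ := by
      intro r θ
      rw [hardyU, Complex.polarCoord_symm_apply, ← map_smul, Complex.real_smul]
    simp only [this, smul_eq_mul]
  · apply Measurable.aemeasurable
    simp only [smul_eq_mul]
    apply Measurable.mul (by fun_prop)
    apply hF.comp
    apply (LinearIsometryEquiv.continuous _).measurable.comp
    have : (fun p : ℝ × ℝ => Complex.polarCoord.symm p) =
        fun p => p.1 * (Real.cos p.2 + Real.sin p.2 * Complex.I) :=
      funext Complex.polarCoord_symm_apply
    change Measurable (fun p : ℝ × ℝ => Complex.polarCoord.symm p)
    rw [this]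
    fun_prop

/-- The critical Hardy inequality in two dimensions: for `R ≥ 1` and any
Lipschitz function `φ` with compact support contained in the open unit ball
`B₁ ⊂ ℝ²`, one has
`(1/4) ∫_{B₁} φ² / (|x|² (log(R/|x|))²) ≤ ∫_{B₁} |∇φ|²`. -/
theorem stmt4 (R : ℝ) (hR : 1 ≤ R)
    (φ : EuclideanSpace ℝ (Fin 2) → ℝ) (L : NNReal)
    (hφ : LipschitzWith L φ)
    (hcpt : HasCompactSupport φ)
    (hsupp : tsupport φ ⊆ Metric.ball (0 : EuclideanSpace ℝ (Fin 2)) 1) :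
    (1 / 4) * ∫ x in Metric.ball (0 : EuclideanSpace ℝ (Fin 2)) 1,
        (φ x) ^ 2 / (‖x‖ ^ 2 * (Real.log (R / ‖x‖)) ^ 2)
      ≤ ∫ x in Metric.ball (0 : EuclideanSpace ℝ (Fin 2)) 1,
        ‖fderiv ℝ φ x‖ ^ 2 := by
  classical
  -- radius
  obtain ⟨ρ, hρ0, hρ1, hρ⟩ : ∃ ρ : ℝ, 0 < ρ ∧ ρ < 1 ∧ ∀ x, ρ ≤ ‖x‖ → φ x = 0 := by
    obtain ⟨ρ, ⟨h0, h1⟩, h2⟩ := exists_pos_lt_subset_ball one_pos (isClosed_tsupport φ) hsupp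
    refine ⟨ρ, h0, h1, fun x hx => ?_⟩
    by_contra hne
    have := h2 (subset_tsupport φ hne)
    rw [mem_ball_zero_iff] at this
    linarith
  have hfm : Measurable (fun x => ‖fderiv ℝ φ x‖ ^ 2) :=
    (measurable_fderiv ℝ φ).norm.pow_const 2
  have hφm : Measurable φ := hφ.continuous.measurable
  have hGm : Measurable (fun x : EuclideanSpace ℝ (Fin 2) =>
      1 / 4 * ((φ x) ^ 2 / (‖x‖ ^ 2 * (Real.log (R / ‖x‖)) ^ 2))) := by
    apply Measurable.const_mul
    apply Measurable.div (hφm.pow_const 2)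
    apply Measurable.mul (measurable_norm.pow_const 2)
    apply Measurable.pow_const
    exact Real.measurable_log.comp (measurable_const.div measurable_norm)
  rw [← integral_const_mul]
  have hfin : IntegrableOn (fun x => ‖fderiv ℝ φ x‖ ^ 2) (Metric.ball 0 1) := by
    apply Measure.integrableOn_of_bounded (M := (L : ℝ) ^ 2) measure_ball_lt_top.ne
      hfm.aestronglyMeasurable
    refine ae_of_all _ fun x => ?_
    rw [norm_pow, norm_norm]
    gcongr
    exact norm_fderiv_le_of_lipschitz ℝ hφ
  rw [integral_eq_lintegral_of_nonneg_ae (ae_of_all _ fun x => by positivity)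
    hGm.aestronglyMeasurable, integral_eq_lintegral_of_nonneg_ae
    (ae_of_all _ fun x => by positivity) hfm.aestronglyMeasurable]
  apply ENNReal.toReal_mono
  · exact (hfin.lintegral_lt_top).ne
  -- D
  set D : EuclideanSpace ℝ (Fin 2) → ENNReal := fun x =>
    if DifferentiableAt ℝ φ x then ENNReal.ofReal (‖fderiv ℝ φ x‖ ^ 2) else ⊤ with hD
  have hDm : Measurable D :=
    Measurable.ite (measurableSet_of_differentiableAt ℝ φ) hfm.ennreal_ofReal measurable_const
  have hR1 : ∫⁻ x in Metric.ball 0 1, ENNReal.ofReal (‖fderiv ℝ φ x‖ ^ 2) = ∫⁻ x, D x := by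
    rw [setLIntegral_eq_of_support_subset]
    · apply lintegral_congr_ae
      filter_upwards [hφ.ae_differentiableAt (μ := volume)] with x hx
      simp [hD, hx]
    · intro x hx
      apply hsupp
      apply support_fderiv_subset ℝ
      intro h0
      apply hx
      simp [h0]
  rw [hR1]
  refine (setLIntegral_le_lintegral _ _).trans ?_
  rw [hardy_polar _ hGm.ennreal_ofReal, hardy_polar _ hDm]
  apply lintegral_mono
  intro θ
  have hu := hardyU_norm θ
  set u := hardyU θ
  set f : ℝ → ℝ := fun r => φ (r • u) with hf
  have hfL : LipschitzWith L f := by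
    apply LipschitzWith.of_dist_le_mul
    intro a b
    refine (hφ.dist_le_mul _ _).trans ?_
    rw [dist_eq_norm, ← sub_smul, norm_smul, hu, mul_one, dist_eq_norm]
  have key := hardy_aux_1d R hR f L hfL ρ hρ0 hρ1 (by
    intro r hr
    apply hρ
    rw [norm_smul, hu, mul_one, Real.norm_of_nonneg (hρ0.le.trans hr)]
    exact hr)
  refine le_trans (le_of_eq ?_) (key.trans ?_)
  · apply setLIntegral_congr_fun measurableSet_Ioi
    intro r hr
    have hr0 : 0 < r := hr
    simp only
    rw [← ENNReal.ofReal_mul hr0.le, norm_smul, hu, mul_one, Real.norm_of_nonneg hr0.le]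
  · apply setLIntegral_mono' measurableSet_Ioi
    intro r hr
    have hr0 : 0 < r := hr
    rw [ENNReal.ofReal_mul hr0.le]
    gcongr
    simp only [hD]
    split_ifs with hd
    · apply ENNReal.ofReal_le_ofReal
      have h1 : HasDerivAt f (fderiv ℝ φ (r • u) u) r := by
        have h2 : HasDerivAt (fun r : ℝ => r • u) u r := by
          simpa using (hasDerivAt_id r).smul_const u
        exact hd.hasFDerivAt.comp_hasDerivAt r h2
      rw [h1.deriv, ← sq_abs]
      have := (fderiv ℝ φ (r • u)).le_opNorm u
      rw [hu, mul_one, Real.norm_eq_abs] at this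
      gcongr
    · exact le_top
end

section
/- Let R ≥ 1 and let B_1 be the open unit ball in ℝ^2. Then for every ε > 0 there exists a sequence (φ_n)_{n ∈ ℕ} of Lipschitz functions on ℝ^2, each not identically zero with compact support contained in B_1, such that the supports of φ_i and φ_j are disjoint whenever i ≠ j, and for every i ∈ ℕ, ((1+ε)/4) ∫_{B_1} φ_i(x)^2 / ( |x|^2 (log(R/|x|))^2 ) dx > ∫_{B_1} |∇φ_i(x)|^2 dx. -/
open Filter Topology Set MeasureTheory

lemma rad_int (A : ℝ → ℝ) {r1 r2 : ℝ} (h1 : 0 < r1) (h12 : r1 ≤ r2) (h2 : r2 < 1)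
    (hA : ∀ r, r ∉ Ioc r1 r2 → A r = 0) :
    ∫ x in Metric.ball (0 : EuclideanSpace ℝ (Fin 2)) 1, A ‖x‖ =
      (2 * (volume : Measure (EuclideanSpace ℝ (Fin 2))).real (Metric.ball 0 1)) *
        ∫ y in r1..r2, y * A y := by
  rw [setIntegral_eq_integral_of_forall_compl_eq_zero, integral_fun_norm_addHaar,
    intervalIntegral.integral_of_le h12]
  · have : ∫ y in Ioi (0 : ℝ), y ^ (Module.finrank ℝ (EuclideanSpace ℝ (Fin 2)) - 1) • A y
        = ∫ y in Ioc r1 r2, y * A y := by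
      rw [setIntegral_eq_of_subset_of_forall_sdiff_eq_zero measurableSet_Ioi
        (s := Ioc r1 r2)]
      · simp
      · intro y hy
        exact h1.trans hy.1
      · intro y hy
        simp [hA y hy.2]
    rw [this]
    simp
    ring
  · intro x hx
    apply hA
    intro h
    apply hx
    simpa using h.2.trans_lt h2

lemma rad_integrable (A : ℝ → ℝ) {r1 r2 : ℝ} (h1 : 0 < r1) (h12 : r1 ≤ r2)
    (hA : ∀ r, r ∉ Ioc r1 r2 → A r = 0)
    (hi : IntervalIntegrable (fun y => y * A y) volume r1 r2) :
    Integrable (fun x : EuclideanSpace ℝ (Fin 2) => A ‖x‖) := by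
  rw [integrable_fun_norm_addHaar]
  rw [intervalIntegrable_iff_integrableOn_Ioc_of_le h12] at hi
  have : (fun y : ℝ => y ^ (Module.finrank ℝ (EuclideanSpace ℝ (Fin 2)) - 1) • A y) =
      fun y => y * A y := by
    ext y; simp
  rw [this]
  refine IntegrableOn.of_forall_sdiff_eq_zero hi measurableSet_Ioi ?_
  intro y hy
  simp [hA y hy.2]

lemma build (R c : ℝ) (hc : 0 ≤ c) (G G' : ℝ → ℝ) {r1 r2 : ℝ} (h1 : 0 < r1) (h12 : r1 < r2) (h2 : r2 < 1)
    (hG : ∀ r ∈ Icc r1 r2, HasDerivAt G (G' r) r) (hG' : ContinuousOn G' (Icc r1 r2))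
    (e1 : G r1 = 0) (e2 : G r2 = 0) (hpos : ∀ r ∈ Ioo r1 r2, 0 < G r)
    (hI : ∫ r in r1..r2, r * G' r ^ 2 <
      c * ∫ r in r1..r2, r * (G r ^ 2 / (r ^ 2 * (Real.log (R / r)) ^ 2))) :
    ∃ φ : EuclideanSpace ℝ (Fin 2) → ℝ,
      (∃ L : NNReal, LipschitzWith L φ) ∧ φ ≠ 0 ∧
      Function.support φ ⊆ {x | r1 < ‖x‖ ∧ ‖x‖ < r2} ∧
      (∫ x in Metric.ball (0 : EuclideanSpace ℝ (Fin 2)) 1, ‖fderiv ℝ φ x‖ ^ 2)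
          < c * ∫ x in Metric.ball (0 : EuclideanSpace ℝ (Fin 2)) 1,
            (φ x) ^ 2 / (‖x‖ ^ 2 * (Real.log (R / ‖x‖)) ^ 2) := by
  classical
  set f : ℝ → ℝ := fun r => G (max r1 (min r2 r)) with hf
  have fIcc : ∀ r ∈ Icc r1 r2, f r = G r := by
    intro r hr
    simp [hf, min_eq_right hr.2, max_eq_right hr.1]
  have f0 : ∀ r, r ∉ Ioo r1 r2 → f r = 0 := by
    intro r hr
    by_cases h : r1 < r
    · have h' : r2 ≤ r := by
        by_contra h'
        exact hr ⟨h, not_le.1 h'⟩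
      simp [hf, min_eq_left h', max_eq_right h12.le, e2]
    · have h' : r ≤ r1 := not_lt.1 h
      simp [hf, min_eq_right (h'.trans h12.le), max_eq_left h', e1]
  have fnn : ∀ r, 0 ≤ f r := by
    intro r
    by_cases h : r ∈ Ioo r1 r2
    · rw [fIcc r (Ioo_subset_Icc_self h)]; exact (hpos r h).le
    · rw [f0 r h]
  have hsupp : Function.support (fun x : EuclideanSpace ℝ (Fin 2) => f ‖x‖) ⊆
      {x | r1 < ‖x‖ ∧ ‖x‖ < r2} := by
    intro x hx
    by_contra h
    exact hx (f0 _ h)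
  refine ⟨fun x => f ‖x‖, ?_, ?_, hsupp, ?_⟩
  · obtain ⟨C, hC⟩ := isCompact_Icc.exists_bound_of_continuousOn hG'
    have hL : LipschitzOnWith C.toNNReal G (Icc r1 r2) := by
      refine (convex_Icc r1 r2).lipschitzOnWith_of_nnnorm_hasDerivWithin_le
        (fun x hx => (hG x hx).hasDerivWithinAt) ?_
      intro x hx
      rw [← NNReal.coe_le_coe, coe_nnnorm]
      exact (hC x hx).trans (Real.le_coe_toNNReal C)
    have hcl : LipschitzWith 1 (fun x : EuclideanSpace ℝ (Fin 2) => max r1 (min r2 ‖x‖)) :=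
      (lipschitzWith_one_norm.const_min r2).const_max r1
    refine ⟨C.toNNReal * 1, ?_⟩
    rw [← lipschitzOnWith_univ] at hcl ⊢
    refine hL.comp hcl ?_
    intro x _
    exact ⟨le_max_left _ _, max_le h12.le (min_le_left _ _)⟩
  · intro h
    have := congrFun h (EuclideanSpace.single 0 ((r1 + r2) / 2))
    have hm : (r1 + r2) / 2 ∈ Ioo r1 r2 := ⟨by linarith, by linarith⟩
    have hp : 0 < (r1 + r2) / 2 := h1.trans hm.1
    simp only [PiLp.norm_single, Real.norm_eq_abs, abs_of_pos hp, Pi.zero_apply] at this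
    rw [fIcc _ (Ioo_subset_Icc_self hm)] at this
    exact (hpos _ hm).ne' this
  · have hvol : 0 < 2 * (volume : Measure (EuclideanSpace ℝ (Fin 2))).real (Metric.ball 0 1) := by
      have := Metric.measure_ball_pos (volume : Measure (EuclideanSpace ℝ (Fin 2))) 0 one_pos
      have h' := measure_ball_lt_top (μ := (volume : Measure (EuclideanSpace ℝ (Fin 2)))) (x := 0) (r := 1)
      have : 0 < (volume : Measure (EuclideanSpace ℝ (Fin 2))).real (Metric.ball 0 1) :=
        ENNReal.toReal_pos this.ne' h'.ne
      linarith
    set A : ℝ → ℝ := indicator (Ioc r1 r2) (fun r => G' r ^ 2) with hA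
    have hA0 : ∀ r, r ∉ Ioc r1 r2 → A r = 0 := fun r hr => indicator_of_notMem hr _
    have hAc : ∀ r ∈ Ioc r1 r2, r * G' r ^ 2 = r * A r := by
      intro r hr; rw [hA, indicator_of_mem hr]
    have hAi : IntervalIntegrable (fun y => y * A y) volume r1 r2 := by
      have : IntervalIntegrable (fun y => y * G' y ^ 2) volume r1 r2 := by
        apply ContinuousOn.intervalIntegrable
        rw [uIcc_of_le h12.le]
        exact continuousOn_id.mul (hG'.pow 2)
      refine this.congr ?_
      rw [uIoc_of_le h12.le]
      intro r hr
      exact hAc r hr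
    have hle : (∫ x in Metric.ball (0 : EuclideanSpace ℝ (Fin 2)) 1,
        ‖fderiv ℝ (fun x : EuclideanSpace ℝ (Fin 2) => f ‖x‖) x‖ ^ 2) ≤
        ∫ x in Metric.ball (0 : EuclideanSpace ℝ (Fin 2)) 1, A ‖x‖ := by
      refine integral_mono_of_nonneg (ae_of_all _ fun x => by positivity)
        (rad_integrable A h1 h12.le hA0 hAi).integrableOn (ae_of_all _ fun x => ?_)
      show ‖fderiv ℝ (fun x : EuclideanSpace ℝ (Fin 2) => f ‖x‖) x‖ ^ 2 ≤ A ‖x‖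
      by_cases hx : ‖x‖ ∈ Ioo r1 r2
      · rw [hA, indicator_of_mem (Ioo_subset_Ioc_self hx), ← sq_abs (G' ‖x‖)]
        have hd : HasDerivAt f (G' ‖x‖) ‖x‖ := by
          refine (hG _ (Ioo_subset_Icc_self hx)).congr_of_eventuallyEq ?_
          filter_upwards [Ioo_mem_nhds hx.1 hx.2] with r hr
          exact fIcc r (Ioo_subset_Icc_self hr)
        have hx0 : x ≠ 0 := norm_pos_iff.1 (h1.trans hx.1)
        have hn : HasFDerivAt (fun x : EuclideanSpace ℝ (Fin 2) => ‖x‖) (fderiv ℝ (fun x : EuclideanSpace ℝ (Fin 2) => ‖x‖) x) x :=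
          (((contDiffAt_norm ℝ hx0).differentiableAt (n := 1) one_ne_zero)).hasFDerivAt
        have hc' := hd.comp_hasFDerivAt x hn
        have hE : fderiv ℝ (fun x : EuclideanSpace ℝ (Fin 2) => f ‖x‖) x = _ := hc'.fderiv
        rw [hE, norm_smul, Real.norm_eq_abs]
        have hb : ‖fderiv ℝ (fun x : EuclideanSpace ℝ (Fin 2) => ‖x‖) x‖ ≤ 1 := by
          simpa using norm_fderiv_le_of_lipschitz ℝ (x₀ := x) (lipschitzWith_one_norm (E := EuclideanSpace ℝ (Fin 2)))
        have := mul_le_of_le_one_right (abs_nonneg (G' ‖x‖)) hb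
        gcongr
      · have : fderiv ℝ (fun x : EuclideanSpace ℝ (Fin 2) => f ‖x‖) x = 0 := by
          apply IsLocalMin.fderiv_eq_zero
          refine Eventually.of_forall fun y => ?_
          simp only [f0 _ hx]
          exact fnn _
        rw [this]
        simp only [norm_zero]
        rw [hA]
        have := indicator_nonneg (s := Ioc r1 r2) (f := fun r => G' r ^ 2) (fun r _ => sq_nonneg _) ‖x‖
        simpa using this
    refine hle.trans_lt ?_
    rw [rad_int A h1 h12.le h2 hA0,
      rad_int (fun r => f r ^ 2 / (r ^ 2 * (Real.log (R / r)) ^ 2)) h1 h12.le h2 ?_]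
    · have k1 : ∫ y in r1..r2, y * A y = ∫ r in r1..r2, r * G' r ^ 2 := by
        rw [intervalIntegral.integral_of_le h12.le, intervalIntegral.integral_of_le h12.le]
        exact setIntegral_congr_fun measurableSet_Ioc fun r hr => (hAc r hr).symm
      have k2 : ∫ y in r1..r2, y * (f y ^ 2 / (y ^ 2 * (Real.log (R / y)) ^ 2)) =
          ∫ r in r1..r2, r * (G r ^ 2 / (r ^ 2 * (Real.log (R / r)) ^ 2)) := by
        rw [intervalIntegral.integral_of_le h12.le, intervalIntegral.integral_of_le h12.le]
        refine setIntegral_congr_fun measurableSet_Ioc fun r hr => ?_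
        simp only [fIcc r (Ioc_subset_Icc_self hr)]
      rw [k1, k2, mul_left_comm]
      exact mul_lt_mul_of_pos_left hI hvol
    · intro r hr
      have : f r = 0 := f0 r fun h => hr (Ioo_subset_Ioc_self h)
      simp [this]

lemma one_piece (R : ℝ) (hR : 1 ≤ R) (ε w a : ℝ) (hw : 0 < w) (hwe : w ^ 2 = ε / 8)
    (ha : Real.log R < a) :
    ∃ φ : EuclideanSpace ℝ (Fin 2) → ℝ,
      (∃ L : NNReal, LipschitzWith L φ) ∧ φ ≠ 0 ∧
      Function.support φ ⊆ {x | R * Real.exp (-(a * Real.exp (Real.pi / w))) < ‖x‖ ∧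
        ‖x‖ < R * Real.exp (-a)} ∧
      (∫ x in Metric.ball (0 : EuclideanSpace ℝ (Fin 2)) 1, ‖fderiv ℝ φ x‖ ^ 2)
          < ((1 + ε) / 4) * ∫ x in Metric.ball (0 : EuclideanSpace ℝ (Fin 2)) 1,
            (φ x) ^ 2 / (‖x‖ ^ 2 * (Real.log (R / ‖x‖)) ^ 2) := by
  have hRpos : 0 < R := by linarith
  have ha0 : 0 < a := (Real.log_nonneg hR).trans_lt ha
  have hpw : 0 < Real.pi / w := div_pos Real.pi_pos hw
  set b := a * Real.exp (Real.pi / w) with hb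
  have hab : a < b := by
    have : 1 < Real.exp (Real.pi / w) := Real.one_lt_exp_iff.2 hpw
    nlinarith
  set r1 := R * Real.exp (-b) with hr1
  set r2 := R * Real.exp (-a) with hr2
  have h1 : 0 < r1 := by positivity
  have h12 : r1 < r2 := by
    have : Real.exp (-b) < Real.exp (-a) := Real.exp_lt_exp.2 (by linarith)
    exact mul_lt_mul_of_pos_left this hRpos
  have h2 : r2 < 1 := by
    have : r2 = Real.exp (Real.log R - a) := by
      rw [hr2, sub_eq_add_neg, Real.exp_add, Real.exp_log hRpos]
    rw [this, Real.exp_lt_one_iff]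
    linarith
  set t : ℝ → ℝ := fun r => Real.log (R / r) with ht
  set θ : ℝ → ℝ := fun r => w * Real.log (t r / a) with hθ
  have t1 : t r1 = b := by
    simp only [ht, hr1]
    rw [div_mul_eq_div_div, div_self hRpos.ne', one_div, ← Real.exp_neg, neg_neg, Real.log_exp]
  have t2 : t r2 = a := by
    simp only [ht, hr2]
    rw [div_mul_eq_div_div, div_self hRpos.ne', one_div, ← Real.exp_neg, neg_neg, Real.log_exp]
  have th1 : θ r1 = Real.pi := by
    simp only [hθ, t1, hb]
    rw [mul_div_cancel_left₀ _ ha0.ne', Real.log_exp]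
    field_simp
  have th2 : θ r2 = 0 := by
    simp only [hθ, t2]
    rw [div_self ha0.ne']; simp
  have tanti : ∀ x y, 0 < x → x < y → t y < t x := by
    intro x y hx hxy
    apply Real.log_lt_log (div_pos hRpos (hx.trans hxy))
    exact div_lt_div_of_pos_left hRpos hx hxy
  have rpos : ∀ r ∈ Icc r1 r2, 0 < r := fun r hr => h1.trans_le hr.1
  have tpos : ∀ r ∈ Icc r1 r2, 0 < t r := by
    intro r hr
    rcases hr.2.eq_or_lt with h | h
    · rw [h, t2]; exact ha0
    · have := tanti r r2 (rpos r hr) h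
      rw [t2] at this; linarith
  have thIoo : ∀ r ∈ Ioo r1 r2, 0 < θ r ∧ θ r < Real.pi := by
    intro r hr
    have hr0 := h1.trans hr.1
    have l1 := tanti r r2 hr0 hr.2
    have l2 := tanti r1 r h1 hr.1
    have key : ∀ x y, 0 < x → x < y → w * Real.log (x / a) < w * Real.log (y / a) := by
      intro x y hx hxy
      apply mul_lt_mul_of_pos_left _ hw
      apply Real.log_lt_log (by positivity)
      exact div_lt_div_of_pos_right hxy ha0
    constructor
    · rw [← th2]; exact key _ _ (by rw [t2]; exact ha0) l1
    · rw [← th1]; exact key _ _ (tpos r (Ioo_subset_Icc_self hr)) l2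
  have dt : ∀ r ∈ Icc r1 r2, HasDerivAt t (-(1 / r)) r := by
    intro r hr
    have hr0 := rpos r hr
    have := ((hasDerivAt_inv hr0.ne').const_mul R).log (by positivity)
    have hfun : t = fun y => Real.log (R * y⁻¹) := by
      funext y
      simp only [ht, div_eq_mul_inv]
    rw [hfun]
    refine HasDerivAt.congr_deriv this ?_
    field_simp
  have dθ : ∀ r ∈ Icc r1 r2, HasDerivAt θ (-(w / (r * t r))) r := by
    intro r hr
    have hr0 := rpos r hr
    have ht0 := tpos r hr
    have := (((dt r hr).div_const a).log (by positivity)).const_mul w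
    refine HasDerivAt.congr_deriv this ?_
    field_simp
  set G : ℝ → ℝ := fun r => Real.sqrt (t r) * Real.sin (θ r) with hG
  set G' : ℝ → ℝ := fun r => -(1 / (r * Real.sqrt (t r))) *
    (Real.sin (θ r) / 2 + w * Real.cos (θ r)) with hG'
  have dG : ∀ r ∈ Icc r1 r2, HasDerivAt G (G' r) r := by
    intro r hr
    have hr0 := rpos r hr
    have ht0 := tpos r hr
    have := ((dt r hr).sqrt ht0.ne').mul (dθ r hr).sin
    refine HasDerivAt.congr_deriv this ?_
    have hs : 0 < Real.sqrt (t r) := Real.sqrt_pos.2 ht0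
    simp only [hG']
    generalize hS : Real.sqrt (t r) = S at *
    have : t r = S ^ 2 := by rw [← hS, Real.sq_sqrt ht0.le]
    rw [this]
    field_simp
    ring
  have ct : ContinuousOn t (Icc r1 r2) := fun r hr => (dt r hr).continuousAt.continuousWithinAt
  have cθ : ContinuousOn θ (Icc r1 r2) := fun r hr => (dθ r hr).continuousAt.continuousWithinAt
  have cG : ContinuousOn G (Icc r1 r2) := fun r hr => (dG r hr).continuousAt.continuousWithinAt
  have cs := Real.continuous_sin.comp_continuousOn cθ
  have cc := Real.continuous_cos.comp_continuousOn cθ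
  have cG' : ContinuousOn G' (Icc r1 r2) := by
    refine ContinuousOn.mul (ContinuousOn.neg (continuousOn_const.div
      (continuousOn_id.mul ct.sqrt) ?_)) ((cs.div_const 2).add (continuousOn_const.mul cc))
    intro r hr
    exact (mul_pos (rpos r hr) (Real.sqrt_pos.2 (tpos r hr))).ne'
  have hε : 0 < ε := by nlinarith [pow_pos hw 2]
  refine build R ((1 + ε) / 4) (by linarith) G G' h1 h12 h2 dG cG' (by simp [hG, th1])
    (by simp [hG, th2]) ?_ ?_
  · intro r hr
    exact mul_pos (Real.sqrt_pos.2 (tpos r (Ioo_subset_Icc_self hr)))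
      (Real.sin_pos_of_pos_of_lt_pi (thIoo r hr).1 (thIoo r hr).2)
  set P : ℝ → ℝ := fun r => w * (Real.sin (θ r) * Real.cos (θ r)) + Real.sin (θ r) ^ 2 / 2 with hP
  set P' : ℝ → ℝ := fun r => (w * (Real.cos (θ r) ^ 2 - Real.sin (θ r) ^ 2) +
    Real.sin (θ r) * Real.cos (θ r)) * (-(w / (r * t r))) with hP'
  set Q : ℝ → ℝ := fun r => w ^ 2 * Real.sin (θ r) ^ 2 / (r * t r) with hQ
  have rt0 : ∀ r ∈ Icc r1 r2, r * t r ≠ 0 := fun r hr => (mul_pos (rpos r hr) (tpos r hr)).ne'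
  have crt : ContinuousOn (fun r => r * t r) (Icc r1 r2) := continuousOn_id.mul ct
  have dP : ∀ r ∈ Icc r1 r2, HasDerivAt P (P' r) r := by
    intro r hr
    have := (((dθ r hr).sin.mul (dθ r hr).cos).const_mul w).add (((dθ r hr).sin.pow 2).div_const 2)
    refine HasDerivAt.congr_deriv this ?_
    simp only [hP']
    ring
  have iP : IntervalIntegrable P' volume r1 r2 := by
    apply ContinuousOn.intervalIntegrable
    rw [uIcc_of_le h12.le]
    exact ((continuousOn_const.mul ((cc.pow 2).sub (cs.pow 2))).add (cs.mul cc)).mul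
      (continuousOn_const.div crt rt0).neg
  have iQ : IntervalIntegrable Q volume r1 r2 := by
    apply ContinuousOn.intervalIntegrable
    rw [uIcc_of_le h12.le]
    exact (continuousOn_const.mul (cs.pow 2)).div crt rt0
  have iA : IntervalIntegrable (fun r => r * G' r ^ 2) volume r1 r2 := by
    apply ContinuousOn.intervalIntegrable
    rw [uIcc_of_le h12.le]
    exact continuousOn_id.mul (cG'.pow 2)
  have zP : ∫ r in r1..r2, P' r = 0 := by
    rw [intervalIntegral.integral_eq_sub_of_hasDerivAt (f := P) _ iP]
    · simp [hP, th1, th2]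
    · intro r hr
      rw [uIcc_of_le h12.le] at hr
      exact dP r hr
  have pQ : 0 < ∫ r in r1..r2, Q r := by
    refine intervalIntegral.intervalIntegral_pos_of_pos_on iQ ?_ h12
    intro r hr
    have h3 := Real.sin_pos_of_pos_of_lt_pi (thIoo r hr).1 (thIoo r hr).2
    have h4 := rpos r (Ioo_subset_Icc_self hr)
    have h5 := tpos r (Ioo_subset_Icc_self hr)
    simp only [hQ]
    positivity
  have key : ((1 + ε) / 4) * ∫ r in r1..r2, r * (G r ^ 2 / (r ^ 2 * (Real.log (R / r)) ^ 2)) =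
      ∫ r in r1..r2, (r * G' r ^ 2 + Q r + P' r) := by
    rw [← intervalIntegral.integral_const_mul]
    apply intervalIntegral.integral_congr
    intro r hr
    rw [uIcc_of_le h12.le] at hr
    have hr0 := rpos r hr
    have ht0 := tpos r hr
    have hs : 0 < Real.sqrt (t r) := Real.sqrt_pos.2 ht0
    show (1 + ε) / 4 * (r * ((Real.sqrt (t r) * Real.sin (θ r)) ^ 2 / (r ^ 2 * (t r) ^ 2))) =
      r * (-(1 / (r * Real.sqrt (t r))) *
        (Real.sin (θ r) / 2 + w * Real.cos (θ r))) ^ 2 +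
      w ^ 2 * Real.sin (θ r) ^ 2 / (r * t r) +
      (w * (Real.cos (θ r) ^ 2 - Real.sin (θ r) ^ 2) +
        Real.sin (θ r) * Real.cos (θ r)) * (-(w / (r * t r)))
    generalize hS : Real.sqrt (t r) = S at *
    have : t r = S ^ 2 := by rw [← hS, Real.sq_sqrt ht0.le]
    rw [this]
    generalize Real.sin (θ r) = s
    generalize Real.cos (θ r) = c
    have he : ε = 8 * w ^ 2 := by linarith
    rw [he]
    field_simp
    ring
  rw [key, intervalIntegral.integral_add (iA.add iQ) iP, intervalIntegral.integral_add iA iQ, zP]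
  linarith

/-- Optimality of the constant `1/4` in the critical Hardy inequality in two
dimensions: for `R ≥ 1` and any `ε > 0`, there is a sequence of nontrivial
Lipschitz functions with compact supports in the unit ball `B₁ ⊂ ℝ²`,
pairwise disjoint supports, each violating the Hardy inequality with constant
`(1+ε)/4`. -/
theorem stmt5 (R : ℝ) (hR : 1 ≤ R) (ε : ℝ) (hε : 0 < ε) :
    ∃ φ : ℕ → EuclideanSpace ℝ (Fin 2) → ℝ,
      (∀ n : ℕ, ∃ L : NNReal, LipschitzWith L (φ n)) ∧
      (∀ n : ℕ, φ n ≠ 0) ∧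
      (∀ n : ℕ, HasCompactSupport (φ n)) ∧
      (∀ n : ℕ, tsupport (φ n) ⊆ Metric.ball (0 : EuclideanSpace ℝ (Fin 2)) 1) ∧
      (∀ i j : ℕ, i ≠ j →
        Disjoint (Function.support (φ i)) (Function.support (φ j))) ∧
      (∀ n : ℕ,
        (∫ x in Metric.ball (0 : EuclideanSpace ℝ (Fin 2)) 1,
            ‖fderiv ℝ (φ n) x‖ ^ 2)
          < ((1 + ε) / 4) * ∫ x in Metric.ball (0 : EuclideanSpace ℝ (Fin 2)) 1,
            (φ n x) ^ 2 / (‖x‖ ^ 2 * (Real.log (R / ‖x‖)) ^ 2)) := by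
  set w := Real.sqrt (ε / 8) with hw
  have hw0 : 0 < w := Real.sqrt_pos.2 (by linarith)
  have hw2 : w ^ 2 = ε / 8 := Real.sq_sqrt (by linarith)
  have hRpos : 0 < R := by linarith
  set q := Real.exp (Real.pi / w) with hq
  have hq1 : 1 < q := Real.one_lt_exp_iff.2 (div_pos Real.pi_pos hw0)
  set a : ℕ → ℝ := fun n => (Real.log R + 1) * q ^ n with ha
  have hl := Real.log_nonneg hR
  have ha1 : ∀ n, Real.log R < a n := by
    intro n
    have : 1 ≤ q ^ n := one_le_pow₀ hq1.le
    simp only [ha]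
    nlinarith
  have hsucc : ∀ n, a n * q = a (n + 1) := by
    intro n; simp only [ha]; ring
  have hmono : Monotone a := by
    intro m n hmn
    have := pow_le_pow_right₀ hq1.le hmn
    simp only [ha]
    gcongr
  choose φ hL hne hs hI using fun n => one_piece R hR ε w (a n) hw0 hw2 (ha1 n)
  have hball : ∀ n, tsupport (φ n) ⊆ Metric.closedBall 0 (R * Real.exp (-a n)) := by
    intro n
    apply closure_minimal _ Metric.isClosed_closedBall
    intro x hx
    simpa using (hs n hx).2.le
  have hlt : ∀ n, R * Real.exp (-a n) < 1 := by
    intro n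
    have : R * Real.exp (-a n) = Real.exp (Real.log R - a n) := by
      rw [sub_eq_add_neg, Real.exp_add, Real.exp_log hRpos]
    rw [this, Real.exp_lt_one_iff]
    linarith [ha1 n]
  have hdis : ∀ i j, i < j → Disjoint (Function.support (φ i)) (Function.support (φ j)) := by
    intro i j hij
    rw [Set.disjoint_left]
    intro x hi hj
    have h1 := (hs i hi).1
    have h2 := (hs j hj).2
    rw [← hq, hsucc] at h1
    have h3 : a (i + 1) ≤ a j := hmono hij
    have h4 : R * Real.exp (-a j) ≤ R * Real.exp (-a (i + 1)) := by gcongr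
    linarith
  refine ⟨φ, hL, hne, ?_, ?_, ?_, hI⟩
  · intro n
    exact (isCompact_closedBall _ _).of_isClosed_subset (isClosed_tsupport _) (hball n)
  · intro n
    exact (hball n).trans (Metric.closedBall_subset_ball (hlt n))
  · intro i j hij
    rcases lt_or_gt_of_ne hij with h | h
    · exact hdis i j h
    · exact (hdis j i h).symm
end

section
/- Let k > 0 and let V_k(r) = 1/(r^2 (1 - log r)^{2+k}) for 0 < r < e. If v is a C^2 function on (0, e) satisfying v''(r) + v'(r)/r + V_k(r) e^{v(r)} = 0 for all 0 < r < e and v(r) → ∞ as r → 0+, then v(r) = k·log(1 - log r) + log k for all 0 < r < e. In particular the equation has exactly one singular solution, namely W(r) = k·log(1 - log r) + log k. -/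
open Filter Topology Set MeasureTheory

set_option linter.unusedSimpArgs false

lemma aux_anti (f f' : ℝ → ℝ) (a : ℝ) (h : ∀ s, HasDerivAt f (f' s) s)
    (h' : ∀ s, a ≤ s → f' s ≤ 0) : ∀ b, a ≤ b → f b ≤ f a := by
  intro b hb
  have : AntitoneOn f (Set.Ici a) := by
    apply antitoneOn_of_deriv_nonpos (convex_Ici a)
    · exact fun s _ => (h s).continuousAt.continuousWithinAt
    · exact fun s _ => (h s).differentiableAt.differentiableWithinAt
    · intro s hs
      rw [(h s).deriv]
      rw [interior_Ici] at hs
      exact h' s (le_of_lt hs)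
  exact this (Set.mem_Ici.2 le_rfl) (Set.mem_Ici.2 hb) hb

lemma aux_mono_s6 (f f' : ℝ → ℝ) (a : ℝ) (h : ∀ s, HasDerivAt f (f' s) s)
    (h' : ∀ s, a ≤ s → 0 ≤ f' s) : ∀ b, a ≤ b → f a ≤ f b := by
  intro b hb
  have := aux_anti (fun s => - f s) (fun s => - f' s) a (fun s => (h s).neg)
    (fun s hs => by have := h' s hs; linarith) b hb
  try simp only at this
  linarith

lemma aux_expneg (s : ℝ) : HasDerivAt (fun s : ℝ => Real.exp (-s)) (-Real.exp (-s)) s := by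
  have := (hasDerivAt_neg s).exp
  refine HasDerivAt.congr_deriv (this) ?_
  try simp only [Pi.mul_apply, Pi.sub_apply, Pi.neg_apply, Function.comp, id]
  ring

lemma aux_expnegk (k s : ℝ) :
    HasDerivAt (fun s : ℝ => Real.exp (-(k * s))) (-k * Real.exp (-(k * s))) s := by
  have := (((hasDerivAt_id s).const_mul k).neg).exp
  refine HasDerivAt.congr_deriv (this) ?_
  try simp only [Pi.mul_apply, Pi.sub_apply, Pi.neg_apply, Function.comp, id]
  simp; ring

lemma aux_tend (k : ℝ) (hk : 0 < k) :
    Tendsto (fun s : ℝ => Real.exp (-(k * s))) atTop (𝓝 0) := by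
  apply Real.tendsto_exp_atBot.comp
  apply tendsto_neg_atTop_atBot.comp
  exact tendsto_id.const_mul_atTop hk

/-- positivity of `y` and the bounds -/
lemma aux_bounds (k : ℝ) (hk : 0 < k) (U y : ℝ → ℝ)
    (hU : ∀ s, HasDerivAt U (y s) s)
    (hy : ∀ s, HasDerivAt y (y s - Real.exp (U s - k * s)) s)
    (hinf : Tendsto U atTop atTop) :
    (∀ s, 0 < y s) ∧ (∀ s, Real.exp (U s - k * s) ≤ k * (k + 1)) ∧
      (∀ s, y s ≤ k * (k + 1)) := by
  have hye : ∀ s, HasDerivAt (fun s => y s * Real.exp (-s))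
      (-(Real.exp (U s - k * s) * Real.exp (-s))) s := by
    intro s
    refine HasDerivAt.congr_deriv ((hy s).mul (aux_expneg s)) ?_
    try simp only [Pi.mul_apply, Pi.sub_apply, Pi.neg_apply, Function.comp, id]
    ring
  have hpos : ∀ s, 0 < y s := by
    intro s0
    by_contra! h0
    have h1 : ∀ s, s0 ≤ s → y s ≤ 0 := by
      intro s hs
      have h2 := aux_anti _ _ s0 hye (fun s _ => by
        have := mul_pos (Real.exp_pos (U s - k * s)) (Real.exp_pos (-s)); linarith) s hs
      try simp only at h2
      have h3 : y s0 * Real.exp (-s0) ≤ 0 :=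
        mul_nonpos_of_nonpos_of_nonneg h0 (Real.exp_pos _).le
      by_contra! h4
      have := mul_pos h4 (Real.exp_pos (-s))
      linarith
    have h2 := aux_anti U y s0 hU h1
    obtain ⟨s, hs1, hs2⟩ := ((hinf.eventually_gt_atTop (U s0)).and (eventually_ge_atTop s0)).exists
    have := h2 s hs2
    linarith
  have hUm : ∀ a b, a ≤ b → U a ≤ U b := fun a b hab =>
    aux_mono_s6 U y a hU (fun s _ => (hpos s).le) b hab
  have hylow : ∀ s, Real.exp (U s - k * s) / (k + 1) ≤ y s := by
    intro s0
    have hd : ∀ s, HasDerivAt (fun s => y s * Real.exp (-s) -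
        Real.exp (U s0) / (k + 1) * Real.exp (-((k + 1) * s)))
        (-(Real.exp (U s - k * s) * Real.exp (-s)) -
          Real.exp (U s0) / (k + 1) * (-(k + 1) * Real.exp (-((k + 1) * s)))) s :=
      fun s => (hye s).sub ((aux_expnegk (k + 1) s).const_mul _)
    have h1 := aux_anti _ _ s0 hd (by
      intro s hs
      have e1 : Real.exp (U s - k * s) * Real.exp (-s) =
          Real.exp (U s) * Real.exp (-((k + 1) * s)) := by
        rw [← Real.exp_add, ← Real.exp_add]; congr 1; ring
      have e2 : Real.exp (U s0) / (k + 1) * (-(k + 1) * Real.exp (-((k + 1) * s))) =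
          - (Real.exp (U s0) * Real.exp (-((k + 1) * s))) := by
        field_simp
      rw [e1, e2]
      have := mul_le_mul_of_nonneg_right (Real.exp_le_exp.2 (hUm s0 s hs))
        (Real.exp_pos (-((k + 1) * s))).le
      linarith)
    have ht : Tendsto (fun s => - (Real.exp (U s0) / (k + 1) * Real.exp (-((k + 1) * s))))
        atTop (𝓝 0) := by
      simpa using ((aux_tend (k + 1) (by linarith)).const_mul (Real.exp (U s0) / (k + 1))).neg
    have h2 : 0 ≤ y s0 * Real.exp (-s0) -
        Real.exp (U s0) / (k + 1) * Real.exp (-((k + 1) * s0)) := by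
      refine le_of_tendsto ht ?_
      filter_upwards [eventually_ge_atTop s0] with s hs
      have h3 := h1 s hs
      try simp only at h3
      have := mul_pos (hpos s) (Real.exp_pos (-s))
      linarith
    have e3 : Real.exp (U s0) / (k + 1) * Real.exp (-((k + 1) * s0)) =
        Real.exp (U s0 - k * s0) / (k + 1) * Real.exp (-s0) := by
      rw [div_mul_eq_mul_div, div_mul_eq_mul_div, ← Real.exp_add, ← Real.exp_add]
      congr 2; ring
    rw [e3] at h2
    exact le_of_mul_le_mul_right (by linarith) (Real.exp_pos (-s0))
  have hxM : ∀ s, Real.exp (U s - k * s) ≤ k * (k + 1) := by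
    intro s0
    have hd : ∀ s, HasDerivAt (fun s => Real.exp (-(U s)) -
        1 / (k * (k + 1)) * Real.exp (-(k * s)))
        (Real.exp (-(U s)) * (-(y s)) - 1 / (k * (k + 1)) * (-k * Real.exp (-(k * s)))) s :=
      fun s => ((hU s).neg.exp).sub ((aux_expnegk k s).const_mul _)
    have h1 := aux_anti _ _ s0 hd (by
      intro s hs
      have h2 := mul_le_mul_of_nonneg_left (hylow s) (Real.exp_pos (-(U s))).le
      have e1 : Real.exp (-(U s)) * (Real.exp (U s - k * s) / (k + 1)) =
          Real.exp (-(k * s)) / (k + 1) := by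
        rw [← mul_div_assoc, ← Real.exp_add]; congr 2; ring
      have e2 : 1 / (k * (k + 1)) * (-k * Real.exp (-(k * s))) =
          - (Real.exp (-(k * s)) / (k + 1)) := by
        field_simp
      rw [e2]; rw [e1] at h2
      linarith)
    have ht : Tendsto (fun s => - (1 / (k * (k + 1)) * Real.exp (-(k * s))))
        atTop (𝓝 0) := by
      simpa using ((aux_tend k hk).const_mul (1 / (k * (k + 1)))).neg
    have h2 : 0 ≤ Real.exp (-(U s0)) - 1 / (k * (k + 1)) * Real.exp (-(k * s0)) := by
      refine le_of_tendsto ht ?_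
      filter_upwards [eventually_ge_atTop s0] with s hs
      have h3 := h1 s hs
      try simp only at h3
      have := Real.exp_pos (-(U s))
      linarith
    have h4 : Real.exp (-(k * s0)) ≤ k * (k + 1) * Real.exp (-(U s0)) := by
      have hkk : 0 < k * (k + 1) := by positivity
      have h5 : Real.exp (-(k * s0)) / (k * (k + 1)) ≤ Real.exp (-(U s0)) := by
        rw [div_eq_inv_mul, ← one_div]; linarith
      rw [div_le_iff₀ hkk] at h5
      linarith
    have h6 := mul_le_mul_of_nonneg_left h4 (Real.exp_pos (U s0)).le
    calc Real.exp (U s0 - k * s0) = Real.exp (U s0) * Real.exp (-(k * s0)) := by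
          rw [← Real.exp_add]; congr 1
      _ ≤ _ := h6
      _ = k * (k + 1) * (Real.exp (U s0) * Real.exp (-(U s0))) := by ring
      _ = k * (k + 1) := by rw [← Real.exp_add]; simp
  refine ⟨hpos, hxM, ?_⟩
  intro s0
  by_contra! h0
  have hd : ∀ s, HasDerivAt (fun s => (y s - k * (k + 1)) * Real.exp (-s))
      ((k * (k + 1) - Real.exp (U s - k * s)) * Real.exp (-s)) s := by
    intro s
    refine HasDerivAt.congr_deriv (((hy s).sub_const (k * (k + 1))).mul (aux_expneg s)) ?_
    try simp only [Pi.mul_apply, Pi.sub_apply, Pi.neg_apply, Function.comp, id]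
    ring
  have h1 := aux_mono_s6 _ _ s0 hd (fun s _ =>
    mul_nonneg (by have := hxM s; linarith) (Real.exp_pos _).le)
  have h2 : ∀ s, s0 ≤ s → k * (k + 1) ≤ y s := by
    intro s hs
    have h3 := h1 s hs
    try simp only at h3
    by_contra! h4
    have h5 := mul_pos (sub_pos.2 h0) (Real.exp_pos (-s0))
    have h6 := mul_pos (sub_pos.2 h4) (Real.exp_pos (-s))
    linarith
  have hd2 : ∀ s, HasDerivAt (fun s => U s - k * (k + 1) * s) (y s - k * (k + 1) * 1) s :=
    fun s => (hU s).sub ((hasDerivAt_id s).const_mul _)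
  have h3 := aux_mono_s6 _ _ s0 hd2 (fun s hs => by have := h2 s hs; linarith)
  have ht : Tendsto (fun s => (k * k) * s) atTop atTop :=
    tendsto_id.const_mul_atTop (by positivity)
  obtain ⟨s, hs1, hs2⟩ := ((ht.eventually_gt_atTop
    (k * (k + 1) - (U s0 - k * (k + 1) * s0))).and (eventually_ge_atTop s0)).exists
  have h4 := h3 s hs2
  try simp only at h4
  have h5 := hxM s
  have h6 := Real.add_one_le_exp (U s - k * s)
  nlinarith

lemma aux_noninf (k : ℝ) (hk : 0 < k) (U y : ℝ → ℝ)
    (hU : ∀ s, HasDerivAt U (y s) s)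
    (hy : ∀ s, HasDerivAt y (y s - Real.exp (U s - k * s)) s)
    (hinf : Tendsto U atTop atTop)
    (hyM : ∀ s, y s ≤ k * (k + 1))
    (s0 : ℝ) (hx : ∀ s, s0 ≤ s → Real.exp (U s - k * s) ≤ k / 2) : False := by
  have h1 : ∀ s, s0 ≤ s → y s ≤ k / 2 := by
    intro s1 hs1
    by_contra! h0
    have hd : ∀ s, HasDerivAt (fun s => (y s - k / 2) * Real.exp (-s))
        ((k / 2 - Real.exp (U s - k * s)) * Real.exp (-s)) s := by
      intro s
      refine HasDerivAt.congr_deriv (((hy s).sub_const (k / 2)).mul (aux_expneg s)) ?_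
      try simp only [Pi.mul_apply, Pi.sub_apply, Pi.neg_apply, Function.comp, id]
      ring
    have h1 := aux_mono_s6 _ _ s1 hd (fun s hs =>
      mul_nonneg (by have := hx s (hs1.trans hs); linarith) (Real.exp_pos _).le)
    have hc := mul_pos (sub_pos.2 h0) (Real.exp_pos (-s1))
    have ht : Tendsto (fun s => k * (k + 1) * Real.exp (-(1 * s))) atTop (𝓝 0) := by
      simpa using (aux_tend 1 one_pos).const_mul (k * (k + 1))
    obtain ⟨s, hs2, hs3⟩ := ((ht.eventually_lt_const hc).and (eventually_ge_atTop s1)).exists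
    have h2 := h1 s hs3
    simp only [one_mul] at h2 hs2
    have h3 := mul_le_mul_of_nonneg_right (hyM s) (Real.exp_pos (-s)).le
    have h4 := mul_pos hk (Real.exp_pos (-s))
    linarith
  have hd : ∀ s, HasDerivAt (fun s => U s - y s + 2 / k * Real.exp (U s - k * s))
      (y s - (y s - Real.exp (U s - k * s)) +
        2 / k * (Real.exp (U s - k * s) * (y s - k * 1))) s := by
    intro s
    exact ((hU s).sub (hy s)).add
      ((((hU s).sub ((hasDerivAt_id s).const_mul k)).exp).const_mul (2 / k))
  have h2 := aux_anti _ _ s0 hd (by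
    intro s hs
    have e : y s - (y s - Real.exp (U s - k * s)) +
        2 / k * (Real.exp (U s - k * s) * (y s - k * 1)) =
        2 / k * Real.exp (U s - k * s) * (y s - k / 2) := by
      field_simp; ring
    rw [e]
    apply mul_nonpos_of_nonneg_of_nonpos (by positivity)
    have := h1 s hs
    linarith)
  obtain ⟨s, hs2, hs3⟩ := ((hinf.eventually_gt_atTop
    (U s0 - y s0 + 2 / k * Real.exp (U s0 - k * s0) + k / 2)).and (eventually_ge_atTop s0)).exists
  have h3 := h2 s hs3
  have h4 := h1 s hs3
  have h5 : 0 < 2 / k * Real.exp (U s - k * s) := by positivity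
  try simp only at h3
  linarith

lemma aux_main_s6 (k : ℝ) (hk : 0 < k) (U y : ℝ → ℝ)
    (hU : ∀ s, HasDerivAt U (y s) s)
    (hy : ∀ s, HasDerivAt y (y s - Real.exp (U s - k * s)) s)
    (hinf : Tendsto U atTop atTop) : ∀ s, U s = k * s + Real.log k := by
  obtain ⟨hpos, hxM, hyM⟩ := aux_bounds k hk U y hU hy hinf
  obtain ⟨w, hw⟩ : ∃ w : ℝ → ℝ, w = fun s => U s - k * s - Real.log k := ⟨_, rfl⟩
  obtain ⟨a, ha⟩ : ∃ a : ℝ → ℝ, a = fun s => y s - k := ⟨_, rfl⟩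
  have hxe : ∀ s, Real.exp (U s - k * s) = k * Real.exp (w s) := by
    intro s
    rw [hw]
    simp only
    rw [Real.exp_sub _ (Real.log k), Real.exp_log hk]
    field_simp
  have hwd : ∀ s, HasDerivAt w (a s) s := by
    intro s
    rw [hw, ha]
    refine HasDerivAt.congr_deriv ((((hU s).sub ((hasDerivAt_id s).const_mul k)).sub_const (Real.log k))) ?_
    try simp only [Pi.mul_apply, Pi.sub_apply, Pi.neg_apply, Function.comp, id]
    simp
  have had : ∀ s, HasDerivAt a (a s - k * (Real.exp (w s) - 1)) s := by
    intro s
    have h1 := (hy s).sub_const k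
    rw [hxe] at h1
    rw [ha]
    refine HasDerivAt.congr_deriv (h1) ?_
    try simp only [Pi.mul_apply, Pi.sub_apply, Pi.neg_apply, Function.comp, id]
    ring
  have hwb : ∀ s, Real.exp (w s) ≤ k + 1 := by
    intro s
    have := hxM s
    rw [hxe] at this
    exact le_of_mul_le_mul_left this hk
  have hal : ∀ s, -k ≤ a s := fun s => by rw [ha]; have := hpos s; simp only; linarith
  have hau : ∀ s, a s ≤ k * k := fun s => by rw [ha]; have := hyM s; simp only; linarith
  obtain ⟨E, hE⟩ : ∃ E : ℝ → ℝ,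
    E = fun s => a s ^ 2 / 2 + k * (Real.exp (w s) - 1 - w s) := ⟨_, rfl⟩
  have hEd : ∀ s, HasDerivAt E (a s ^ 2) s := by
    intro s
    rw [hE]
    refine HasDerivAt.congr_deriv ((((had s).pow 2).div_const 2).add
      ((((hwd s).exp.sub_const 1).sub (hwd s)).const_mul k)) ?_
    try simp only [Pi.mul_apply, Pi.sub_apply, Pi.neg_apply, Function.comp, id]
    simp; ring
  have hq : ∀ δ > 0, ∀ s0, ∃ s, s0 ≤ s ∧ a s ^ 2 + (Real.exp (w s) - 1) ^ 2 < δ := by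
    intro δ hδ s0
    by_contra! hcon
    obtain ⟨ε, hε⟩ : ∃ ε : ℝ, ε = k / (2 * (k + 1) ^ 2) := ⟨_, rfl⟩
    have hε0 : 0 < ε := by rw [hε]; positivity
    have hε1 : ε * (k + 1) ≤ 1 / 2 := by
      rw [hε, div_mul_eq_mul_div, div_le_div_iff₀ (by positivity) (by norm_num)]
      nlinarith
    have hε2 : ε ≤ k / 2 := by
      rw [hε, div_le_div_iff₀ (by positivity) (by norm_num)]
      nlinarith [mul_pos hk hk, mul_pos hk (mul_pos hk hk)]
    obtain ⟨c, hc⟩ : ∃ c : ℝ, c = min (1 / 4) (ε * k / 2) := ⟨_, rfl⟩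
    have hc0 : 0 < c := by rw [hc]; exact lt_min (by norm_num) (by positivity)
    have hc1 : c ≤ 1 / 4 := by rw [hc]; exact min_le_left _ _
    have hc2 : c ≤ ε * k / 2 := by rw [hc]; exact min_le_right _ _
    have hd : ∀ s, HasDerivAt (fun s => E s - ε * (a s * (Real.exp (w s) - 1)) - c * δ * s)
        (a s ^ 2 - ε * ((a s - k * (Real.exp (w s) - 1)) * (Real.exp (w s) - 1) +
          a s * (Real.exp (w s) * a s)) - c * δ * 1) s := by
      intro s
      exact ((hEd s).sub (((had s).mul ((hwd s).exp.sub_const 1)).const_mul ε)).sub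
        ((hasDerivAt_id s).const_mul (c * δ))
    have h1 := aux_mono_s6 _ _ s0 hd (by
      intro s hs
      have h2 := hcon s hs
      have h3 := hwb s
      obtain ⟨X, hX⟩ : ∃ X, X = Real.exp (w s) - 1 := ⟨_, rfl⟩
      have hX' : Real.exp (w s) = X + 1 := by linarith
      rw [hX'] at h2 h3 ⊢
      have h4 : ε * (X + 1) ≤ 1 / 2 := (mul_le_mul_of_nonneg_left h3 hε0.le).trans hε1
      have h5 : a s ^ 2 * (ε * (X + 1)) ≤ a s ^ 2 * (1 / 2) :=
        mul_le_mul_of_nonneg_left h4 (sq_nonneg _)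
      have h6 : ε * ε * X ^ 2 ≤ ε * (k / 2) * X ^ 2 :=
        mul_le_mul_of_nonneg_right (mul_le_mul_of_nonneg_left hε2 hε0.le) (sq_nonneg _)
      have h7 : 0 ≤ (a s / 2 - ε * X) ^ 2 := sq_nonneg _
      have h8 : c * δ ≤ c * (a s ^ 2 + X ^ 2) := by
        apply mul_le_mul_of_nonneg_left _ hc0.le
        convert h2 using 2; ring
      have h9 := mul_le_mul_of_nonneg_right hc1 (sq_nonneg (a s))
      have h10 := mul_le_mul_of_nonneg_right hc2 (sq_nonneg X)
      nlinarith)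
    -- upper bound of the modified energy
    obtain ⟨B, hB⟩ : ∃ B : ℝ, B = (k + k * k) ^ 2 / 2 + k * k + ε * ((k + k * k) * (k + 1)) :=
      ⟨_, rfl⟩
    have hub : ∀ s, E s - ε * (a s * (Real.exp (w s) - 1)) ≤ B - k * w s := by
      intro s
      have i1 : |a s| ≤ k + k * k := by
        rw [abs_le]; constructor <;> nlinarith [hal s, hau s, mul_pos hk hk]
      have i2 : |Real.exp (w s) - 1| ≤ k + 1 := by
        rw [abs_le]; constructor <;> nlinarith [hwb s, Real.exp_pos (w s)]
      have i3 : |a s * (Real.exp (w s) - 1)| ≤ (k + k * k) * (k + 1) := by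
        rw [abs_mul]; exact mul_le_mul i1 i2 (abs_nonneg _) (by positivity)
      have i4 := mul_le_mul_of_nonneg_left ((neg_le_abs _).trans i3) hε0.le
      have i5 : a s ^ 2 ≤ (k + k * k) ^ 2 := by
        rw [← sq_abs]; gcongr
      have i6 := mul_le_mul_of_nonneg_left (hwb s) hk.le
      rw [hE, hB]
      simp only
      nlinarith
    have ht : Tendsto (fun s => c * δ * s) atTop atTop :=
      tendsto_id.const_mul_atTop (by positivity)
    obtain ⟨s1, hs1⟩ := eventually_atTop.1 ((ht.eventually_ge_atTop
      (B - k * Real.log (1 / 2) - (E s0 - ε * (a s0 * (Real.exp (w s0) - 1)) - c * δ * s0))).and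
        (eventually_ge_atTop s0))
    refine aux_noninf k hk U y hU hy hinf hyM s1 ?_
    intro s hs
    obtain ⟨j1, j2⟩ := hs1 s hs
    have j3 := h1 s j2
    have j4 := hub s
    try simp only at j3
    have j5 : k * w s ≤ k * Real.log (1 / 2) := by linarith
    have j6 := le_of_mul_le_mul_left j5 hk
    have j7 := Real.exp_le_exp.2 j6
    rw [Real.exp_log (by norm_num)] at j7
    rw [hxe]
    nlinarith
  have hE0 : ∀ s, E s ≤ 0 := by
    intro s1
    by_contra! hpE
    obtain ⟨s, hs, hqs⟩ := hq (min (1 / 4) (E s1 / (1 / 2 + 2 * k)))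
      (lt_min (by norm_num) (by positivity)) s1
    have h1 := aux_mono_s6 E _ s1 hEd (fun s _ => sq_nonneg _) s hs
    have h2 := hqs.trans_le (min_le_left _ _)
    have h3 := hqs.trans_le (min_le_right _ _)
    rw [lt_div_iff₀ (by positivity)] at h3
    have h4 : 1 / 2 ≤ Real.exp (w s) := by nlinarith [sq_nonneg (a s)]
    have h5 := Real.add_one_le_exp (-(w s))
    have h6 : Real.exp (w s) * Real.exp (-(w s)) = 1 := by rw [← Real.exp_add]; simp
    have h7 : Real.exp (w s) - 1 - w s ≤ 2 * (Real.exp (w s) - 1) ^ 2 := by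
      have h8 : Real.exp (-(w s)) ≤ 2 := by
        have := Real.exp_pos (-(w s)); nlinarith
      have h9 : Real.exp (w s) + Real.exp (-(w s)) - 2 =
          Real.exp (-(w s)) * (Real.exp (w s) - 1) ^ 2 := by
        linear_combination (2 - Real.exp (w s)) * h6
      have h10 := mul_le_mul_of_nonneg_right h8 (sq_nonneg (Real.exp (w s) - 1))
      linarith
    have h8 := mul_le_mul_of_nonneg_left h7 hk.le
    have h9 : E s = a s ^ 2 / 2 + k * (Real.exp (w s) - 1 - w s) := by rw [hE]
    nlinarith [mul_nonneg hk.le (sq_nonneg (a s)), sq_nonneg (Real.exp (w s) - 1)]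
  intro s
  have h1 := hE0 s
  rw [hE] at h1
  try simp only at h1
  have h2 : w s = 0 := by
    by_contra hne
    have h3 := Real.add_one_lt_exp hne
    have h4 : 0 < k * (Real.exp (w s) - 1 - w s) := mul_pos hk (by linarith)
    nlinarith [sq_nonneg (a s)]
  rw [hw] at h2
  try simp only at h2
  linarith

/-- Uniqueness of the singular solution in the exponential case: every `C²`
solution of `v'' + v'/r + V_k(r) e^v = 0` on `(0, e)` with `v(r) → ∞` as
`r → 0+` coincides with `W(r) = k log(1 - log r) + log k`. -/
theorem stmt6 (k : ℝ) (hk : 0 < k) (v v' v'' : ℝ → ℝ)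
    (hsol : IsSolExp k v v' v'')
    (hsing : Tendsto v (𝓝[>] (0 : ℝ)) atTop) :
    ∀ r ∈ Set.Ioo (0 : ℝ) (Real.exp 1),
      v r = k * Real.log (1 - Real.log r) + Real.log k := by
  obtain ⟨h1, h2, _, h4⟩ := hsol
  obtain ⟨ρ, hρ⟩ : ∃ ρ : ℝ → ℝ, ρ = fun s => Real.exp (1 - Real.exp s) := ⟨_, rfl⟩
  have hρm : ∀ s, ρ s ∈ Set.Ioo (0 : ℝ) (Real.exp 1) := by
    intro s
    rw [hρ]
    refine ⟨Real.exp_pos _, Real.exp_lt_exp.2 ?_⟩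
    have := Real.exp_pos s
    linarith
  have hρd : ∀ s, HasDerivAt ρ (-(ρ s * Real.exp s)) s := by
    intro s
    rw [hρ]
    refine HasDerivAt.congr_deriv (((Real.hasDerivAt_exp s).const_sub 1).exp) ?_
    try simp only [Pi.mul_apply, Pi.sub_apply, Pi.neg_apply, Function.comp, id]
    ring
  have hU : ∀ s, HasDerivAt (fun s => v (ρ s)) (-(v' (ρ s) * (ρ s * Real.exp s))) s := by
    intro s
    refine HasDerivAt.congr_deriv ((h1 (ρ s) (hρm s)).comp s (hρd s)) ?_
    try simp only [Pi.mul_apply, Pi.sub_apply, Pi.neg_apply, Function.comp, id]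
    ring
  have hy : ∀ s, HasDerivAt (fun s => -(v' (ρ s) * (ρ s * Real.exp s)))
      (-(v' (ρ s) * (ρ s * Real.exp s)) - Real.exp (v (ρ s) - k * s)) s := by
    intro s
    have hc := (h2 (ρ s) (hρm s)).comp s (hρd s)
    have hd := (hc.mul ((hρd s).mul (Real.hasDerivAt_exp s))).neg
    refine HasDerivAt.congr_deriv (hd) ?_
    try simp only [Pi.mul_apply, Pi.sub_apply, Pi.neg_apply, Function.comp, id]
    have heq := h4 (ρ s) (hρm s)
    have hp := (hρm s).1
    have hl : 1 - Real.log (ρ s) = Real.exp s := by rw [hρ]; simp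
    have e1 : Real.exp (v (ρ s) - k * s) =
        (ρ s) ^ 2 * (Real.exp s) ^ 2 * (Vk k (ρ s) * Real.exp (v (ρ s))) := by
      have e2 : (Real.exp s) ^ (2 + k) = (Real.exp s) ^ 2 * Real.exp (k * s) := by
        rw [← Real.exp_mul, ← Real.exp_nat_mul, ← Real.exp_add]
        congr 1; push_cast; ring
      rw [Vk, hl, e2, Real.exp_sub]
      have := Real.exp_pos s
      have := Real.exp_pos (k * s)
      field_simp
    have e3 : Vk k (ρ s) * Real.exp (v (ρ s)) = - (v'' (ρ s) + v' (ρ s) / ρ s) := by linarith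
    rw [e1, e3]
    field_simp
    ring
  have hρt : Tendsto ρ atTop (𝓝[>] (0 : ℝ)) := by
    rw [tendsto_nhdsWithin_iff]
    refine ⟨?_, Eventually.of_forall fun s => (hρm s).1⟩
    rw [hρ]
    apply Real.tendsto_exp_atBot.comp
    have := tendsto_atBot_add_const_left atTop (1 : ℝ)
      (tendsto_neg_atTop_atBot.comp Real.tendsto_exp_atTop)
    simpa [sub_eq_add_neg] using this
  have hfin := aux_main_s6 k hk _ _ hU hy (hsing.comp hρt)
  intro r hr
  have hlog : 0 < 1 - Real.log r := by
    have := (Real.log_lt_log_iff hr.1 (Real.exp_pos 1)).2 hr.2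
    rw [Real.log_exp] at this
    linarith
  have h5 := hfin (Real.log (1 - Real.log r))
  have h6 : ρ (Real.log (1 - Real.log r)) = r := by
    rw [hρ]
    simp only
    rw [Real.exp_log hlog]
    simp [Real.exp_log hr.1]
  simp only [h6] at h5
  exact h5
end

section
/- Let k > 0 and let B_1 be the open unit ball in ℝ^2. Consider the quadratic form Q(φ) = ∫_{B_1} |∇φ(x)|^2 dx - k ∫_{B_1} φ(x)^2 / ( |x|^2 (log(e/|x|))^2 ) dx defined on Lipschitz functions φ : ℝ^2 → ℝ with compact support contained in B_1. If k ≤ 1/4, then Q(φ) ≥ 0 for every such φ. If k > 1/4, then there exists a sequence (φ_n)_{n ∈ ℕ} of such functions, each not identically zero, with pairwise disjoint supports, such that Q(φ_n) < 0 for every n. -/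
open Filter Topology Set MeasureTheory

/-- The quadratic form
`Q(φ) = ∫_{B₁} |∇φ|² - k ∫_{B₁} φ² / (|x|² (log(e/|x|))²)`,
the linearized stability form at the singular solution of the weighted
Gelfand problem in two dimensions. -/
noncomputable def hardyForm (k : ℝ) (φ : EuclideanSpace ℝ (Fin 2) → ℝ) : ℝ :=
  (∫ x in Metric.ball (0 : EuclideanSpace ℝ (Fin 2)) 1, ‖fderiv ℝ φ x‖ ^ 2) -
    k * ∫ x in Metric.ball (0 : EuclideanSpace ℝ (Fin 2)) 1,
      (φ x) ^ 2 / (‖x‖ ^ 2 * (Real.log (Real.exp 1 / ‖x‖)) ^ 2)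

abbrev E2 := EuclideanSpace ℝ (Fin 2)

/-- regularized field component -/
noncomputable def fldF (ε : ℝ) (i : Fin 2) (x : E2) : ℝ :=
  -(x i / (2 * (‖x‖ ^ 2 + ε) * (1 - Real.log (‖x‖ ^ 2 + ε) / 2)))

lemma T_pos {s : ℝ} (h0 : 0 < s) (h : s ≤ 2) : 0 < 1 - Real.log s / 2 := by
  have := Real.log_le_sub_one_of_pos h0
  linarith

lemma normsq_line (x : E2) (i : Fin 2) (t : ℝ) :
    ‖x + t • (-(EuclideanSpace.single i (1:ℝ)))‖ ^ 2 = ‖x‖ ^ 2 - 2 * t * x i + t ^ 2 := by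
  rw [EuclideanSpace.norm_sq_eq, EuclideanSpace.norm_sq_eq]
  fin_cases i <;> simp [Fin.sum_univ_two] <;> ring

lemma fldF_lineDeriv {ε : ℝ} (i : Fin 2) (x : E2) (h0 : 0 < ‖x‖ ^ 2 + ε)
    (h : ‖x‖ ^ 2 + ε ≤ 2) :
    HasLineDerivAt ℝ (fldF ε i)
      (((‖x‖ ^ 2 + ε) * (1 - Real.log (‖x‖ ^ 2 + ε) / 2)
        - (x i) ^ 2 * (2 * (1 - Real.log (‖x‖ ^ 2 + ε) / 2) - 1)) /
        (2 * (‖x‖ ^ 2 + ε) ^ 2 * (1 - Real.log (‖x‖ ^ 2 + ε) / 2) ^ 2)) x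
      (-(EuclideanSpace.single i (1:ℝ))) := by
  unfold HasLineDerivAt fldF
  have hT := T_pos h0 h
  have e : ∀ t : ℝ, (x + t • (-(EuclideanSpace.single i (1:ℝ)))) i = x i - t := by
    intro t; simp; ring
  simp only [normsq_line, e]
  set s := ‖x‖ ^ 2 + ε with hs
  have hq : HasDerivAt (fun t : ℝ => ‖x‖ ^ 2 - 2 * t * x i + t ^ 2 + ε) (- 2 * x i) 0 := by
    have h1 : HasDerivAt (fun t : ℝ => t) 1 0 := hasDerivAt_id 0
    have := ((((h1.const_mul 2).mul_const (x i)).const_sub (‖x‖ ^ 2)).add (h1.pow 2)).add_const ε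
    convert! this using 1
    simp
  have q0 : ‖x‖ ^ 2 - 2 * (0:ℝ) * x i + 0 ^ 2 + ε = s := by rw [hs]; ring
  have hl := hq.log (by rw [q0]; exact h0.ne')
  have hD := (hq.const_mul 2).mul ((hl.div_const 2).const_sub 1)
  have hN : HasDerivAt (fun t : ℝ => x i - t) (-1) 0 := by
    simpa using (hasDerivAt_id (0:ℝ)).const_sub (x i)
  have := (hN.div hD (by
    simp only [Pi.mul_apply]
    rw [q0]; positivity)).neg
  convert! this using 1
  simp only [Pi.mul_apply, q0]
  have h3 : (2 - Real.log s) ≠ 0 := by intro h; linarith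
  field_simp
  ring

lemma fldF_contDiffAt {ε : ℝ} (i : Fin 2) (x : E2) (h0 : 0 < ‖x‖ ^ 2 + ε)
    (h : ‖x‖ ^ 2 + ε ≤ 2) : ContDiffAt ℝ 1 (fldF ε i) x := by
  have hT := T_pos h0 h
  unfold fldF
  have h1 : ContDiffAt ℝ 1 (fun x : E2 => x i) x := by fun_prop
  have h2 : ContDiffAt ℝ 1 (fun x : E2 => ‖x‖ ^ 2 + ε) x :=
    (contDiff_norm_sq ℝ).contDiffAt.add contDiffAt_const
  have h3 : ContDiffAt ℝ 1 (fun x : E2 => Real.log (‖x‖ ^ 2 + ε)) x := h2.log h0.ne'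
  exact (h1.div ((contDiffAt_const.mul h2).mul (contDiffAt_const.sub (h3.div_const 2)))
    (by positivity)).neg

lemma sq_lip {φ : E2 → ℝ} {L : NNReal} (hL : LipschitzWith L φ) (hc : HasCompactSupport φ) :
    ∃ C : NNReal, LipschitzWith C (fun x => φ x ^ 2) := by
  obtain ⟨M, hM⟩ := hc.exists_bound_of_continuous hL.continuous
  have hM0 : 0 ≤ M := (norm_nonneg _).trans (hM 0)
  refine ⟨⟨2 * M * L, by positivity⟩, LipschitzWith.of_dist_le_mul fun x y => ?_⟩
  have h1 := hL.dist_le_mul x y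
  rw [Real.dist_eq] at *
  have h2 := hM x
  have h3 := hM y
  rw [Real.norm_eq_abs] at h2 h3
  have : φ x ^ 2 - φ y ^ 2 = (φ x + φ y) * (φ x - φ y) := by ring
  rw [this, abs_mul]
  calc |φ x + φ y| * |φ x - φ y| ≤ (2 * M) * (L * dist x y) := by
        gcongr
        exact (abs_add_le _ _).trans (by linarith)
    _ = _ := by
      show _ = (2 * M * L) * dist x y
      ring

lemma ball_int_grad {φ : E2 → ℝ} (hs : tsupport φ ⊆ Metric.ball (0 : E2) 1) :
    (∫ x in Metric.ball (0 : E2) 1, ‖fderiv ℝ φ x‖ ^ 2) = ∫ x, ‖fderiv ℝ φ x‖ ^ 2 := by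
  apply setIntegral_eq_integral_of_forall_compl_eq_zero
  intro x hx
  have : fderiv ℝ φ x = 0 := by
    by_contra h
    exact hx (hs (support_fderiv_subset ℝ h))
  simp [this]

lemma grad_integrable {φ : E2 → ℝ} {L : NNReal} (hL : LipschitzWith L φ)
    (hc : HasCompactSupport φ) : Integrable (fun x => ‖fderiv ℝ φ x‖ ^ 2) := by
  have h1 : IntegrableOn (fun x => ‖fderiv ℝ φ x‖ ^ 2) (tsupport φ) := by
    apply Measure.integrableOn_of_bounded (M := (L:ℝ)^2) hc.isCompact.measure_lt_top.ne
    · refine Filter.Eventually.of_forall fun x => ?_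
      rw [Real.norm_of_nonneg (by positivity)]
      gcongr
      exact norm_fderiv_le_of_lipschitz ℝ hL
    · exact ((measurable_fderiv ℝ φ).norm.pow_const 2).aestronglyMeasurable
  rwa [integrableOn_iff_integrable_of_support_subset] at h1
  intro x hx
  apply support_fderiv_subset ℝ
  intro h
  apply hx
  simp [h]

lemma final_alg {a b y ε T f d N : ℝ} (n2 : y ^ 2 = a ^ 2 + b ^ 2) (hε : 0 ≤ ε)
    (hs : 0 < y ^ 2 + ε) (hT : 0 < T) (hop : |d| ≤ N * y) :
    f ^ 2 * y ^ 2 / (4 * ((y ^ 2 + ε) * T) ^ 2) ≤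
      N ^ 2 - -(2 * f * d) / (2 * (y ^ 2 + ε) * T) +
      (((y ^ 2 + ε) * T - a ^ 2 * (2 * T - 1)) / (2 * (y ^ 2 + ε) ^ 2 * T ^ 2) * f ^ 2 +
       ((y ^ 2 + ε) * T - b ^ 2 * (2 * T - 1)) / (2 * (y ^ 2 + ε) ^ 2 * T ^ 2) * f ^ 2) := by
  have hb : b ^ 2 = y ^ 2 - a ^ 2 := by linarith
  rw [hb, ← sub_nonneg]
  generalize hsd : y ^ 2 + ε = s at *
  have hε' : ε = s - y ^ 2 := by linarith
  have key : 0 ≤ N ^ 2 * (s * T) ^ 2 + f * d * (s * T) + f ^ 2 * y ^ 2 / 4 + f ^ 2 * ε * T := by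
    have h1 : -(|f| * (N * y) * (s * T)) ≤ f * d * (s * T) := by
      have h2 : |f * d| ≤ |f| * (N * y) := by rw [abs_mul]; gcongr
      have h3 := neg_abs_le (f * d)
      have : 0 < s * T := by positivity
      nlinarith
    have h4 := sq_nonneg (N * (s * T) - |f| * y / 2)
    have h5 : 0 ≤ f ^ 2 * ε * T := by positivity
    have h6 := sq_abs f
    have h7 : (N * (s * T) - |f| * y / 2) ^ 2 =
      N ^ 2 * (s * T) ^ 2 - |f| * (N * y) * (s * T) + f ^ 2 * y ^ 2 / 4 := by
      rw [← h6]; ring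
    linarith
  have : 0 ≤ (N ^ 2 * (s * T) ^ 2 + f * d * (s * T) + f ^ 2 * y ^ 2 / 4 + f ^ 2 * ε * T)
    / (s * T) ^ 2 := by positivity
  convert this using 1
  rw [hε']
  field_simp
  ring

lemma key_ineq {φ : E2 → ℝ} {L : NNReal} (hL : LipschitzWith L φ)
    (hc : HasCompactSupport φ) {ρ : ℝ} (hρ0 : 0 < ρ) (hρ : ρ < 1)
    (hs : tsupport φ ⊆ Metric.ball (0 : E2) ρ) {ε : ℝ} (hε : 0 < ε) (hε1 : ε ≤ 1) :
    ∫ x, φ x ^ 2 * ‖x‖ ^ 2 / (4 * ((‖x‖ ^ 2 + ε) * (1 - Real.log (‖x‖ ^ 2 + ε) / 2)) ^ 2)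
      ≤ ∫ x, ‖fderiv ℝ φ x‖ ^ 2 := by
  let χ : ContDiffBump (0 : E2) := ⟨ρ, 1, hρ0, hρ⟩
  let g : Fin 2 → E2 → ℝ := fun i x => χ x * fldF ε i x
  have hχt : tsupport χ = Metric.closedBall (0:E2) 1 := χ.tsupport_eq
  have bnd : ∀ x : E2, ‖x‖ ≤ 1 → 0 < ‖x‖ ^ 2 + ε ∧ ‖x‖ ^ 2 + ε ≤ 2 := by
    intro x hx
    refine ⟨by positivity, ?_⟩
    have := norm_nonneg x
    nlinarith
  have gc : ∀ i, HasCompactSupport (g i) := fun i => χ.hasCompactSupport.mul_right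
  have gs : ∀ i, ContDiff ℝ 1 (g i) := by
    intro i
    rw [contDiff_iff_contDiffAt]
    intro x
    by_cases hx : x ∈ tsupport (g i)
    swap
    · have : g i =ᶠ[𝓝 x] fun _ => 0 := notMem_tsupport_iff_eventuallyEq.1 hx
      exact contDiffAt_const.congr_of_eventuallyEq this
    have hx1 : x ∈ tsupport χ := tsupport_mul_subset_left hx
    rw [hχt, mem_closedBall_zero_iff] at hx1
    exact χ.contDiffAt.mul (fldF_contDiffAt i x (bnd x hx1).1 (bnd x hx1).2)
  obtain ⟨C, hC⟩ := sq_lip hL hc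
  have hc2 : HasCompactSupport (fun x => φ x ^ 2) := by
    exact hc.comp_left (g := fun y : ℝ => y ^ 2) (by simp)
  have φ2i : Integrable (fun x => φ x ^ 2) := hC.continuous.integrable_of_hasCompactSupport hc2
  let v : Fin 2 → E2 := fun i => EuclideanSpace.single i (1:ℝ)
  let A : Fin 2 → E2 → ℝ := fun i x => lineDeriv ℝ (fun x => φ x ^ 2) x (v i) * g i x
  let B : Fin 2 → E2 → ℝ := fun i x => lineDeriv ℝ (g i) x (-v i) * φ x ^ 2
  have gl : ∀ i, ∃ D : NNReal, LipschitzWith D (g i) := fun i =>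
    ContDiff.lipschitzWith_of_hasCompactSupport (gc i) (gs i) (by simp)
  have hAB : ∀ i, ∫ x, A i x = ∫ x, B i x := by
    intro i
    obtain ⟨D, hD⟩ := gl i
    exact hC.integral_lineDeriv_mul_eq hD (gc i) (v i)
  have hA : ∀ i, Integrable (A i) := by
    intro i
    apply Integrable.bdd_mul ((gs i).continuous.integrable_of_hasCompactSupport (gc i))
      (aestronglyMeasurable_lineDeriv hC.continuous _) (c := C * ‖v i‖)
    exact Filter.Eventually.of_forall fun x => norm_lineDeriv_le_of_lipschitz ℝ hC
  have hB : ∀ i, Integrable (B i) := by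
    intro i
    obtain ⟨D, hD⟩ := gl i
    apply Integrable.bdd_mul φ2i
      (aestronglyMeasurable_lineDeriv hD.continuous _) (c := D * ‖-v i‖)
    exact Filter.Eventually.of_forall fun x => norm_lineDeriv_le_of_lipschitz ℝ hD
  have hG := grad_integrable hL hc
  have hI : Integrable (fun x => ‖fderiv ℝ φ x‖ ^ 2 - (A 0 x + A 1 x) + (B 0 x + B 1 x)) :=
    (hG.sub ((hA 0).add (hA 1))).add ((hB 0).add (hB 1))
  have hE : ∫ x, (‖fderiv ℝ φ x‖ ^ 2 - (A 0 x + A 1 x) + (B 0 x + B 1 x))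
      = ∫ x, ‖fderiv ℝ φ x‖ ^ 2 := by
    have e1 := integral_add (hG.sub ((hA 0).add (hA 1))) ((hB 0).add (hB 1))
    have e2 := integral_sub hG ((hA 0).add (hA 1))
    have e3 := integral_add (hA 0) (hA 1)
    have e4 := integral_add (hB 0) (hB 1)
    simp only [Pi.add_apply, Pi.sub_apply] at e1 e2 e3 e4
    rw [e1, e2, e3, e4, hAB, hAB]
    ring
  rw [← hE]
  apply integral_mono_of_nonneg _ hI
  · filter_upwards [hL.ae_differentiableAt (μ := volume)] with x hx
    have hAx : ∀ i, A i x = 2 * φ x * fderiv ℝ φ x (v i) * g i x := by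
      intro i
      have h1 : HasFDerivAt (fun x => φ x ^ 2) ((2 * φ x) • fderiv ℝ φ x) x := by
        have := hx.hasFDerivAt.pow 2
        simpa using this
      simp only [A]
      rw [(h1.hasLineDerivAt (v i)).lineDeriv]
      simp
    by_cases h0 : φ x = 0
    · simp only [hAx, h0, B]
      simp
    · have hxs : x ∈ Metric.ball (0:E2) ρ := hs (subset_tsupport _ h0)
      have hxn : ‖x‖ < ρ := by simpa using hxs
      have χ1 : (χ : E2 → ℝ) =ᶠ[𝓝 x] 1 := χ.eventuallyEq_one_of_mem_ball hxs
      have geq : ∀ i, g i =ᶠ[𝓝 x] fldF ε i := by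
        intro i
        filter_upwards [χ1] with y hy
        simp [g, hy]
      obtain ⟨b1, b2⟩ := bnd x (by linarith)
      have hT := T_pos b1 b2
      have hBx : ∀ i, B i x = _ := fun i => by
        simp only [B]
        rw [Filter.EventuallyEq.lineDeriv_eq (geq i), (fldF_lineDeriv i x b1 b2).lineDeriv]
      have n2 : ‖x‖ ^ 2 = x 0 ^ 2 + x 1 ^ 2 := by
        rw [EuclideanSpace.norm_sq_eq]; simp [Fin.sum_univ_two]
      have hsum : A 0 x + A 1 x = -(2 * φ x * fderiv ℝ φ x x) /
          (2 * (‖x‖ ^ 2 + ε) * (1 - Real.log (‖x‖ ^ 2 + ε) / 2)) := by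
        have hxv : x = x 0 • v 0 + x 1 • v 1 := by
          ext i; fin_cases i <;> simp [v]
        have : fderiv ℝ φ x x = x 0 * fderiv ℝ φ x (v 0) + x 1 * fderiv ℝ φ x (v 1) := by
          conv_lhs => rw [hxv, ← hxv]
          conv_lhs => arg 2; rw [hxv]
          simp
        rw [this, hAx, hAx, (geq 0).eq_of_nhds, (geq 1).eq_of_nhds]
        simp only [fldF]
        ring
      have hop : |fderiv ℝ φ x x| ≤ ‖fderiv ℝ φ x‖ * ‖x‖ := (fderiv ℝ φ x).le_opNorm x
      rw [hBx, hBx, hsum]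
      generalize hTT : 1 - Real.log (‖x‖ ^ 2 + ε) / 2 = T at *
      have hd : 0 < (‖x‖ ^ 2 + ε) * T := by positivity
      generalize fderiv ℝ φ x x = d at *
      generalize ‖fderiv ℝ φ x‖ = N at *
      exact final_alg n2 hε.le b1 hT hop
  · exact Filter.Eventually.of_forall fun x => by
      simp only [Pi.zero_apply]; positivity

lemma mono_sT {y s : ℝ} (hy : 0 < y) (hys : y ≤ s) (hs : s ≤ 1) :
    y * (1 - Real.log y / 2) ≤ s * (1 - Real.log s / 2) := by
  have hs0 : 0 < s := hy.trans_le hys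
  have h1 := Real.log_le_sub_one_of_pos (div_pos hs0 hy)
  rw [Real.log_div hs0.ne' hy.ne'] at h1
  have h2 : y * (Real.log s - Real.log y) ≤ s - y := by
    calc _ ≤ y * (s / y - 1) := by gcongr
      _ = _ := by field_simp
  have h3 := Real.log_nonpos hs0.le hs
  nlinarith [mul_nonneg (sub_nonneg.2 hys) (neg_nonneg.2 h3)]

lemma hardy_quarter {φ : E2 → ℝ} {L : NNReal} (hL : LipschitzWith L φ)
    (hc : HasCompactSupport φ) (hs : tsupport φ ⊆ Metric.ball (0 : E2) 1) :
    1 / 4 * (∫ x in Metric.ball (0 : E2) 1,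
      (φ x) ^ 2 / (‖x‖ ^ 2 * (Real.log (Real.exp 1 / ‖x‖)) ^ 2)) ≤
    ∫ x in Metric.ball (0 : E2) 1, ‖fderiv ℝ φ x‖ ^ 2 := by
  obtain ⟨ρ, ⟨hρ0, hρ⟩, hsρ⟩ := exists_pos_lt_subset_ball one_pos (isClosed_tsupport φ) hs
  set W : E2 → ℝ := fun x => (φ x) ^ 2 / (‖x‖ ^ 2 * (Real.log (Real.exp 1 / ‖x‖)) ^ 2) with hW
  have e1 : ∫ x in Metric.ball (0 : E2) 1, W x = ∫ x, W x := by
    apply setIntegral_eq_integral_of_forall_compl_eq_zero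
    intro x hx
    have : φ x = 0 := by
      by_contra h
      exact hx (hs (subset_tsupport _ h))
    simp [hW, this]
  rw [ball_int_grad hs, e1]
  by_cases hI : Integrable W
  swap
  · rw [integral_undef hI]
    simp only [mul_zero]
    positivity
  rw [← integral_const_mul]
  let ε : ℕ → ℝ := fun n => (1 - ρ ^ 2) * (1 / ((n:ℝ) + 1))
  have hρ2 : 0 < 1 - ρ ^ 2 := by nlinarith
  have ε0 : ∀ n, 0 < ε n := fun n => by positivity
  have ε1 : ∀ n, ε n ≤ 1 - ρ ^ 2 := fun n => by
    have : 1 / ((n:ℝ) + 1) ≤ 1 := by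
      rw [div_le_one (by positivity)]
      have : (0:ℝ) ≤ n := by positivity
      linarith
    calc _ ≤ (1 - ρ ^ 2) * 1 := by simp only [ε]; gcongr
      _ = _ := mul_one _
  have εlim : Tendsto ε atTop (𝓝 0) := by
    have := (tendsto_one_div_add_atTop_nhds_zero_nat (𝕜 := ℝ)).const_mul (1 - ρ ^ 2)
    rw [mul_zero] at this
    exact this
  have Wx : ∀ x : E2, x ≠ 0 → 1 / 4 * W x = φ x ^ 2 * ‖x‖ ^ 2 /
      (4 * ((‖x‖ ^ 2) * (1 - Real.log (‖x‖ ^ 2) / 2)) ^ 2) := by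
    intro x hx
    have hn : ‖x‖ ≠ 0 := norm_ne_zero_iff.2 hx
    simp only [hW]
    rw [Real.log_div (Real.exp_ne_zero 1) hn, Real.log_exp, Real.log_pow]
    have : (1 - ((2:ℕ):ℝ) * Real.log ‖x‖ / 2) = 1 - Real.log ‖x‖ := by push_cast; ring
    rw [this]
    by_cases h : 1 - Real.log ‖x‖ = 0
    · simp [h]
    · field_simp
  refine le_of_tendsto' (f := fun n => ∫ x, φ x ^ 2 * ‖x‖ ^ 2 /
    (4 * ((‖x‖ ^ 2 + ε n) * (1 - Real.log (‖x‖ ^ 2 + ε n) / 2)) ^ 2)) (x := atTop) ?_ (fun n => 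
      key_ineq hL hc hρ0 hρ hsρ (ε0 n) ((ε1 n).trans (by nlinarith)))
  apply tendsto_integral_of_dominated_convergence (fun x => 1 / 4 * W x)
  · intro n
    have := hL.continuous.measurable
    apply Measurable.aestronglyMeasurable
    fun_prop
  · exact hI.const_mul _
  · intro n
    filter_upwards [compl_mem_ae_iff.2 (measure_singleton (μ := volume) (0:E2))] with x hx
    have hx : x ≠ 0 := hx
    rw [Real.norm_of_nonneg (by positivity), Wx x hx]
    by_cases h0 : φ x = 0
    · simp [h0]
    have hxs : x ∈ Metric.ball (0:E2) ρ := hsρ (subset_tsupport _ h0)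
    have hxn : ‖x‖ < ρ := by simpa using hxs
    have hp : 0 < ‖x‖ := norm_pos_iff.2 hx
    have hx2 : ‖x‖ ^ 2 < ρ ^ 2 := by gcongr
    have := mono_sT (y := ‖x‖ ^ 2) (s := ‖x‖ ^ 2 + ε n) (by positivity)
      (by linarith [ε0 n]) (by linarith [ε1 n])
    have hT := T_pos (s := ‖x‖ ^ 2) (by positivity) (by linarith)
    gcongr
  · filter_upwards [compl_mem_ae_iff.2 (measure_singleton (μ := volume) (0:E2))] with x hx
    have hx : x ≠ 0 := hx
    rw [Wx x hx]
    by_cases h0 : φ x = 0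
    · simp [h0]
    have hxs : x ∈ Metric.ball (0:E2) ρ := hsρ (subset_tsupport _ h0)
    have hxn : ‖x‖ < ρ := by simpa using hxs
    have hp : 0 < ‖x‖ := norm_pos_iff.2 hx
    have hx2 : ‖x‖ ^ 2 < ρ ^ 2 := by gcongr
    have hT := T_pos (s := ‖x‖ ^ 2) (by positivity) (by linarith)
    have h1 : Tendsto (fun n => ‖x‖ ^ 2 + ε n) atTop (𝓝 (‖x‖ ^ 2)) := by
      simpa using εlim.const_add (‖x‖ ^ 2)
    have h2 := h1.log (by positivity)
    exact tendsto_const_nhds.div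
      (((h1.mul ((h2.div_const 2).const_sub 1)).pow 2).const_mul 4) (by positivity)

lemma part1 {k : ℝ} (hk : k ≤ 1 / 4) {φ : E2 → ℝ} {L : NNReal} (hL : LipschitzWith L φ)
    (hc : HasCompactSupport φ) (hs : tsupport φ ⊆ Metric.ball (0 : E2) 1) :
    0 ≤ hardyForm k φ := by
  have h := hardy_quarter hL hc hs
  have h2 : 0 ≤ ∫ x in Metric.ball (0 : E2) 1,
      (φ x) ^ 2 / (‖x‖ ^ 2 * (Real.log (Real.exp 1 / ‖x‖)) ^ 2) :=
    integral_nonneg fun x => by simp only [Pi.zero_apply]; positivity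
  unfold hardyForm
  nlinarith

lemma oned {c k a b : ℝ} (ha : 0 < a) (hab : a < b) (hb : b < 1) (hck : c < k) {h p : ℝ → ℝ}
    (hh : ∀ r ∈ Icc a b, HasDerivAt h (p r / r) r)
    (hp : ∀ r ∈ Icc a b, HasDerivAt p (-c * h r / (r * (1 - Real.log r) ^ 2)) r)
    (h0a : h a = 0) (h0b : h b = 0) (hne : ∃ r ∈ Ioo a b, h r ≠ 0) :
    (∫ r in a..b, p r ^ 2 / r) - k * ∫ r in a..b, h r ^ 2 / (r * (1 - Real.log r) ^ 2) < 0 := by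
  have hpos : ∀ r ∈ Icc a b, 0 < r * (1 - Real.log r) ^ 2 := by
    intro r hr
    have h1 : 0 < r := ha.trans_le hr.1
    have h2 := Real.log_nonpos h1.le (hr.2.trans hb.le)
    have : 0 < 1 - Real.log r := by linarith
    positivity
  have hr0 : ∀ r ∈ Icc a b, r ≠ 0 := fun r hr => (ha.trans_le hr.1).ne'
  have ch : ContinuousOn h (Icc a b) := fun r hr => (hh r hr).continuousAt.continuousWithinAt
  have cp : ContinuousOn p (Icc a b) := fun r hr => (hp r hr).continuousAt.continuousWithinAt
  have cl : ContinuousOn Real.log (Icc a b) :=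
    fun r hr => (Real.continuousAt_log (hr0 r hr)).continuousWithinAt
  have c1 : ContinuousOn (fun r => p r ^ 2 / r) (Icc a b) := (cp.pow 2).div continuousOn_id hr0
  have c2 : ContinuousOn (fun r => h r ^ 2 / (r * (1 - Real.log r) ^ 2)) (Icc a b) :=
    (ch.pow 2).div (continuousOn_id.mul ((continuousOn_const.sub cl).pow 2))
      (fun r hr => (hpos r hr).ne')
  have i1 : IntervalIntegrable (fun r => p r ^ 2 / r) volume a b :=
    ContinuousOn.intervalIntegrable (by rwa [uIcc_of_le hab.le])
  have i2 : IntervalIntegrable (fun r => h r ^ 2 / (r * (1 - Real.log r) ^ 2)) volume a b :=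
    ContinuousOn.intervalIntegrable (by rwa [uIcc_of_le hab.le])
  have ftc : ∫ r in a..b, (p r ^ 2 / r - c * (h r ^ 2 / (r * (1 - Real.log r) ^ 2))) = 0 := by
    rw [intervalIntegral.integral_eq_sub_of_hasDerivAt (f := fun r => h r * p r)]
    · simp [h0a, h0b]
    · intro r hr
      rw [uIcc_of_le hab.le] at hr
      have := (hh r hr).mul (hp r hr)
      convert! this using 1
      ring
    · exact i1.sub (i2.const_mul c)
  rw [intervalIntegral.integral_sub i1 (i2.const_mul c), intervalIntegral.integral_const_mul] at ftc
  have pos : 0 < ∫ r in a..b, h r ^ 2 / (r * (1 - Real.log r) ^ 2) := by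
    obtain ⟨r, hr, hr1⟩ := hne
    apply intervalIntegral.integral_pos hab c2
    · intro x hx
      have := hpos x (Ioc_subset_Icc_self hx)
      positivity
    · refine ⟨r, Ioo_subset_Icc_self hr, ?_⟩
      have := hpos r (Ioo_subset_Icc_self hr)
      positivity
  nlinarith

lemma exists_neg {c k a b : ℝ} (ha : 0 < a) (hab : a < b) (hb : b < 1) (hck : c < k) (hk : 0 < k)
    {h p : ℝ → ℝ}
    (hh : ∀ r ∈ Icc a b, HasDerivAt h (p r / r) r)
    (hp : ∀ r ∈ Icc a b, HasDerivAt p (-c * h r / (r * (1 - Real.log r) ^ 2)) r)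
    (h0a : h a = 0) (h0b : h b = 0) (hne : ∃ r ∈ Ioo a b, h r ≠ 0) :
    ∃ φ : E2 → ℝ, (∃ L : NNReal, LipschitzWith L φ) ∧
      (∀ x, φ x ≠ 0 → ‖x‖ ∈ Ioo a b) ∧ hardyForm k φ < 0 := by
  have main := oned ha hab hb hck hh hp h0a h0b hne
  have hr0 : ∀ r ∈ Icc a b, r ≠ 0 := fun r hr => (ha.trans_le hr.1).ne'
  have ch : ContinuousOn h (Icc a b) := fun r hr => (hh r hr).continuousAt.continuousWithinAt
  have cp : ContinuousOn p (Icc a b) := fun r hr => (hp r hr).continuousAt.continuousWithinAt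
  have cpr : ContinuousOn (fun r => p r / r) (Icc a b) := cp.div continuousOn_id hr0
  obtain ⟨M, hM⟩ := isCompact_Icc.exists_bound_of_continuousOn cpr
  have hM0 : 0 ≤ M := (norm_nonneg _).trans (hM a ⟨le_rfl, hab.le⟩)
  have hlip : LipschitzOnWith ⟨M, hM0⟩ h (Icc a b) := by
    apply Convex.lipschitzOnWith_of_nnnorm_hasDerivWithin_le (convex_Icc a b)
      (fun r hr => (hh r hr).hasDerivWithinAt)
    intro r hr
    exact hM r hr
  let cl : E2 → ℝ := fun x => max a (min b ‖x‖)
  have hcl : LipschitzWith 1 cl := (lipschitzWith_one_norm.const_min b).const_max a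
  have hclm : ∀ x, cl x ∈ Icc a b := fun x =>
    ⟨le_max_left _ _, max_le hab.le (min_le_left _ _)⟩
  let φ : E2 → ℝ := fun x => h (cl x)
  have φlip : LipschitzWith (⟨M, hM0⟩ * 1) φ := by
    rw [← lipschitzOnWith_univ]
    exact hlip.comp hcl.lipschitzOnWith (fun x _ => hclm x)
  have φin : ∀ x, ‖x‖ ∈ Icc a b → φ x = h ‖x‖ := by
    intro x hx
    simp only [φ, cl]
    rw [min_eq_right hx.2, max_eq_right hx.1]
  have φlo : ∀ x, ‖x‖ ≤ a → φ x = 0 := by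
    intro x hx
    simp only [φ, cl]
    rw [min_eq_right (hx.trans hab.le), max_eq_left hx, h0a]
  have φhi : ∀ x, b ≤ ‖x‖ → φ x = 0 := by
    intro x hx
    simp only [φ, cl]
    rw [min_eq_left hx, max_eq_right hab.le, h0b]
  have φsupp : ∀ x, φ x ≠ 0 → ‖x‖ ∈ Ioo a b := by
    intro x hx
    constructor
    · by_contra h; exact hx (φlo x (not_lt.1 h))
    · by_contra h; exact hx (φhi x (not_lt.1 h))
  refine ⟨φ, ⟨_, φlip⟩, φsupp, ?_⟩
  have hsub : Ioo a b ⊆ Ioi 0 := fun r hr => ha.trans hr.1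
  -- weights
  let G : ℝ → ℝ := (Ioo a b).indicator (fun r => (p r / r) ^ 2)
  let W : ℝ → ℝ := (Ioo a b).indicator (fun r => h r ^ 2 / (r ^ 2 * (1 - Real.log r) ^ 2))
  have fr : Module.finrank ℝ E2 = 2 := by simp
  have conv : ∀ F : ℝ → ℝ, ∫ x : E2, ((Ioo a b).indicator F) ‖x‖ =
      2 * (volume.real (Metric.ball (0:E2) 1)) * ∫ r in a..b, r * F r := by
    intro F
    rw [integral_fun_norm_addHaar volume ((Ioo a b).indicator F), fr,
      intervalIntegral.integral_of_le hab.le, integral_Ioc_eq_integral_Ioo]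
    simp only [smul_eq_mul, nsmul_eq_mul, mul_assoc]
    congr 2
    have : ∀ y : ℝ, y ^ (2 - 1) * (Ioo a b).indicator F y
        = (Ioo a b).indicator (fun r => r * F r) y := by
      intro y
      by_cases hy : y ∈ Ioo a b <;> simp [hy]
    simp only [this]
    rw [setIntegral_indicator measurableSet_Ioo, inter_eq_right.2 hsub]
  have Gint : Integrable (fun x : E2 => G ‖x‖) := by
    rw [integrable_fun_norm_addHaar volume, fr]
    have : ∀ y : ℝ, y ^ (2 - 1) • G y
        = (Ioo a b).indicator (fun r => r * (p r / r) ^ 2) y := by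
      intro y
      by_cases hy : y ∈ Ioo a b <;> simp [hy, G]
    simp only [this]
    apply Integrable.integrableOn
    rw [integrable_indicator_iff measurableSet_Ioo]
    exact ((continuousOn_id.mul (cpr.pow 2)).integrableOn_compact isCompact_Icc).mono_set
      Ioo_subset_Icc_self
  have hW : ∫ x in Metric.ball (0 : E2) 1,
      (φ x) ^ 2 / (‖x‖ ^ 2 * (Real.log (Real.exp 1 / ‖x‖)) ^ 2) = ∫ x : E2, W ‖x‖ := by
    rw [setIntegral_eq_integral_of_forall_compl_eq_zero]
    · congr 1
      ext x
      by_cases hx : ‖x‖ ∈ Ioo a b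
      · simp only [W, indicator_of_mem hx]
        rw [φin x (Ioo_subset_Icc_self hx), Real.log_div (Real.exp_ne_zero 1)
          (hr0 _ (Ioo_subset_Icc_self hx)), Real.log_exp]
      · have : φ x = 0 := by
          by_contra h; exact hx (φsupp x h)
        simp [W, hx, this]
    · intro x hx
      have : φ x = 0 := by
        by_contra h
        apply hx
        have := (φsupp x h).2
        rw [mem_ball_zero_iff]; linarith
      simp [this]
  have hG : ∫ x in Metric.ball (0 : E2) 1, ‖fderiv ℝ φ x‖ ^ 2 ≤ ∫ x : E2, G ‖x‖ := by
    refine (setIntegral_le_integral (s := Metric.ball (0 : E2) 1) (f := fun x => G ‖x‖) Gint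
      ?_).trans' ?_
    · refine Filter.Eventually.of_forall fun x => ?_
      exact indicator_nonneg (fun r _ => by positivity) _
    apply integral_mono_of_nonneg (Filter.Eventually.of_forall fun x => by
      simp only [Pi.zero_apply]; positivity) Gint.integrableOn
    apply ae_restrict_of_ae
    have s1 : volume (Metric.sphere (0:E2) a) = 0 := Measure.addHaar_sphere _ _ _
    have s2 : volume (Metric.sphere (0:E2) b) = 0 := Measure.addHaar_sphere _ _ _
    filter_upwards [compl_mem_ae_iff.2 s1, compl_mem_ae_iff.2 s2] with x h1 h2
    have h1 : ‖x‖ ≠ a := by simpa using h1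
    have h2 : ‖x‖ ≠ b := by simpa using h2
    have cn : ContinuousAt (fun y : E2 => ‖y‖) x := continuous_norm.continuousAt
    have zero : φ =ᶠ[𝓝 x] (fun _ => 0) → ‖fderiv ℝ φ x‖ ^ 2 ≤ G ‖x‖ := by
      intro hz
      rw [hz.fderiv_eq]
      simp only [fderiv_fun_const, Pi.zero_apply, norm_zero]
      simpa using indicator_nonneg (fun r _ => by positivity) _
    rcases lt_or_gt_of_ne h1 with h1 | h1
    · apply zero
      filter_upwards [cn.eventually_lt_const h1] with y hy using φlo y hy.le
    rcases lt_or_gt_of_ne h2 with h2 | h2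
    · have hx : ‖x‖ ∈ Ioo a b := ⟨h1, h2⟩
      have ev : φ =ᶠ[𝓝 x] fun y => h ‖y‖ := by
        filter_upwards [cn.eventually_lt_const h2, cn.eventually_const_lt h1] with y hy hy'
          using φin y ⟨hy'.le, hy.le⟩
      have hx0 : x ≠ 0 := norm_pos_iff.1 (ha.trans h1)
      have hd : DifferentiableAt ℝ (fun y : E2 => ‖y‖) x := differentiableAt_id.norm ℝ hx0
      have hf := (hh _ (Ioo_subset_Icc_self hx)).comp_hasFDerivAt x hd.hasFDerivAt
      have hf : HasFDerivAt (fun y : E2 => h ‖y‖) _ x := hf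
      rw [ev.fderiv_eq, hf.fderiv]
      simp only [G, indicator_of_mem hx]
      rw [norm_smul, mul_pow, Real.norm_eq_abs, sq_abs]
      have : ‖fderiv ℝ (fun y : E2 => ‖y‖) x‖ ≤ 1 := by
        simpa using norm_fderiv_le_of_lipschitz ℝ (lipschitzWith_one_norm (E := E2)) (x₀ := x)
      have h3 : ‖fderiv ℝ (fun y : E2 => ‖y‖) x‖ ^ 2 ≤ 1 := pow_le_one₀ (norm_nonneg _) this
      exact mul_le_of_le_one_right (sq_nonneg _) h3
    · apply zero
      filter_upwards [cn.eventually_const_lt h2] with y hy using φhi y hy.le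
  unfold hardyForm
  rw [hW]
  have cG := conv (fun r => (p r / r) ^ 2)
  have cW := conv (fun r => h r ^ 2 / (r ^ 2 * (1 - Real.log r) ^ 2))
  have eG : ∫ r in a..b, r * (p r / r) ^ 2 = ∫ r in a..b, p r ^ 2 / r := by
    apply intervalIntegral.integral_congr
    intro r hr
    rw [uIcc_of_le hab.le] at hr
    have := hr0 r hr
    simp only
    field_simp
  have eW : ∫ r in a..b, r * (h r ^ 2 / (r ^ 2 * (1 - Real.log r) ^ 2))
      = ∫ r in a..b, h r ^ 2 / (r * (1 - Real.log r) ^ 2) := by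
    apply intervalIntegral.integral_congr
    intro r hr
    rw [uIcc_of_le hab.le] at hr
    have := hr0 r hr
    simp only
    rw [← mul_div_assoc, show r ^ 2 * (1 - Real.log r) ^ 2 = r * (r * (1 - Real.log r) ^ 2) by ring,
      mul_div_mul_left _ _ this]
  rw [eG] at cG
  rw [eW] at cW
  have hv : 0 < volume.real (Metric.ball (0:E2) 1) :=
    ENNReal.toReal_pos (Metric.measure_ball_pos _ _ one_pos).ne' measure_ball_lt_top.ne
  have : (∫ x : E2, G ‖x‖) - k * ∫ x : E2, W ‖x‖ < 0 := by
    simp only [G, W]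
    rw [cG, cW]
    have := mul_neg_of_pos_of_neg (mul_pos two_pos hv) main
    linarith
  linarith

noncomputable def hfun (ω r : ℝ) : ℝ :=
  Real.sqrt (1 - Real.log r) * Real.sin (ω * Real.log (1 - Real.log r))

noncomputable def pfun (ω r : ℝ) : ℝ :=
  -((Real.sin (ω * Real.log (1 - Real.log r)) / 2 + ω * Real.cos (ω * Real.log (1 - Real.log r)))
    / Real.sqrt (1 - Real.log r))

lemma hfun_deriv (ω : ℝ) {r : ℝ} (h0 : 0 < r) (h1 : r < 1) :
    HasDerivAt (hfun ω) (pfun ω r / r) r := by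
  have hl := Real.log_neg h0 h1
  have ht : 0 < 1 - Real.log r := by linarith
  have d1 := (Real.hasDerivAt_log h0.ne').const_sub 1
  have d2 := d1.sqrt ht.ne'
  have d3 := (d1.log ht.ne').const_mul ω
  have := d2.mul d3.sin
  convert! this using 1
  unfold pfun
  generalize Real.sin (ω * Real.log (1 - Real.log r)) = S
  generalize Real.cos (ω * Real.log (1 - Real.log r)) = C
  generalize 1 - Real.log r = t at *
  obtain ⟨q, hq, rfl⟩ : ∃ q : ℝ, 0 < q ∧ t = q ^ 2 :=
    ⟨Real.sqrt t, Real.sqrt_pos.2 ht, (Real.sq_sqrt ht.le).symm⟩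
  rw [Real.sqrt_sq hq.le]
  field_simp
  ring

lemma pfun_deriv (ω : ℝ) {r : ℝ} (h0 : 0 < r) (h1 : r < 1) :
    HasDerivAt (pfun ω) (-(1 / 4 + ω ^ 2) * hfun ω r / (r * (1 - Real.log r) ^ 2)) r := by
  have hl := Real.log_neg h0 h1
  have ht : 0 < 1 - Real.log r := by linarith
  have d1 := (Real.hasDerivAt_log h0.ne').const_sub 1
  have d2 := d1.sqrt ht.ne'
  have d3 := (d1.log ht.ne').const_mul ω
  have := (((d3.sin.div_const 2).add (d3.cos.const_mul ω)).div d2 (Real.sqrt_pos.2 ht).ne').neg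
  convert! this using 1
  unfold hfun
  simp only [Pi.add_apply]
  generalize Real.sin (ω * Real.log (1 - Real.log r)) = S
  generalize Real.cos (ω * Real.log (1 - Real.log r)) = C
  generalize 1 - Real.log r = t at *
  obtain ⟨q, hq, rfl⟩ : ∃ q : ℝ, 0 < q ∧ t = q ^ 2 :=
    ⟨Real.sqrt t, Real.sqrt_pos.2 ht, (Real.sq_sqrt ht.le).symm⟩
  rw [Real.sqrt_sq hq.le]
  field_simp
  ring

/-- radius -/
noncomputable def Rad (ω y : ℝ) : ℝ := Real.exp (1 - Real.exp (y * Real.pi / ω))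

lemma Rad_anti {ω : ℝ} (hω : 0 < ω) : StrictAnti (Rad ω) := by
  intro x y hxy
  unfold Rad
  gcongr

lemma hfun_Rad {ω : ℝ} (hω : 0 < ω) (y : ℝ) :
    hfun ω (Rad ω y) = Real.sqrt (Real.exp (y * Real.pi / ω)) * Real.sin (y * Real.pi) := by
  unfold hfun Rad
  rw [Real.log_exp, sub_sub_cancel, Real.log_exp, mul_div_cancel₀ _ hω.ne']

lemma part2 {k : ℝ} (hk : 1 / 4 < k) (n : ℕ) {ω : ℝ} (hω : 0 < ω) (hω2 : 1 / 4 + ω ^ 2 < k) :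
    ∃ φ : E2 → ℝ, (∃ L : NNReal, LipschitzWith L φ) ∧
      (∀ x, φ x ≠ 0 → ‖x‖ ∈ Ioo (Rad ω (n + 2)) (Rad ω (n + 1))) ∧ hardyForm k φ < 0 := by
  have h1 : Rad ω (n + 1) < 1 := by
    unfold Rad
    rw [Real.exp_lt_one_iff, sub_neg, Real.one_lt_exp_iff]
    positivity
  refine exists_neg (h := hfun ω) (p := pfun ω) (Real.exp_pos _) (Rad_anti hω (by linarith)) h1
    hω2 (by linarith)
    (fun r hr => hfun_deriv ω ((Real.exp_pos _).trans_le hr.1) (hr.2.trans_lt h1))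
    (fun r hr => pfun_deriv ω ((Real.exp_pos _).trans_le hr.1) (hr.2.trans_lt h1)) ?_ ?_ ?_
  · rw [hfun_Rad hω]
    have := Real.sin_nat_mul_pi (n + 2)
    push_cast at this
    simp [this]
  · rw [hfun_Rad hω]
    have := Real.sin_nat_mul_pi (n + 1)
    push_cast at this
    simp [this]
  · refine ⟨Rad ω (n + 3 / 2), ⟨Rad_anti hω (by linarith), Rad_anti hω (by linarith)⟩, ?_⟩
    rw [hfun_Rad hω]
    apply mul_ne_zero (by positivity)
    rw [Real.sin_ne_zero_iff]
    intro m hm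
    have := mul_right_cancel₀ Real.pi_ne_zero hm
    have h2 : ((2 * m : ℤ) : ℝ) = ((2 * n + 3 : ℤ) : ℝ) := by push_cast; linarith
    have h3 : 2 * m = 2 * (n:ℤ) + 3 := by exact_mod_cast h2
    omega

/-- Stability of the singular solution in the exponential case: the form `Q`
is non-negative on compactly supported Lipschitz functions in the unit ball
iff `k ≤ 1/4`; for `k > 1/4` there is a sequence of nontrivial such functions
with pairwise disjoint supports on which `Q` is negative. -/
theorem stmt7 (k : ℝ) (hk : 0 < k) :
    (k ≤ 1 / 4 →
      ∀ (φ : EuclideanSpace ℝ (Fin 2) → ℝ) (L : NNReal),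
        LipschitzWith L φ → HasCompactSupport φ →
        tsupport φ ⊆ Metric.ball (0 : EuclideanSpace ℝ (Fin 2)) 1 →
        0 ≤ hardyForm k φ) ∧
    (1 / 4 < k →
      ∃ φ : ℕ → EuclideanSpace ℝ (Fin 2) → ℝ,
        (∀ n : ℕ, ∃ L : NNReal, LipschitzWith L (φ n)) ∧
        (∀ n : ℕ, φ n ≠ 0) ∧
        (∀ n : ℕ, HasCompactSupport (φ n)) ∧
        (∀ n : ℕ, tsupport (φ n) ⊆ Metric.ball (0 : EuclideanSpace ℝ (Fin 2)) 1) ∧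
        (∀ i j : ℕ, i ≠ j →
          Disjoint (Function.support (φ i)) (Function.support (φ j))) ∧
        (∀ n : ℕ, hardyForm k (φ n) < 0)) := by
  refine ⟨fun hk4 φ L hL hc hs => part1 hk4 hL hc hs, fun hk4 => ?_⟩
  obtain ⟨ω, hω, hω2⟩ : ∃ ω : ℝ, 0 < ω ∧ 1 / 4 + ω ^ 2 < k := by
    refine ⟨Real.sqrt ((k - 1 / 4) / 2), Real.sqrt_pos.2 (by linarith), ?_⟩
    rw [Real.sq_sqrt (by linarith)]
    linarith
  choose φ hL hs hneg using fun n : ℕ => part2 hk4 n hω hω2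
  have hts : ∀ n : ℕ, tsupport (φ n) ⊆ Metric.closedBall (0 : E2) (Rad ω (n + 1)) := by
    intro n
    apply closure_minimal _ Metric.isClosed_closedBall
    intro x hx
    rw [mem_closedBall_zero_iff]
    exact (hs n x hx).2.le
  refine ⟨φ, hL, ?_, ?_, ?_, ?_, hneg⟩
  · intro n h
    have := hneg n
    rw [h] at this
    simp [hardyForm] at this
  · intro n
    exact (isCompact_closedBall (0 : E2) _).of_isClosed_subset (isClosed_tsupport _) (hts n)
  · intro n
    refine (hts n).trans (Metric.closedBall_subset_ball ?_)
    unfold Rad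
    rw [Real.exp_lt_one_iff, sub_neg, Real.one_lt_exp_iff]
    positivity
  · have key : ∀ i j : ℕ, i < j →
        Disjoint (Function.support (φ i)) (Function.support (φ j)) := by
      intro i j hij
      rw [Set.disjoint_left]
      intro x hi hj
      have h1 := (hs i x hi).1
      have h2 := (hs j x hj).2
      have h3 : (i : ℝ) + 2 ≤ j + 1 := by
        have : (i : ℝ) + 1 ≤ j := by exact_mod_cast hij
        linarith
      have h4 := (Rad_anti hω).antitone h3
      linarith
    intro i j hij
    rcases lt_or_gt_of_ne hij with h | h
    · exact key i j h
    · exact (key j i h).symm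
end

section
/- Let 0 < k ≤ 1/4 and let V_k(r) = 1/(r^2 (1 - log r)^{2+k}) for 0 < r < e. Let W(r) = k·log(1 - log r) + log k. For β ∈ ℝ, let v(·, β) ∈ C^0([0, e)) ∩ C^2((0, e)) be the unique solution of v'' + v'/r + V_k(r) e^v = 0 on (0, e) with v(0, β) = β. Then: (i) v(r, β) < W(r) for all 0 < r < e; and (ii) if β < γ then v(r, β) < v(r, γ) for all 0 < r < e. -/
open Filter Topology Set MeasureTheory

lemma sturm_pos (g g' g'' : ℝ → ℝ)
    (h1 : ∀ t, 0 < t → HasDerivAt g (g' t) t)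
    (h2 : ∀ t, 0 < t → HasDerivAt g' (g'' t) t)
    (hineq : ∀ t, 0 < t → 0 < g t → -(g t / (4 * t ^ 2)) ≤ g'' t)
    (hev : ∀ᶠ t in atTop, 0 < g t)
    (hlim : Tendsto (fun t => g t / Real.sqrt t) atTop (𝓝 0)) :
    ∀ t, 0 < t → 0 < g t := by
  intro t1 ht1
  by_contra hneg
  push Not at hneg
  obtain ⟨T, hT⟩ := eventually_atTop.1 hev
  have hgc : ContinuousOn g (Icc t1 T) := fun t ht =>
    (h1 t (lt_of_lt_of_le ht1 ht.1)).continuousAt.continuousWithinAt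
  have hcomp : IsCompact (Icc t1 T ∩ g ⁻¹' Iic 0) :=
    isCompact_Icc.of_isClosed_subset (hgc.preimage_isClosed_of_isClosed isClosed_Icc isClosed_Iic)
      inter_subset_left
  have ht1T : t1 ≤ T := by
    by_contra h
    push Not at h
    exact absurd (hT t1 h.le) (not_lt.2 hneg)
  obtain ⟨t0, ht0, hmax⟩ := hcomp.exists_isGreatest ⟨t1, ⟨⟨le_refl _, ht1T⟩, hneg⟩⟩
  have ht0p : 0 < t0 := lt_of_lt_of_le ht1 ht0.1.1
  have hpos : ∀ t, t0 < t → 0 < g t := by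
    intro t ht
    by_contra hc
    push Not at hc
    rcases le_total t T with h | h
    · exact absurd (hmax ⟨⟨ht0.1.1.trans ht.le, h⟩, hc⟩) (not_le.2 ht)
    · exact absurd (hT t h) (not_lt.2 hc)
  have hle : g t0 ≤ 0 := ht0.2
  have hslope : 0 ≤ g' t0 := by
    have hd := (h1 t0 ht0p).hasDerivWithinAt (s := Ioi t0)
    rw [hasDerivWithinAt_iff_tendsto_slope' (by simp)] at hd
    refine ge_of_tendsto hd ?_
    filter_upwards [self_mem_nhdsWithin] with t ht
    rw [slope_def_field]
    have := hpos t ht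
    exact div_nonneg (by linarith) (by have : t0 < t := ht; linarith)
  have hs : ∀ t, 0 < t → HasDerivAt Real.sqrt (1 / (2 * Real.sqrt t)) t := fun t ht =>
    Real.hasDerivAt_sqrt ht.ne'
  set P : ℝ → ℝ := fun t => g t / (2 * Real.sqrt t) - g' t * Real.sqrt t with hP
  have hPd : ∀ t, 0 < t → HasDerivAt P (-(Real.sqrt t * (g'' t + g t / (4 * t ^ 2)))) t := by
    intro t ht
    have hst := Real.sqrt_pos.2 ht
    have e := ((h1 t ht).div ((hs t ht).const_mul 2) (by positivity)).sub ((h2 t ht).mul (hs t ht))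
    refine e.congr_deriv ?_
    have hq : t = Real.sqrt t ^ 2 := (Real.sq_sqrt ht.le).symm
    generalize Real.sqrt t = s at *
    subst hq
    field_simp
    ring
  have hPanti : AntitoneOn P (Ici t0) := by
    apply antitoneOn_of_deriv_nonpos (convex_Ici t0)
    · exact fun t ht => (hPd t (lt_of_lt_of_le ht0p ht)).continuousAt.continuousWithinAt
    · intro t ht
      rw [interior_Ici] at ht
      exact (hPd t (ht0p.trans ht)).differentiableAt.differentiableWithinAt
    · intro t ht
      rw [interior_Ici] at ht
      have htp := ht0p.trans ht
      rw [(hPd t htp).deriv]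
      have := hineq t htp (hpos t ht)
      have : 0 ≤ Real.sqrt t * (g'' t + g t / (4 * t ^ 2)) :=
        mul_nonneg (Real.sqrt_nonneg _) (by linarith)
      linarith
  have hP0 : P t0 ≤ 0 := by
    have a : g t0 / (2 * Real.sqrt t0) ≤ 0 := div_nonpos_of_nonpos_of_nonneg hle (by positivity)
    have b : 0 ≤ g' t0 * Real.sqrt t0 := by positivity
    simp only [hP]; linarith
  have hQd : ∀ t, 0 < t → HasDerivAt (fun t => g t / Real.sqrt t) (-(P t) / t) t := by
    intro t ht
    have hst := Real.sqrt_pos.2 ht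
    refine ((h1 t ht).div (hs t ht) hst.ne').congr_deriv ?_
    simp only [hP]
    have hq : t = Real.sqrt t ^ 2 := (Real.sq_sqrt ht.le).symm
    generalize Real.sqrt t = s at *
    subst hq
    field_simp
    ring
  have hQmono : MonotoneOn (fun t => g t / Real.sqrt t) (Ici t0) := by
    apply monotoneOn_of_deriv_nonneg (convex_Ici t0)
    · exact fun t ht => (hQd t (lt_of_lt_of_le ht0p ht)).continuousAt.continuousWithinAt
    · intro t ht
      rw [interior_Ici] at ht
      exact (hQd t (ht0p.trans ht)).differentiableAt.differentiableWithinAt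
    · intro t ht
      rw [interior_Ici] at ht
      have htp := ht0p.trans ht
      rw [(hQd t htp).deriv]
      have : P t ≤ P t0 := hPanti self_mem_Ici (mem_Ici.2 (mem_Ioi.1 ht).le) (mem_Ioi.1 ht).le
      exact div_nonneg (by linarith) htp.le
  have hfin : g (t0 + 1) / Real.sqrt (t0 + 1) ≤ 0 := by
    refine ge_of_tendsto hlim ?_
    filter_upwards [eventually_ge_atTop (t0 + 1)] with t ht
    exact hQmono (by simp) (by simp only [mem_Ici]; linarith) ht
  have : 0 < g (t0 + 1) / Real.sqrt (t0 + 1) :=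
    div_pos (hpos _ (by linarith)) (Real.sqrt_pos.2 (by linarith))
  linarith

lemma exp_mem {t : ℝ} (ht : 0 < t) : Real.exp (1 - t) ∈ Ioo (0 : ℝ) (Real.exp 1) :=
  ⟨Real.exp_pos _, Real.exp_lt_exp.2 (by linarith)⟩

lemma transf (k : ℝ) (v v' v'' : ℝ → ℝ) (hs : IsSolExp k v v' v'') :
    (∀ t, 0 < t → HasDerivAt (fun t => v (Real.exp (1 - t)))
      (-(Real.exp (1 - t) * v' (Real.exp (1 - t)))) t) ∧
    (∀ t, 0 < t → HasDerivAt (fun t => -(Real.exp (1 - t) * v' (Real.exp (1 - t))))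
      (-(Real.exp (v (Real.exp (1 - t))) / (t ^ 2 * t ^ k))) t) := by
  obtain ⟨h1, h2, -, h4⟩ := hs
  have he : ∀ t : ℝ, HasDerivAt (fun t => Real.exp (1 - t)) (-Real.exp (1 - t)) t := by
    intro t
    simpa using ((hasDerivAt_id t).const_sub 1).exp
  constructor
  · intro t ht
    have := (h1 _ (exp_mem ht)).comp t (he t)
    exact this.congr_deriv (by ring)
  · intro t ht
    have := ((he t).mul ((h2 _ (exp_mem ht)).comp t (he t))).neg
    refine this.congr_deriv ?_
    have e := h4 _ (exp_mem ht)
    simp only [Vk, Real.log_exp, sub_sub_cancel] at e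
    rw [Real.rpow_add ht, Real.rpow_two] at e
    simp only [Function.comp]
    have hr := Real.exp_pos (1 - t)
    have hk := Real.rpow_pos_of_pos ht k
    generalize Real.exp (1 - t) = r at *
    have e' : v'' r = -(v' r / r + 1 / (r ^ 2 * (t ^ 2 * t ^ k)) * Real.exp (v r)) := by linarith
    rw [e']
    field_simp
    ring

lemma lim_u (v : ℝ → ℝ) (hc : ContinuousOn v (Ico 0 (Real.exp 1))) :
    Tendsto (fun t => v (Real.exp (1 - t))) atTop (𝓝 (v 0)) := by
  have h := hc 0 ⟨le_refl _, Real.exp_pos 1⟩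
  refine h.tendsto.comp (tendsto_nhdsWithin_iff.2 ⟨?_, ?_⟩)
  · exact Real.tendsto_exp_atBot.comp (tendsto_atBot_add_const_left _ 1 tendsto_neg_atTop_atBot)
  · filter_upwards [eventually_gt_atTop 0] with t ht
    exact ⟨(exp_mem ht).1.le, (exp_mem ht).2⟩

lemma part1_s8 (k : ℝ) (hk0 : 0 < k) (hk : k ≤ 1 / 4) (v v' v'' : ℝ → ℝ)
    (hc : ContinuousOn v (Ico 0 (Real.exp 1))) (hs : IsSolExp k v v' v'') :
    ∀ t, 0 < t → v (Real.exp (1 - t)) < k * Real.log t + Real.log k := by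
  obtain ⟨a, b⟩ := transf k v v' v'' hs
  have hl := lim_u v hc
  have hsq : Tendsto (fun t : ℝ => (Real.sqrt t)⁻¹) atTop (𝓝 0) :=
    tendsto_inv_atTop_zero.comp Real.tendsto_sqrt_atTop
  have key := sturm_pos (fun t => k * Real.log t + Real.log k - v (Real.exp (1 - t)))
    (fun t => k * t⁻¹ - -(Real.exp (1 - t) * v' (Real.exp (1 - t))))
    (fun t => k * (-(t ^ 2)⁻¹) - -(Real.exp (v (Real.exp (1 - t))) / (t ^ 2 * t ^ k)))
    (fun t ht => (((Real.hasDerivAt_log ht.ne').const_mul k).add_const _).sub (a t ht))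
    (fun t ht => ((hasDerivAt_inv ht.ne').const_mul k).sub (b t ht)) ?_ ?_ ?_
  · intro t ht
    have := key t ht
    linarith
  · intro t ht hg
    set g := k * Real.log t + Real.log k - v (Real.exp (1 - t)) with hgdef
    have hv : Real.exp (v (Real.exp (1 - t))) = k * t ^ k * Real.exp (-g) := by
      rw [Real.rpow_def_of_pos ht]
      have hkk : k * Real.exp (Real.log t * k) * Real.exp (-g) =
          Real.exp (Real.log k) * Real.exp (Real.log t * k) * Real.exp (-g) := by
        rw [Real.exp_log hk0]
      rw [hkk, ← Real.exp_add, ← Real.exp_add]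
      congr 1
      rw [hgdef]; ring
    have htk := Real.rpow_pos_of_pos ht k
    have h3 : 1 - g ≤ Real.exp (-g) := by linarith [Real.add_one_le_exp (-g)]
    rw [hv]
    have e : k * (-(t ^ 2)⁻¹) - -(k * t ^ k * Real.exp (-g) / (t ^ 2 * t ^ k))
        - -(g / (4 * t ^ 2)) = (k * (Real.exp (-g) - (1 - g)) + (1 / 4 - k) * g) / t ^ 2 := by
      field_simp
      ring
    have : 0 ≤ (k * (Real.exp (-g) - (1 - g)) + (1 / 4 - k) * g) / t ^ 2 := by
      apply div_nonneg _ (by positivity)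
      have := mul_nonneg hk0.le (sub_nonneg.2 h3)
      have := mul_nonneg (sub_nonneg.2 hk) hg.le
      linarith
    linarith
  · have h1 : Tendsto (fun t => k * Real.log t + Real.log k) atTop atTop :=
      tendsto_atTop_add_const_right _ _ (Real.tendsto_log_atTop.const_mul_atTop hk0)
    have h2 := h1.atTop_add hl.neg
    filter_upwards [h2.eventually_gt_atTop 0] with t ht
    linarith
  · have h1 : Tendsto (fun t => Real.log t / Real.sqrt t) atTop (𝓝 0) := by
      have := (isLittleO_log_rpow_atTop (r := 1 / 2) (by norm_num)).tendsto_div_nhds_zero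
      simpa only [← Real.sqrt_eq_rpow] using this
    have h2 := (h1.const_mul k).add ((hl.const_sub (Real.log k)).mul hsq)
    simp only [mul_zero, add_zero] at h2
    refine h2.congr fun t => ?_
    ring

/-- Separation property in the exponential case for `0 < k ≤ 1/4`: regular
solutions lie strictly below the singular solution
`W(r) = k log(1 - log r) + log k`, and are strictly ordered in `β`. -/
theorem stmt8 (k : ℝ) (hk0 : 0 < k) (hk : k ≤ 1 / 4) (β γ : ℝ) (hβγ : β < γ)
    (vβ vβ' vβ'' vγ vγ' vγ'' : ℝ → ℝ)
    (hcβ : ContinuousOn vβ (Set.Ico 0 (Real.exp 1))) (h0β : vβ 0 = β)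
    (hsβ : IsSolExp k vβ vβ' vβ'')
    (hcγ : ContinuousOn vγ (Set.Ico 0 (Real.exp 1))) (h0γ : vγ 0 = γ)
    (hsγ : IsSolExp k vγ vγ' vγ'') :
    (∀ r ∈ Set.Ioo (0 : ℝ) (Real.exp 1),
      vβ r < k * Real.log (1 - Real.log r) + Real.log k) ∧
    (∀ r ∈ Set.Ioo (0 : ℝ) (Real.exp 1), vβ r < vγ r) := by
  have hr : ∀ r ∈ Ioo (0 : ℝ) (Real.exp 1), 0 < 1 - Real.log r ∧
      Real.exp (1 - (1 - Real.log r)) = r := by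
    intro r hr
    refine ⟨?_, by rw [sub_sub_cancel, Real.exp_log hr.1]⟩
    have := (Real.log_lt_iff_lt_exp hr.1).2 hr.2
    linarith
  refine ⟨fun r h => ?_, ?_⟩
  · have := part1_s8 k hk0 hk vβ vβ' vβ'' hcβ hsβ _ (hr r h).1
    rwa [(hr r h).2] at this
  have hW := part1_s8 k hk0 hk vγ vγ' vγ'' hcγ hsγ
  obtain ⟨a1, b1⟩ := transf k vβ vβ' vβ'' hsβ
  obtain ⟨a2, b2⟩ := transf k vγ vγ' vγ'' hsγ
  have hl1 := lim_u vβ hcβ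
  have hl2 := lim_u vγ hcγ
  have hl := hl2.sub hl1
  have hsq : Tendsto (fun t : ℝ => (Real.sqrt t)⁻¹) atTop (𝓝 0) :=
    tendsto_inv_atTop_zero.comp Real.tendsto_sqrt_atTop
  have key := sturm_pos _ _ _ (fun t ht => (a2 t ht).sub (a1 t ht))
    (fun t ht => (b2 t ht).sub (b1 t ht)) ?_ ?_ ?_
  · intro r h
    have := key _ (hr r h).1
    simp only [Pi.sub_apply, (hr r h).2] at this
    linarith
  · intro t ht hg
    have hw := hW t ht
    simp only [Pi.sub_apply] at hg ⊢
    generalize vγ (Real.exp (1 - t)) = x at *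
    generalize vβ (Real.exp (1 - t)) = y at *
    have htk := Real.rpow_pos_of_pos ht k
    have hx : Real.exp x ≤ k * t ^ k := by
      have : k * t ^ k = Real.exp (k * Real.log t + Real.log k) := by
        rw [Real.exp_add, Real.exp_log hk0, Real.rpow_def_of_pos ht]; ring_nf
      rw [this]
      exact Real.exp_le_exp.2 hw.le
    have hy : Real.exp x * (1 - (x - y)) ≤ Real.exp y := by
      have : Real.exp y = Real.exp x * Real.exp (y - x) := by rw [← Real.exp_add]; ring_nf
      rw [this]
      have := Real.add_one_le_exp (y - x)
      exact mul_le_mul_of_nonneg_left (by linarith) (Real.exp_pos _).le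
    have e : -(Real.exp x / (t ^ 2 * t ^ k)) - -(Real.exp y / (t ^ 2 * t ^ k))
        - -((x - y) / (4 * t ^ 2)) =
        (Real.exp y - Real.exp x + t ^ k / 4 * (x - y)) / (t ^ 2 * t ^ k) := by
      field_simp
      ring
    have : 0 ≤ (Real.exp y - Real.exp x + t ^ k / 4 * (x - y)) / (t ^ 2 * t ^ k) := by
      apply div_nonneg _ (by positivity)
      have h5 : Real.exp x ≤ t ^ k / 4 := by nlinarith
      have := mul_le_mul_of_nonneg_right h5 hg.le
      linarith
    linarith
  · have : 0 < vγ 0 - vβ 0 := by rw [h0β, h0γ]; linarith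
    exact hl.eventually_const_lt this
  · have := hl.mul hsq
    simpa only [mul_zero, div_eq_mul_inv, Pi.sub_apply] using this
end
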